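/- For all integers k ≥ 3 and every real μ > 0, there exists n_0 such that every k-graph H on n ≥ n_0 vertices whose minimum relative (k−2)-degree is at least 5/9 + μ contains a tight Hamilton cycle. (Equivalently, hc_{k−2}(k) ≤ 5/9; together with the Han–Zhao lower bound this gives hc_{k−2}(k) = 5/9.) -/

import Mathlib

open Finset

variable {A : Type*} [DecidableEq A]

def walkEdgeAt (k : ℕ) (w : List A) (i : ℕ) : Finset A :=
  ((w.drop i).take k).toFinset

def IsTightWalk (k : ℕ) (E : Finset (Finset A)) (w : List A) : Prop :=
  k ≤ w.length ∧ ∀ i, i + k ≤ w.length → walkEdgeAt k w i ∈ E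

def EdgeOnWalk (k : ℕ) (w : List A) (e : Finset A) : Prop :=
  ∃ i, i + k ≤ w.length ∧ walkEdgeAt k w i = e

def TightlyConnected (k : ℕ) (E : Finset (Finset A)) : Prop :=
  ∀ e₁ ∈ E, ∀ e₂ ∈ E, ∃ w : List A, IsTightWalk k E w ∧ EdgeOnWalk k w e₁ ∧ EdgeOnWalk k w e₂

def IsClosedTightWalk (k : ℕ) (E : Finset (Finset A)) (w : List A) : Prop :=
  k ≤ w.length ∧ ∀ i < w.length, ((w.rotate i).take k).toFinset ∈ E

def HasTightHamCycle (k : ℕ) (V : Finset A) (E : Finset (Finset A)) : Prop :=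
  ∃ w : List A, w.Nodup ∧ w.toFinset = V ∧ IsClosedTightWalk k E w

def shadow (j : ℕ) (E : Finset (Finset A)) : Finset (Finset A) :=
  E.biUnion fun e => e.powersetCard j

def link (S : Finset A) (E : Finset (Finset A)) : Finset (Finset A) :=
  (E.filter fun e => S ⊆ e).image fun e => e \ S

def HasFracMatching (E : Finset (Finset A)) (m : ℝ) : Prop :=
  ∃ w : Finset A → ℝ,
    (∀ e ∈ E, 0 ≤ w e ∧ w e ≤ 1) ∧
    (∀ v : A, ∑ e ∈ E.filter (fun e' => v ∈ e'), w e ≤ 1) ∧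
    m ≤ ∑ e ∈ E, w e

def HasBFracMatching (V : Finset A) (E : Finset (Finset A)) (b : A → ℝ) (m : ℝ) : Prop :=
  ∃ w : Finset A → ℝ,
    (∀ e ∈ E, 0 ≤ w e ∧ w e ≤ 1) ∧
    (∀ v ∈ V, ∑ e ∈ E.filter (fun e' => v ∈ e'), w e ≤ b v) ∧
    m ≤ ∑ e ∈ E, w e

def RobustlyMatchable (γ : ℝ) (V : Finset A) (E : Finset (Finset A)) : Prop :=
  ∀ b : A → ℝ, (∀ v ∈ V, 1 - γ ≤ b v ∧ b v ≤ 1) →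
    ∃ w : Finset A → ℝ, (∀ e ∈ E, 0 ≤ w e ∧ w e ≤ 1) ∧
      ∀ v ∈ V, ∑ e ∈ E.filter (fun e' => v ∈ e'), w e = b v

def HasSwitcher (C : Finset (Finset A)) : Prop :=
  ∃ e ∈ C, ∃ a ∈ e, ∀ b ∈ e, ∃ c, c ∉ e ∧
    insert c (e.erase a) ∈ C ∧ insert c (e.erase b) ∈ C

def HasArc (k d : ℕ) (E : Finset (Finset A)) (C : Finset A → Finset (Finset A)) : Prop :=
  ∃ l : List A, l.length = k + 1 ∧ l.Nodup ∧
    (l.take d).toFinset ∈ shadow d E ∧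
    ((l.drop d).take (k - d)).toFinset ∈ C ((l.take d).toFinset) ∧
    ((l.drop 1).take d).toFinset ∈ shadow d E ∧
    (l.drop (d + 1)).toFinset ∈ C (((l.drop 1).take d).toFinset)

def generatedEdges (d : ℕ) (E : Finset (Finset A)) (C : Finset A → Finset (Finset A)) :
    Finset (Finset A) :=
  (shadow d E).biUnion fun S => (C S).image fun B => B ∪ S

def PerturbedDegLB (k d : ℕ) (a δ : ℝ) (V : Finset A) (E : Finset (Finset A)) : Prop :=
  ∀ j : ℕ, 1 ≤ j → j ≤ d →
    (∀ S ∈ shadow j E,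
      δ * (((V.card - j).choose (k - j) : ℕ) : ℝ) ≤ ((E.filter fun e => S ⊆ e).card : ℝ)) ∧
    ((((V.powersetCard j).filter fun S => S ∉ shadow j E).card : ℝ)
        ≤ a * ((V.card.choose j : ℕ) : ℝ)) ∧
    (∀ T : Finset A, (T ∈ shadow (j - 1) E ∨ (j = 1 ∧ T = ∅)) →
      ((((V.powersetCard j).filter fun S => T ⊆ S ∧ S ∉ shadow j E).card : ℝ)
        < a * ((V.card : ℝ) - (j : ℝ) + 1)))

def IsHamVicinity (k d : ℕ) (γ δ : ℝ) (V : Finset A) (E : Finset (Finset A))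
    (C : Finset A → Finset (Finset A)) : Prop :=
  (∀ S ∈ shadow d E, C S ⊆ link S E) ∧
  (∀ S ∈ shadow d E, TightlyConnected (k - d) (C S)) ∧
  (∀ S ∈ shadow d E, ∀ S' ∈ shadow d E, (C S ∩ C S').Nonempty) ∧
  (∀ S ∈ shadow d E, HasSwitcher (C S)) ∧
  HasArc k d E C ∧
  (∀ S ∈ shadow d E, HasFracMatching (C S) ((1 / (k : ℝ) + γ) * (V.card : ℝ))) ∧
  (∀ S ∈ shadow d E, (1 - δ + γ) * ((V.card.choose (k - d) : ℕ) : ℝ) ≤ ((C S).card : ℝ))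

def IsHamFramework (k : ℕ) (a γ δ : ℝ) (VR VH : Finset A) (EH : Finset (Finset A)) : Prop :=
  (1 - a) * (VR.card : ℝ) ≤ (VH.card : ℝ) ∧
  TightlyConnected k EH ∧
  (∃ w : List A, IsClosedTightWalk k EH w ∧ w.length % k = 1 % k) ∧
  RobustlyMatchable γ VH EH ∧
  (∀ v ∈ VH, (1 - δ + γ) * (((VH.card - 1).choose (k - 1) : ℕ) : ℝ)
      ≤ ((EH.filter fun e => v ∈ e).card : ℝ))

def IsTightComponent (k : ℕ) (E C : Finset (Finset A)) : Prop :=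
  C ⊆ E ∧ TightlyConnected k C ∧
    ∀ C' : Finset (Finset A), C ⊆ C' → C' ⊆ E → TightlyConnected k C' → C' = C

def HamCycleProp (k d : ℕ) (δ : ℝ) : Prop :=
  ∀ μ : ℝ, 0 < μ → ∃ n₀ : ℕ, ∀ (B : Type) [DecidableEq B],
    ∀ (V : Finset B) (E : Finset (Finset B)),
      n₀ ≤ V.card → (∀ e ∈ E, e ⊆ V ∧ e.card = k) →
      (∀ S ⊆ V, S.card = d →
        (δ + μ) * (((V.card - d).choose (k - d) : ℕ) : ℝ)
          ≤ ((E.filter fun e => S ⊆ e).card : ℝ)) →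
      HasTightHamCycle k V E

def HamFrameworkProp (k d : ℕ) (δ : ℝ) : Prop :=
  ∀ μ : ℝ, 0 < μ → ∃ γ₀ : ℝ, 0 < γ₀ ∧ ∀ γ : ℝ, 0 < γ → γ ≤ γ₀ →
    ∃ α₀ : ℝ, 0 < α₀ ∧ ∀ a : ℝ, 0 < a → a ≤ α₀ →
      ∃ ε₀ : ℝ, 0 < ε₀ ∧ ∀ ε : ℝ, 0 < ε → ε ≤ ε₀ →
        ∃ t₀ : ℕ, ∀ t : ℕ, t₀ ≤ t →
          ∀ (B : Type) [DecidableEq B], ∀ (VR : Finset B) (ER : Finset (Finset B)),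
            VR.card = t → (∀ e ∈ ER, e ⊆ VR ∧ e.card = k) →
            (∀ S ⊆ VR, S.card = d →
              (δ + μ) * (((t - d).choose (k - d) : ℕ) : ℝ)
                ≤ ((ER.filter fun e => S ⊆ e).card : ℝ)) →
            ∀ I : Finset (Finset B), I ⊆ ER → (I.card : ℝ) ≤ ε * ((t.choose k : ℕ) : ℝ) →
              ∃ (VH : Finset B) (EH : Finset (Finset B)),
                VH ⊆ VR ∧ EH ⊆ ER ∧ (∀ e ∈ EH, e ⊆ VH) ∧ (∀ e ∈ EH, e ∉ I) ∧
                IsHamFramework k a γ δ VR VH EH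

def HamVicinityProp (k d : ℕ) (δ : ℝ) : Prop :=
  ∀ μ : ℝ, 0 < μ → ∃ γ₀ : ℝ, 0 < γ₀ ∧ ∀ γ : ℝ, 0 < γ → γ ≤ γ₀ →
    ∃ α₀ : ℝ, 0 < α₀ ∧ ∀ a : ℝ, 0 < a → a ≤ α₀ →
      ∃ t₀ : ℕ, ∀ t : ℕ, t₀ ≤ t →
        ∀ (B : Type) [DecidableEq B], ∀ (V : Finset B) (E : Finset (Finset B)),
          V.card = t → (∀ e ∈ E, e ⊆ V ∧ e.card = k) →
          PerturbedDegLB k d a (δ + μ) V E →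
          (∀ v ∈ V, ∃ e ∈ E, v ∈ e) →
          ∃ C : Finset B → Finset (Finset B), IsHamVicinity k d γ δ V E C

namespace TH
open Finset Function
open List (ofFn)
set_option linter.all false
set_option hygiene false
notation:max "Θ" => (d+3 : ℕ)
notation:max "Δ" => (d+3)
notation:max "Φ" => Fin (d+3)
notation:max "Ψ" => Fin (d+1)
notation:max "Λ" => (Fin (d+3) → V)
notation:max "Ξ" => Fintype.card V
notation:max "Ж" => Fin (BB d m b')
notation:max "Г" => Finset (Finset V)
notation:max "Щ" => (Fin m × Φ)
notation:max "Ц" => (zz d ε)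
notation:max "Ю" u:max => φ (j u.1) u.2 (i u)
notation:max "Я" => φ t.1 t.2.1 t.2.2
notation:max "Ы" => (d+1)
notation:max "Й" => (mkr p q s)
notation:max "Б" => (A \ X)
notation:max "Э" => ((Injective fun a : Ψ × Ж => (z (Sum.inl a.1) a.2).1) ∧ ∀ a : Ψ × Ж, (z (Sum.inl a.1) a.2).1 ∉ Xj)
notation:max "Л" => ∀ u, Injective fun a => (z (Sum.inr u) a).2
notation:max "И" => (ind_nonneg _)
set_option hygiene true
notation:max "§" => (by positivity)
notation:max "¶" => (by linarith)
notation:max "£" => (by simp)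
notation:max "¿" => (by omega)
notation:max "ø" => (0:ℝ)
notation:max "mll" => mul_le_mul_of_nonneg_left
notation:max "mlr" => mul_le_mul_of_nonneg_right
notation:max "dli" => div_le_iff₀
notation:max "ncn" => Nat.cast_nonneg
notation:max "pll" => pow_le_pow_left₀
notation:max "ddr" => div_le_div_of_nonneg_right
lemma ex_ {α : Sort*} (a : α) : ∃ x, x = a := ⟨a, rfl⟩
noncomputable def Ex {Ω : Type*} [Fintype Ω] (f : Ω → ℝ) : ℝ := (∑ ω, f ω) / (Fintype.card Ω : ℝ)
open scoped Classical in
noncomputable def ind (P : Prop) : ℝ := if P then 1 else 0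
lemma ind_nonneg (P : Prop) : 0 ≤ ind P := by unfold ind; split_ifs <;> norm_num
lemma ind_le_one (P : Prop) : ind P ≤ 1 := by unfold ind; split_ifs <;> norm_num
lemma ind_true {P : Prop} (h : P) : ind P = 1 := by simp [ind, h]
lemma ind_false {P : Prop} (h : ¬ P) : ind P = 0 := by simp [ind, h]
lemma ind_mono {P Q : Prop} (h : P → Q) : ind P ≤ ind Q := by
  by_cases hP : P
  · rw [ind_true hP, ind_true (h hP)]
  · rw [ind_false hP]; exact ind_nonneg Q
lemma ind_congr {P Q : Prop} (h : P ↔ Q) : ind P = ind Q := by rw [propext h]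
lemma ind_and (P Q : Prop) : ind (P ∧ Q) = ind P * ind Q := by
  by_cases hP : P <;> by_cases hQ : Q <;> simp [ind, hP, hQ]
lemma ind_not (P : Prop) : ind (¬ P) = 1 - ind P := by
  by_cases hP : P <;> simp [ind, hP]
lemma ind_or_le (P Q : Prop) : ind (P ∨ Q) ≤ ind P + ind Q := by
  by_cases hP : P <;> by_cases hQ : Q <;> simp [ind, hP, hQ]
lemma ind_le_add (P Q : Prop) : ind P ≤ ind (P ∧ Q) + ind (¬ Q) := by
  by_cases hP : P <;> by_cases hQ : Q <;> simp [ind, hP, hQ]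
lemma ind_forall {ι : Type*} [Fintype ι] (P : ι → Prop) : ind (∀ i, P i) = ∏ i, ind (P i) := by
  by_cases h : ∀ i, P i
  · rw [ind_true h, Finset.prod_eq_one]; intro i _; exact ind_true (h i)
  · rw [ind_false h]; push Not at h; obtain ⟨i, hi⟩ := h
    exact (Finset.prod_eq_zero (mem_univ i) (ind_false hi)).symm
lemma ind_exists_le {ι : Type*} (s : Finset ι) (P : ι → Prop) :
    ind (∃ i ∈ s, P i) ≤ ∑ i ∈ s, ind (P i) := by
  by_cases h : ∃ i ∈ s, P i
  · rw [ind_true h]; obtain ⟨i, hi, hp⟩ := h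
    rw [← ind_true hp]; exact Finset.single_le_sum (f := fun i => ind (P i)) (fun i _ => ind_nonneg _) hi
  · rw [ind_false h]; exact Finset.sum_nonneg fun i _ => ind_nonneg _
section
variable {Ω Ω' : Type*} [Fintype Ω] [Fintype Ω']
lemma Ex_nonneg {f : Ω → ℝ} (h : ∀ ω, 0 ≤ f ω) : 0 ≤ Ex f :=
  div_nonneg (Finset.sum_nonneg fun i _ => h i) (ncn _)
lemma Ex_mono {f g : Ω → ℝ} (h : ∀ ω, f ω ≤ g ω) : Ex f ≤ Ex g :=
  ddr (Finset.sum_le_sum fun i _ => h i) (ncn _)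
lemma Ex_congr {f g : Ω → ℝ} (h : ∀ ω, f ω = g ω) : Ex f = Ex g := by
  rw [show f = g from funext h]
lemma Ex_const [Nonempty Ω] (c : ℝ) : Ex (fun _ : Ω => c) = c := by
  have : (Fintype.card Ω : ℝ) ≠ 0 := by exact_mod_cast Fintype.card_ne_zero
  simp [Ex]
lemma Ex_add (f g : Ω → ℝ) : Ex (fun ω => f ω + g ω) = Ex f + Ex g := by
  simp [Ex, Finset.sum_add_distrib, add_div]
lemma Ex_sub (f g : Ω → ℝ) : Ex (fun ω => f ω - g ω) = Ex f - Ex g := by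
  simp [Ex, Finset.sum_sub_distrib, sub_div]
lemma Ex_mul_left (c : ℝ) (f : Ω → ℝ) : Ex (fun ω => c * f ω) = c * Ex f := by
  simp [Ex, ← Finset.mul_sum, mul_div_assoc]
lemma Ex_mul_right (c : ℝ) (f : Ω → ℝ) : Ex (fun ω => f ω * c) = Ex f * c := by
  simp [Ex, ← Finset.sum_mul]; ring
lemma Ex_sum {ι : Type*} (s : Finset ι) (f : ι → Ω → ℝ) :
    Ex (fun ω => ∑ i ∈ s, f i ω) = ∑ i ∈ s, Ex (f i) := by
  simp only [Ex]; rw [Finset.sum_comm, Finset.sum_div]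
lemma Ex_prod (f : Ω × Ω' → ℝ) : Ex f = Ex fun a => Ex fun b => f (a, b) := by
  simp only [Ex, Fintype.sum_prod_type, Fintype.card_prod, Nat.cast_mul, ← Finset.sum_div]
  rw [div_div, mul_comm]
lemma Ex_comm (f : Ω → Ω' → ℝ) : (Ex fun a => Ex fun b => f a b) = Ex fun b => Ex fun a => f a b := by
  simp only [Ex, ← Finset.sum_div]
  rw [Finset.sum_comm, div_div, div_div, mul_comm]
lemma Ex_equiv (e : Ω ≃ Ω') (f : Ω' → ℝ) : (Ex fun ω => f (e ω)) = Ex f := by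
  simp only [Ex, Fintype.card_congr e, Equiv.sum_comp e f]
lemma Ex_le_one {f : Ω → ℝ} (h : ∀ ω, f ω ≤ 1) : Ex f ≤ 1 := by
  rcases isEmpty_or_nonempty Ω with hE | hE
  · simp [Ex]
  · exact (Ex_mono h).trans (Ex_const (Ω := Ω) 1).le
lemma Ex_exists_ge [Nonempty Ω] (f : Ω → ℝ) : ∃ ω, Ex f ≤ f ω := by
  by_contra! h
  have h2 : ∑ ω, f ω < ∑ _ω : Ω, Ex f := Finset.sum_lt_sum_of_nonempty univ_nonempty fun i _ => h i
  have : (Fintype.card Ω : ℝ) ≠ 0 := by exact_mod_cast Fintype.card_ne_zero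
  simp [Ex] at h2; field_simp at h2; exact lt_irrefl _ h2
lemma Ex_ind_exists {P : Ω → Prop} (h : 0 < Ex fun ω => ind (P ω)) : ∃ ω, P ω := by
  by_contra! h2
  rw [Ex_congr fun ω => ind_false (h2 ω)] at h
  simp [Ex] at h
lemma Ex_ind_le_one (P : Ω → Prop) : (Ex fun ω => ind (P ω)) ≤ 1 := Ex_le_one fun _ => ind_le_one _
lemma Ex_ind_nonneg (P : Ω → Prop) : 0 ≤ (Ex fun ω => ind (P ω)) := Ex_nonneg fun _ => ind_nonneg _
lemma Ex_ind_mono {P Q : Ω → Prop} (h : ∀ ω, P ω → Q ω) :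
    (Ex fun ω => ind (P ω)) ≤ Ex fun ω => ind (Q ω) := Ex_mono fun ω => ind_mono (h ω)
lemma Ex_ind_or_le (P Q : Ω → Prop) :
    (Ex fun ω => ind (P ω ∨ Q ω)) ≤ (Ex fun ω => ind (P ω)) + Ex fun ω => ind (Q ω) := by
  rw [← Ex_add]; exact Ex_mono fun ω => ind_or_le _ _
lemma Ex_ind_le_add (P Q : Ω → Prop) :
    (Ex fun ω => ind (P ω)) ≤ (Ex fun ω => ind (P ω ∧ Q ω)) + Ex fun ω => ind (¬ Q ω) := by
  rw [← Ex_add]; exact Ex_mono fun ω => ind_le_add _ _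
lemma Ex_ind_not [Nonempty Ω] (P : Ω → Prop) :
    (Ex fun ω => ind (¬ P ω)) = 1 - Ex fun ω => ind (P ω) := by
  rw [Ex_congr fun ω => ind_not (P ω), Ex_sub, Ex_const]
lemma Ex_pow_le [Nonempty Ω] {f : Ω → ℝ} (h : ∀ ω, 0 ≤ f ω) (b : ℕ) : (Ex f) ^ b ≤ Ex fun ω => f ω ^ b := by
  have := Real.pow_arith_mean_le_arith_mean_pow (univ : Finset Ω) (fun _ => 1 / (Fintype.card Ω : ℝ)) f
    (fun i _ => by positivity) (by simp [Finset.card_univ]) (fun i _ => h i) b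
  simpa [Ex, ← Finset.mul_sum, div_eq_inv_mul] using this
lemma Ex_ind_card (s : Finset Ω) : (Ex fun ω => ind (ω ∈ s)) = (s.card : ℝ) / Fintype.card Ω := by
  simp [Ex, ind]
lemma Ex_markov {f : Ω → ℝ} (h0 : ∀ ω, 0 ≤ f ω) {t : ℝ} :
    t * (Ex fun ω => ind (t ≤ f ω)) ≤ Ex f := by
  rw [← Ex_mul_left]; refine Ex_mono fun ω => ?_
  by_cases h : t ≤ f ω
  · rw [ind_true h]; linarith
  · rw [ind_false h]; linarith [h0 ω]
lemma Ex_rev [Nonempty Ω] {f : Ω → ℝ} (h1 : ∀ ω, f ω ≤ 1) {t : ℝ} (ht : 0 ≤ t) :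
    Ex f - t ≤ Ex fun ω => ind (t ≤ f ω) := by
  have : Ex f ≤ Ex fun ω => ind (t ≤ f ω) + t := Ex_mono fun ω => by
    by_cases h : t ≤ f ω
    · rw [ind_true h]; linarith [h1 ω]
    · rw [ind_false h]; linarith
  rw [Ex_add, Ex_const] at this; linarith
end
section
variable {V : Type*} [Fintype V]
lemma Ex_pi_prod {ι : Type*} [Fintype ι] [DecidableEq ι] (h : ι → V → ℝ) :
    (Ex fun x : ι → V => ∏ i, h i (x i)) = ∏ i, Ex (h i) := by
  simp only [Ex, Finset.prod_div_distrib, Fintype.card_pi, Nat.cast_prod]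
  congr 1
  rw [Finset.prod_univ_sum]; simp [Fintype.piFinset_univ]
lemma Ex_cons {r : ℕ} (f : (Fin (r+1) → V) → ℝ) :
    Ex f = Ex fun a => Ex fun y : Fin r → V => f (Fin.cons a y) := by
  rw [← Ex_equiv (Fin.consEquiv (fun _ : Fin (r+1) => V)) f, Ex_prod]; rfl
lemma Ex_append {r s : ℕ} (f : (Fin (r+s) → V) → ℝ) :
    Ex f = Ex fun a : Fin r → V => Ex fun b : Fin s → V => f (Fin.append a b) := by
  rw [← Ex_equiv (Fin.appendEquiv r s) f, Ex_prod]; rfl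
lemma Ex_marginal [Nonempty V] {ι κ : Type*} [Fintype ι] [DecidableEq ι] [Fintype κ] [DecidableEq κ]
    (φ : κ → ι) (hφ : Function.Injective φ) (f : (κ → V) → ℝ) :
    (Ex fun x : ι → V => f (fun j => x (φ j))) = Ex f := by
  classical
  rw [← Ex_equiv (Equiv.piEquivPiSubtypeProd (fun i => i ∈ Set.range φ) (fun _ => V)).symm, Ex_prod]
  have e := Equiv.ofInjective φ hφ
  rw [← Ex_equiv (Equiv.arrowCongr (Equiv.ofInjective φ hφ) (Equiv.refl V)) (fun a : (Set.range φ → V) => Ex _)]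
  refine Ex_congr fun z => ?_
  rw [← Ex_const (Ω := {i // i ∉ Set.range φ} → V) (f z)]
  refine Ex_congr fun b => ?_
  congr 1; ext j
  simp [Equiv.piEquivPiSubtypeProd, Equiv.arrowCongr]
lemma Ex_coord [Nonempty V] {ι : Type*} [Fintype ι] [DecidableEq ι] (i : ι) (f : V → ℝ) :
    (Ex fun x : ι → V => f (x i)) = Ex f := by
  rw [Ex_marginal (fun _ : Unit => i) (fun _ _ _ => rfl) (fun z : Unit → V => f (z ()))]
  exact Ex_equiv (Equiv.funUnique Unit V) f
lemma Ex_coord2 [Nonempty V] {ι : Type*} [Fintype ι] [DecidableEq ι] {i j : ι} (hij : i ≠ j) (f : V → V → ℝ) :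
    (Ex fun x : ι → V => f (x i) (x j)) = Ex fun a => Ex fun b => f a b := by
  have := Ex_marginal (fun t : Fin 2 => if t = 0 then i else j) (by
    intro a b h; fin_cases a <;> fin_cases b <;> simp_all [eq_comm]) (fun z : Fin 2 → V => f (z 0) (z 1))
  simp only [if_true, one_ne_zero, if_false] at this
  rw [this, ← Ex_equiv (finTwoArrowEquiv V).symm, Ex_prod]; simp
lemma Ex_eq (a : V) : (Ex fun b => ind (a = b)) = 1 / (Ξ : ℝ) := by
  classical
  simp [Ex, ind]
lemma avoid [Nonempty V] {ι : Type*} [Fintype ι] [DecidableEq ι] (X : Finset V) :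
    (Ex fun z : ι → V => ind (¬ (Function.Injective z ∧ ∀ i, z i ∉ X))) ≤
      ((Fintype.card ι : ℝ) ^ 2 + Fintype.card ι * X.card) / Ξ := by
  classical
  have h1 : ∀ z : ι → V, ind (¬ (Function.Injective z ∧ ∀ i, z i ∉ X)) ≤
      (∑ p ∈ (univ : Finset (ι × ι)).filter (fun p => p.1 ≠ p.2), ind (z p.1 = z p.2))
       + ∑ i ∈ (univ : Finset ι), ind (z i ∈ X) := by
    intro z
    have : (¬ (Function.Injective z ∧ ∀ i, z i ∉ X)) →
      (∃ p ∈ (univ : Finset (ι × ι)).filter (fun p => p.1 ≠ p.2), z p.1 = z p.2) ∨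
        ∃ i ∈ (univ : Finset ι), z i ∈ X := by
      intro h; by_contra! h2; apply h
      refine ⟨fun a b hab => ?_, fun i => h2.2 i (mem_univ _)⟩
      by_contra hne; exact h2.1 (a, b) (by simp [hne]) hab
    exact (ind_mono this).trans ((ind_or_le _ _).trans (add_le_add (ind_exists_le _ _) (ind_exists_le _ _)))
  refine (Ex_mono h1).trans ?_
  rw [Ex_add, Ex_sum, Ex_sum, add_div]
  refine add_le_add ?_ ?_
  · rw [Finset.sum_congr rfl (g := fun _ => 1 / (Ξ : ℝ))]
    · simp only [sum_const, nsmul_eq_mul, mul_one_div]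
      gcongr
      calc ((#(filter (fun p : ι × ι => p.1 ≠ p.2) univ) : ℕ) : ℝ) ≤ (#(univ : Finset (ι × ι)) : ℝ) := by
            exact_mod_cast Finset.card_filter_le _ _
        _ = _ := by simp [sq]
    · intro p hp; simp at hp
      rw [Ex_coord2 hp (fun a b => ind (a = b)), Ex_congr fun a => Ex_eq a, Ex_const]
  · rw [Finset.sum_congr rfl (g := fun _ => (X.card : ℝ) / (Ξ : ℝ))]
    · simp [mul_div_assoc]
    · intro i _; rw [Ex_coord i (fun a => ind (a ∈ X)), Ex_ind_card]
end
section
variable {V : Type*} [Fintype V] [DecidableEq V]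
noncomputable def ms (X : Finset V) : ℝ := Ex fun x => ind (x ∈ X)
noncomputable def ee (G : V → V → Prop) (X Y : Finset V) : ℝ :=
  Ex fun x => Ex fun y => ind (x ∈ X) * ind (y ∈ Y) * ind (G x y)
lemma ms_nonneg (X : Finset V) : 0 ≤ ms X := Ex_ind_nonneg _
lemma ms_le_one (X : Finset V) : ms X ≤ 1 := Ex_ind_le_one _
lemma ms_mono {X Y : Finset V} (h : X ⊆ Y) : ms X ≤ ms Y := Ex_ind_mono fun _ h' => h h'
lemma ind_mem_add {X A : Finset V} (h : X ⊆ A) (x : V) : ind (x ∈ A) = ind (x ∈ X) + ind (x ∈ A \ X) := by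
  by_cases h1 : x ∈ X
  · simp [ind, h1, h h1]
  · by_cases h2 : x ∈ A <;> simp [ind, h1, h2]
lemma ms_add {X A : Finset V} (h : X ⊆ A) : ms A = ms X + ms Б := by
  unfold ms; rw [← Ex_add]; exact Ex_congr fun x => ind_mem_add h x
lemma ms_univ [Nonempty V] : ms (univ : Finset V) = 1 := by
  unfold ms; rw [← Ex_const (Ω := V) 1]; exact Ex_congr fun x => ind_true (mem_univ x)
lemma ms_single (x : V) : ms ({x} : Finset V) = 1 / Ξ := by
  unfold ms; rw [Ex_ind_card]; simp
lemma ee_add_left (G : V → V → Prop) {X A : Finset V} (h : X ⊆ A) (Y : Finset V) :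
    ee G A Y = ee G X Y + ee G Б Y := by
  unfold ee; rw [← Ex_add]; refine Ex_congr fun x => ?_
  rw [← Ex_add]; refine Ex_congr fun y => ?_
  rw [ind_mem_add h]; ring
lemma ee_comm {G : V → V → Prop} (hG : ∀ x y, G x y → G y x) (X Y : Finset V) : ee G X Y = ee G Y X := by
  unfold ee; rw [Ex_comm]; refine Ex_congr fun x => Ex_congr fun y => ?_
  rw [ind_congr (⟨hG y x, hG x y⟩ : G y x ↔ G x y)]; ring
lemma ee_add_right (G : V → V → Prop) {X A : Finset V} (h : X ⊆ A) (Y : Finset V) :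
    ee G Y A = ee G Y X + ee G Y Б := by
  unfold ee; rw [← Ex_add]; refine Ex_congr fun x => ?_
  rw [← Ex_add]; refine Ex_congr fun y => ?_
  rw [ind_mem_add h]; ring
lemma ee_nonneg (G : V → V → Prop) (X Y : Finset V) : 0 ≤ ee G X Y :=
  Ex_nonneg fun _ => Ex_nonneg fun _ => mul_nonneg (mul_nonneg И И) И
lemma ee_le_mul (G : V → V → Prop) (X Y : Finset V) : ee G X Y ≤ ms X * ms Y := by
  unfold ee ms
  rw [← Ex_mul_right]; refine Ex_mono fun x => ?_
  rw [← Ex_mul_left]; refine Ex_mono fun y => ?_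
  exact mul_le_of_le_one_right (mul_nonneg И И) (ind_le_one _)
lemma ee_mono (G : V → V → Prop) {X X' Y Y' : Finset V} (h : X ⊆ X') (h' : Y ⊆ Y') :
    ee G X Y ≤ ee G X' Y' := by
  refine Ex_mono fun x => Ex_mono fun y => ?_
  refine mlr (mul_le_mul (ind_mono fun a => h a) (ind_mono fun a => h' a) И
    И) И
lemma core [Nonempty V] {G : V → V → Prop} (hG : ∀ x y, G x y → G y x) {μ β : ℝ} (hβ : 0 < β)
    (hβμ : 4 * β ≤ μ) (h : 5/9 + μ ≤ Ex fun x => Ex fun y => ind (G x y)) :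
    ∃ A : Finset V, 2/3 ≤ ms A ∧ 5/9 + μ - 2 * β - (1 - ms A)^2 ≤ ee G A A ∧
      ∀ X ⊆ A, β * ms X * ms Б ≤ ee G X Б := by
  classical
  have hu : ee G univ univ = Ex fun x => Ex fun y => ind (G x y) :=
    Ex_congr fun x => Ex_congr fun y => by simp [ind]
  have tot : ∀ A : Finset V, ee G univ univ = ee G A A + 2 * ee G A (univ \ A) + ee G (univ \ A) (univ \ A) := by
    intro A
    rw [ee_add_left G (subset_univ A), ee_add_right G (subset_univ A) A,
      ee_add_right G (subset_univ A) (univ \ A), ee_comm hG (univ \ A) A]; ring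
  have mc : ∀ A : Finset V, ms (univ \ A) = 1 - ms A := by
    intro A; have := ms_add (subset_univ A); rw [ms_univ] at this; linarith
  let Q : Finset V → Prop := fun A => 2/3 ≤ ms A ∧ ee G A (univ \ A) ≤ β * (1 - ms A)
  have hQu : Q univ := by
    refine ⟨by rw [ms_univ]; norm_num, ?_⟩
    have := ee_le_mul G univ (univ \ univ); rw [mc, ms_univ] at this; rw [ms_univ]; linarith
  obtain ⟨A, hAmem, hmin⟩ := Finset.exists_min_image ((univ : Г).filter Q) card
    ⟨univ, by simp [hQu]⟩
  have hA : Q A := (mem_filter.1 hAmem).2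
  refine ⟨A, hA.1, ?_, ?_⟩
  · have h1 := tot A; have h2 := ee_le_mul G (univ \ A) (univ \ A); rw [mc] at h2
    have h3 := hA.2; nlinarith [ms_nonneg A]
  · have key : ∀ X ⊆ A, ms X ≤ ms Б → β * ms X * ms Б ≤ ee G X Б := by
      intro X hX hle
      by_contra! hlt
      have hXne : X.Nonempty := by
        rw [nonempty_iff_ne_empty]; rintro rfl
        have := ee_nonneg G ∅ (A \ ∅)
        have h0 : ms (∅ : Finset V) = 0 := by simp [ms, ind, Ex]
        rw [h0] at hlt; simp at hlt; simp at this; linarith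
      have hsub : A \ X ⊆ univ \ X := sdiff_subset_sdiff (subset_univ _) le_rfl
      have e1 : univ \ Б = (univ \ A) ∪ X := by
        ext v; simp; tauto
      have hXs : X ⊆ univ \ Б := by rw [e1]; exact subset_union_right
      have e2 : (univ \ Б) \ X = univ \ A := by
        ext v; simp; constructor
        · rintro ⟨h1, h2⟩ h3; exact h2 (h1 h3)
        · intro h1; exact ⟨fun h => absurd h h1, fun h => h1 (hX h)⟩
      have ha := ms_add hX
      have hcut : ee G Б (univ \ Б) ≤ β * (1 - ms Б) := by
        rw [ee_add_right G hXs, e2, ee_comm hG Б X]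
        have := ee_mono G (sdiff_subset : A \ X ⊆ A) (le_refl (univ \ A))
        have h3 := hA.2
        have h4 : β * ms X * ms Б ≤ β * ms X := by
          have := ms_le_one Б
          exact mul_le_of_le_one_right (mul_nonneg hβ.le (ms_nonneg _)) this
        have : β * (1 - ms Б) = β * (1 - ms A) + β * ms X := by rw [ha]; ring
        linarith
      have hQ' : Q Б := by
        refine ⟨?_, hcut⟩
        by_contra! hlt2
        have h1 := tot Б; have h2 := ee_le_mul G (univ \ Б) (univ \ Б); rw [mc] at h2
        have h3 := ee_le_mul G Б Б
        have h5 : 1/3 ≤ ms Б := by have := hA.1; linarith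
        have h6 : β * (1 - ms Б) ≤ β := by nlinarith
        nlinarith
      have := hmin Б (by simp [hQ'])
      have h7 : Б.card < A.card := card_lt_card (by
        refine ⟨sdiff_subset, fun hs => ?_⟩
        obtain ⟨x, hx⟩ := hXne
        have := hs (hX hx); simp [hx] at this)
      omega
    intro X hX
    rcases le_total (ms X) (ms Б) with h1 | h1
    · exact key X hX h1
    · have := key Б sdiff_subset (by rwa [Finset.sdiff_sdiff_eq_self hX])
      rw [Finset.sdiff_sdiff_eq_self hX, ee_comm hG] at this; linarith
lemma dcover {K : V → V → Prop} (hK : ∀ x y, K x y → K y x) {A X Y : Finset V} {β γ ε : ℝ}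
    (hβ : 0 < β) (hβ1 : β ≤ 1) (hγ : 0 < γ) (hγ1 : γ ≤ 1/200) (hε : 2 * ε ≤ β * γ ^ 2) (hX : X ⊆ A) (hY : Y ⊆ A)
    (hcut : ∀ X ⊆ A, β * ms X * ms Б ≤ ee K X Б)
    (hbig : ms A ^ 2 / 2 + 1/18 ≤ ee K A A) (hXm : γ < ms X)
    (h1 : ee K X (A \ Y) ≤ ε) (h2 : ee K Y Б ≤ ε) : ms Б ≤ γ := by
  have cl : ∀ C ⊆ A, ee K C (A \ C) ≤ 2 * ε → ms C ≤ γ ∨ ms (A \ C) ≤ γ := by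
    intro C hC h
    by_contra! h'
    have := hcut C hC
    have h3 : γ * γ < ms C * ms (A \ C) := mul_lt_mul'' h'.1 h'.2 hγ.le hγ.le
    have h4 : β * (γ * γ) < β * (ms C * ms (A \ C)) := mul_lt_mul_of_pos_left h3 hβ
    nlinarith
  have sA : ∀ {P Q : Finset V}, P ⊆ Q → ee K P P ≤ ee K Q Q := fun h => ee_mono K h h
  rcases cl (X ∩ Y) (inter_subset_left.trans hX) (by
    have e : A \ X ⊆ A \ (X ∩ Y) := sdiff_subset_sdiff le_rfl inter_subset_left
    rw [ee_add_right K e]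
    have a1 := ee_mono K (inter_subset_right : X ∩ Y ⊆ Y) (le_refl Б)
    have a2 : ee K (X ∩ Y) ((A \ (X ∩ Y)) \ Б) ≤ ee K X (A \ Y) := ee_mono K inter_subset_left (by
      intro v; simp; tauto)
    linarith) with hC | hC
  swap
  · exact (ms_mono (sdiff_subset_sdiff le_rfl inter_subset_left)).trans hC
  rcases cl (A \ (X ∪ Y)) sdiff_subset (by
    have e : A \ (A \ (X ∪ Y)) = X ∪ Y := Finset.sdiff_sdiff_eq_self (union_subset hX hY)
    rw [e, ee_add_right K (subset_union_left : X ⊆ X ∪ Y)]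
    have a1 : ee K (A \ (X ∪ Y)) X ≤ ee K (A \ Y) X := ee_mono K (sdiff_subset_sdiff le_rfl subset_union_right) le_rfl
    have a2 : ee K (A \ (X ∪ Y)) ((X ∪ Y) \ X) ≤ ee K Б Y :=
      ee_mono K (sdiff_subset_sdiff le_rfl subset_union_left) (by intro v; simp; tauto)
    rw [ee_comm hK] at a1; rw [ee_comm hK Б] at a2
    rw [ee_comm hK X] at a1
    have := ee_comm hK (A \ Y) X
    have := ee_comm hK X (A \ (X ∪ Y))
    linarith) with hZ | hZ
  swap
  · rw [Finset.sdiff_sdiff_eq_self (union_subset hX hY)] at hZ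
    have := ms_mono (subset_union_left : X ⊆ X ∪ Y); linarith
  exfalso
  set P := X \ Y
  set Q := Y \ X
  have hPA : P ⊆ A := sdiff_subset.trans hX
  have hQA : Q ⊆ A \ P := by intro v; simp [P, Q]; intro a b; exact ⟨hY a, fun c => absurd c b⟩
  set R := (A \ P) \ Q
  have hR : ms R ≤ 2 * γ := by
    have e : X ∩ Y ⊆ R := by
      intro v; simp [R, P, Q]; intro a b; exact ⟨⟨hX a, fun _ => b⟩, fun _ => a⟩
    rw [ms_add e]
    have : R \ (X ∩ Y) ⊆ A \ (X ∪ Y) := by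
      intro v; simp [R, P, Q]; tauto
    have := ms_mono this; linarith
  have m1 := ms_add hPA
  have m2 := ms_add hQA
  have p1 : ee K P P ≤ ε := (ee_mono K sdiff_subset (by intro v; simp [P]; intro a b; exact ⟨hX a, b⟩)).trans h1
  have p2 : ee K Q Q ≤ ε := (ee_mono K sdiff_subset (by intro v; simp [Q]; intro a b; exact ⟨hY a, b⟩)).trans h2
  have p3 := ee_le_mul K P Q
  have p4 := ee_le_mul K R A
  have p5 := ee_le_mul K A R
  have q1 : ee K A A ≤ ee K P P + 2 * ee K P Q + ee K Q Q + ee K R A + ee K A R := by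
    rw [ee_add_left K hPA A, ee_add_left K hQA A]
    rw [ee_add_right K hPA P, ee_add_right K hQA P, ee_add_right K hPA Q, ee_add_right K hQA Q]
    rw [ee_add_left K hPA R, ee_add_left K hQA R, ee_comm hK Q P]
    have := ee_nonneg K R R
    linarith
  have a1 := ms_le_one A
  have r0 := ms_nonneg R
  have pp := ms_nonneg P
  have qq := ms_nonneg Q
  have aa := ms_nonneg A
  have z1 : ms R * ms A ≤ 2 * γ := by linarith [mul_le_of_le_one_right r0 a1]
  have z2 : (ms P + ms Q)^2 ≤ ms A ^ 2 := by
    have : ms P + ms Q ≤ ms A := by linarith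
    exact pll ¶ this 2
  have z3 : β * γ ^ 2 ≤ γ ^ 2 := mul_le_of_le_one_left (sq_nonneg γ) ¶
  have z4 : γ ^ 2 ≤ γ := by rw [sq]; exact mul_le_of_le_one_left hγ.le ¶
  linarith [sq_nonneg (ms P - ms Q)]
noncomputable def Wk (K : V → V → Prop) : ℕ → V → V → ℝ
  | 0, x, y => ind (K x y)
  | L+1, x, y => Ex fun z => Wk K L x z * ind (K z y)
lemma Wk_nonneg (K : V → V → Prop) (L : ℕ) (x y : V) : 0 ≤ Wk K L x y := by
  induction L generalizing y with
  | zero => exact ind_nonneg _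
  | succ L ih => exact Ex_nonneg fun z => mul_nonneg (ih z) И
lemma Wk_le_one (K : V → V → Prop) (L : ℕ) (x y : V) : Wk K L x y ≤ 1 := by
  induction L generalizing y with
  | zero => exact ind_le_one _
  | succ L ih => exact Ex_le_one fun z => mul_le_one₀ (ih z) И (ind_le_one _)
lemma Wk_step (K : V → V → Prop) (L : ℕ) (x y : V) {c η : ℝ} (hc : 0 ≤ c) {D : Finset V}
    (hD : ∀ z ∈ D, c ≤ Wk K L x z) (h : η ≤ Ex fun z => ind (z ∈ D) * ind (K z y)) :
    c * η ≤ Wk K (L+1) x y := by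
  refine (mll h hc).trans ?_
  rw [← Ex_mul_left]; refine Ex_mono fun z => ?_
  rw [← mul_assoc]; refine mlr ?_ И
  by_cases hz : z ∈ D
  · rw [ind_true hz]; linarith [hD z hz]
  · rw [ind_false hz]; linarith [Wk_nonneg K L x z]
noncomputable def ph (δ c : ℝ) : ℝ := c^3 * δ^2 / 8
lemma Wk_len [Nonempty V] {K : V → V → Prop} (hK : ∀ x y, K x y → K y x) {A : Finset V}
    (hA : ∀ x y, K x y → x ∈ A)
    {δ : ℝ} (hδ : 0 ≤ δ) (hdeg : ∀ x ∈ A, δ ≤ Ex fun y => ind (K x y)) (L : ℕ) (x y : V) {c : ℝ} (hc : 0 ≤ c)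
    (h : c ≤ Wk K (L+1) x y) : ph δ c ≤ Wk K (L+3) x y := by
  classical
  let Z : Finset V := univ.filter fun z => c/2 ≤ Wk K L x z ∧ K z y
  have hZ1 : c / 2 ≤ Ex fun z => ind (z ∈ Z) := by
    have h2 : Wk K (L+1) x y ≤ Ex fun z => ind (z ∈ Z) + c/2 := Ex_mono fun z => by
      by_cases hz : z ∈ Z
      · rw [ind_true hz]
        have := mul_le_one₀ (Wk_le_one K L x z) (ind_nonneg (K z y)) (ind_le_one _); linarith
      · rw [ind_false hz]
        by_cases hk : K z y
        · have : ¬ c/2 ≤ Wk K L x z := fun h' => hz (by simp [Z, h', hk])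
          rw [ind_true hk]; linarith
        · rw [ind_false hk]; linarith
    rw [Ex_add, Ex_const] at h2; linarith
  let hh : V → ℝ := fun u => Ex fun z => ind (z ∈ Z) * ind (K z u)
  have hh0 : ∀ u, 0 ≤ hh u := fun u => Ex_nonneg fun z => mul_nonneg И И
  have hhE : c/2 * δ ≤ Ex hh := by
    rw [show Ex hh = Ex fun z => Ex fun u => ind (z ∈ Z) * ind (K z u) from Ex_comm _]
    refine (mlr hZ1 hδ).trans ?_
    rw [← Ex_mul_right]; refine Ex_mono fun z => ?_
    rw [Ex_mul_left]
    by_cases hz : z ∈ Z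
    · exact mll (hdeg z (hA z y (mem_filter.1 hz).2.2)) И
    · rw [ind_false hz]; simp
  have h1 : ∀ u, c/2 * hh u ≤ Wk K (L+1) x u := fun u =>
    Wk_step K L x u ¶ (D := Z) (fun z hz => (mem_filter.1 hz).2.1) le_rfl
  have h3 : (Ex fun u => c/2 * hh u * hh u) ≤ Wk K (L+3) x y := by
    have : ∀ z', (Ex fun u => (c/2 * hh u) * ind (K u z')) ≤ Wk K (L+2) x z' := fun z' =>
      Ex_mono fun u => mlr (h1 u) И
    have h4 : (Ex fun z' => (Ex fun u => (c/2 * hh u) * ind (K u z')) * ind (K z' y)) ≤ Wk K (L+3) x y :=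
      Ex_mono fun z' => mlr (this z') И
    refine le_trans ?_ h4
    have : (Ex fun u => c/2 * hh u * hh u) =
        Ex fun z' => (Ex fun u => (c/2 * hh u) * ind (K u z')) * ind (z' ∈ Z) := by
      rw [Ex_congr (fun z' => (Ex_mul_right _ _).symm), Ex_comm]
      refine Ex_congr fun u => ?_
      show _ * (Ex fun z => ind (z ∈ Z) * ind (K z u)) = _
      rw [← Ex_mul_left]; refine Ex_congr fun z => ?_
      rw [ind_congr (⟨hK z u, hK u z⟩ : K z u ↔ K u z)]; ring
    rw [this]
    refine Ex_mono fun z' => mll (ind_mono fun hz => (mem_filter.1 hz).2.2) ?_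
    exact Ex_nonneg fun u => mul_nonneg (mul_nonneg ¶ (hh0 u)) И
  refine le_trans ?_ h3
  have h5 : (Ex hh)^2 ≤ Ex fun u => hh u ^ 2 := Ex_pow_le hh0 2
  have h6 : (Ex fun u => c/2 * hh u * hh u) = c/2 * Ex fun u => hh u ^ 2 := by
    rw [← Ex_mul_left]; exact Ex_congr fun u => by ring
  rw [h6]; unfold ph
  have h7 : (c/2*δ)^2 ≤ (Ex hh)^2 := pll § hhE 2
  calc c^3*δ^2/8 = c/2 * (c/2*δ)^2 := by ring
    _ ≤ _ := mll (h7.trans h5) ¶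
noncomputable def cj (δ η : ℝ) : ℕ → ℝ
  | 0 => δ^2/2
  | j+1 => ph δ (η * cj δ η j)
noncomputable def ej (δ c : ℝ) : ℕ → ℝ
  | 0 => c
  | j+1 => ph δ (ej δ c j)
lemma ph_pos {δ c : ℝ} (hδ : 0 < δ) (hc : 0 < c) : 0 < ph δ c := by unfold ph; positivity
lemma ph_le {δ c : ℝ} (hδ : 0 < δ) (hδ1 : δ ≤ 1) (hc : 0 < c) (hc1 : c ≤ 1) : ph δ c ≤ c := by
  unfold ph
  have h1 : c^2 ≤ 1 := pow_le_one₀ hc.le hc1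
  have h2 : δ^2 ≤ 1 := pow_le_one₀ hδ.le hδ1
  have h3 : c^2*δ^2 ≤ 1 := mul_le_one₀ h1 § h2
  nlinarith
lemma ph_mono {δ c c' : ℝ} (hc : 0 ≤ c) (h : c ≤ c') : ph δ c ≤ ph δ c' := by unfold ph; gcongr
lemma cj_pos {δ η : ℝ} (hδ : 0 < δ) (hη : 0 < η) (j : ℕ) : 0 < cj δ η j := by
  induction j with
  | zero => simp only [cj]; positivity
  | succ j ih => exact ph_pos hδ (mul_pos hη ih)
lemma cj_succ_le {δ η : ℝ} (hδ : 0 < δ) (hδ1 : δ ≤ 1) (hη : 0 < η) (hη1 : η ≤ 1) (j : ℕ) :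
    cj δ η j ≤ 1 ∧ cj δ η (j+1) ≤ η * cj δ η j := by
  have step : ∀ j, cj δ η j ≤ 1 → cj δ η (j+1) ≤ η * cj δ η j := fun j h =>
    ph_le hδ hδ1 (mul_pos hη (cj_pos hδ hη j)) (mul_le_one₀ hη1 (cj_pos hδ hη j).le h)
  have h1 : cj δ η j ≤ 1 := by
    induction j with
    | zero => simp only [cj]; nlinarith
    | succ j ih => exact (step j ih).trans (mul_le_one₀ hη1 (cj_pos hδ hη j).le ih)
  exact ⟨h1, step j h1⟩
lemma cj_anti {δ η : ℝ} (hδ : 0 < δ) (hδ1 : δ ≤ 1) (hη : 0 < η) (hη1 : η ≤ 1) : Antitone (cj δ η) :=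
  antitone_nat_of_succ_le fun j => (cj_succ_le hδ hδ1 hη hη1 j).2.trans
    (mul_le_of_le_one_left (cj_pos hδ hη j).le hη1)
lemma ej_pos {δ c : ℝ} (hδ : 0 < δ) (hc : 0 < c) (j : ℕ) : 0 < ej δ c j := by
  induction j with
  | zero => exact hc
  | succ j ih => exact ph_pos hδ ih
lemma ej_anti {δ c : ℝ} (hδ : 0 < δ) (hδ1 : δ ≤ 1) (hc : 0 < c) (hc1 : c ≤ 1) : Antitone (ej δ c) := by
  have h1 : ∀ j, ej δ c j ≤ 1 := by
    intro j
    induction j with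
    | zero => exact hc1
    | succ j ih => exact (ph_le hδ hδ1 (ej_pos hδ hc j) ih).trans ih
  exact antitone_nat_of_succ_le fun j => ph_le hδ hδ1 (ej_pos hδ hc j) (h1 j)
lemma pigeon (a : ℕ → ℝ) (h0 : 0 ≤ a 0) (J : ℕ) (hJ : 0 < J) (h2 : a J ≤ 2) : ∃ j < J, a (j+1) - a j ≤ 2 / J := by
  by_contra! h
  have : ∀ j ≤ J, j * (2 / (J:ℝ)) ≤ a j - a 0 := by
    intro j hj
    induction j with
    | zero => simp
    | succ j ih =>
      have := h j ¿; have := ih ¿; push_cast; linarith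
  have h3 := h (J-1) ¿
  have h4 := this (J-1) ¿
  have h5 : J - 1 + 1 = J := by omega
  rw [h5] at h3
  have hc : ((J-1:ℕ):ℝ) = J - 1 := by rw [Nat.cast_sub ¿]; simp
  rw [hc] at h4
  have : ((J:ℝ) - 1) * (2/J) = 2 - 2/J := by field_simp
  linarith
lemma walks {β : ℝ} (hβ : 0 < β) (hβ1 : β ≤ 1) : ∃ (L : ℕ) (c : ℝ), 0 < c ∧
    ∀ {V : Type} [Fintype V] [DecidableEq V] [Nonempty V] {K : V → V → Prop} {A : Finset V},
      (∀ x y, K x y → K y x) → (∀ x y, K x y → x ∈ A) →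
      (∀ x ∈ A, β / 2 ≤ Ex fun y => ind (K x y)) →
      (∀ X ⊆ A, β * ms X * ms Б ≤ ee K X Б) →
      (ms A ^ 2 / 2 + 1/18 ≤ ee K A A) → ∀ x ∈ A, ∀ y ∈ A, c ≤ Wk K (2 * L) x y := by
  set δ := β / 2 with hδd
  have hδ : 0 < δ := by positivity
  have hδ1 : δ ≤ 1 := by linarith
  obtain ⟨γ, hγ, hγ1, hγ2, hγ3⟩ : ∃ γ : ℝ, 0 < γ ∧ γ ≤ 1/200 ∧ γ < δ^2/2 ∧ γ ≤ δ/2 := by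
    refine ⟨min (1/200) (min (δ^2/4) (δ/2)), by positivity, min_le_left _ _, ?_, ?_⟩
    · have : min (1/200) (min (δ^2/4) (δ/2)) ≤ δ^2/4 := (min_le_right _ _).trans (min_le_left _ _)
      have : 0 < δ^2 := by positivity
      linarith
    · exact (min_le_right _ _).trans (min_le_right _ _)
  set η := β * γ^2 / 4 with hη_def
  have hη : 0 < η := by positivity
  have hη1 : η ≤ 1 := by
    have : γ^2 ≤ 1 := pow_le_one₀ hγ.le ¶
    have : β * γ^2 ≤ 1 := mul_le_one₀ hβ1 § this
    linarith
  obtain ⟨J, hJ⟩ := exists_nat_gt (2/η)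
  have hJ0 : 0 < J := by
    have : ø < J := lt_trans § hJ
    exact_mod_cast this
  have hJε : 2/(J:ℝ) ≤ η := by
    rw [dli (by exact_mod_cast hJ0)]; rw [div_lt_iff₀ hη] at hJ; linarith
  set e0 := cj δ η J * (δ/2) with he0
  have he0p : 0 < e0 := mul_pos (cj_pos hδ hη J) §
  have he01 : e0 ≤ 1 := mul_le_one₀ (cj_succ_le hδ hδ1 hη hη1 J).1 § ¶
  refine ⟨J + 1, ej δ e0 J, ej_pos hδ he0p J, ?_⟩
  intro V _ _ _ K A hK hA hdeg hcut hbig x hx y hy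
  classical
  have len := fun (L : ℕ) (y : V) {c : ℝ} (hc : 0 ≤ c) => Wk_len hK hA hδ.le hdeg L x y (c := c) hc
  let X : ℕ → Finset V := fun j => A.filter fun z => cj δ η j ≤ Wk K (2*j+1) x z
  let Y : ℕ → Finset V := fun j => A.filter fun z => cj δ η j ≤ Wk K (2*j+2) x z
  have cjm : ∀ j, cj δ η (j+1) ≤ ph δ (cj δ η j) := fun j =>
    ph_mono (mul_pos hη (cj_pos hδ hη j)).le (mul_le_of_le_one_left (cj_pos hδ hη j).le hη1)
  have hXm : ∀ j, X j ⊆ X (j+1) := by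
    intro j z hz; simp only [X, mem_filter] at hz ⊢
    exact ⟨hz.1, (cjm j).trans (len (2*j) z (cj_pos hδ hη j).le hz.2)⟩
  have hYm : ∀ j, Y j ⊆ Y (j+1) := by
    intro j z hz; simp only [Y, mem_filter] at hz ⊢
    exact ⟨hz.1, (cjm j).trans (len (2*j+1) z (cj_pos hδ hη j).le hz.2)⟩
  have hXA : ∀ j, X j ⊆ A := fun j => filter_subset _ _
  have hYA : ∀ j, Y j ⊆ A := fun j => filter_subset _ _
  have hX0 : δ^2/2 ≤ ms (X 0) := by
    have h1 : δ^2 ≤ Ex fun z => Wk K 1 x z := by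
      have : (Ex fun z => Wk K 1 x z) = Ex fun u => ind (K x u) * Ex fun z => ind (K u z) := by
        rw [show (Ex fun z => Wk K 1 x z) = Ex fun z => Ex fun u => ind (K x u) * ind (K u z) from rfl, Ex_comm]
        exact Ex_congr fun u => Ex_mul_left _ _
      rw [this]
      have h2 := hdeg x hx
      calc δ^2 ≤ (Ex fun u => ind (K x u)) * δ := by nlinarith
        _ = Ex fun u => ind (K x u) * δ := (Ex_mul_right _ _).symm
        _ ≤ _ := Ex_mono fun u => by
          by_cases hu : K x u
          · exact mll (hdeg u (hA u x (hK _ _ hu))) И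
          · rw [ind_false hu]; simp
    have h2 := Ex_rev (f := fun z => Wk K 1 x z) (fun z => Wk_le_one K 1 x z) (t := δ^2/2) §
    refine le_trans ¶ (h2.trans (Ex_ind_mono fun z hz => ?_))
    have hzpos : 0 < Wk K 1 x z := lt_of_lt_of_le § hz
    have hzA : z ∈ A := by
      by_contra hzA
      have : Wk K 1 x z = 0 := by
        have : ∀ u, Wk K 0 x u * ind (K u z) = 0 := fun u => by
          rw [ind_false (fun h => hzA (hA z u (hK _ _ h)))]; simp
        show Ex (fun u => Wk K 0 x u * ind (K u z)) = 0
        rw [Ex_congr this, Ex_const]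
      linarith
    simp only [X, mem_filter]; exact ⟨hzA, hz⟩
  obtain ⟨j, hjJ, hj⟩ := pigeon (fun j => ms (X j) + ms (Y j)) (add_nonneg (ms_nonneg _) (ms_nonneg _)) J hJ0
    (by have := ms_le_one (X J); have := ms_le_one (Y J); show ms (X J) + ms (Y J) ≤ 2; linarith)
  have iX := ms_add (hXm j)
  have iY := ms_add (hYm j)
  have n1 := ms_nonneg (X (j+1) \ X j)
  have n2 := ms_nonneg (Y (j+1) \ Y j)
  have eb : ∀ (P : Finset V) (Q Q' : Finset V), Q ⊆ Q' → (∀ z ∈ A, z ∉ Q' → (Ex fun u => ind (u ∈ P) * ind (K u z)) < η) →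
      ms (Q' \ Q) ≤ η → ee K P (A \ Q) ≤ 2 * η := by
    intro P Q Q' hQ hN hm
    unfold ee; rw [Ex_comm]
    have : ∀ z, (Ex fun u => ind (u ∈ P) * ind (z ∈ A \ Q) * ind (K u z)) ≤ ind (z ∈ Q' \ Q) + η := by
      intro z
      have e1 : (Ex fun u => ind (u ∈ P) * ind (z ∈ A \ Q) * ind (K u z)) =
          ind (z ∈ A \ Q) * Ex fun u => ind (u ∈ P) * ind (K u z) := by
        rw [← Ex_mul_left]; exact Ex_congr fun u => by ring
      rw [e1]
      have t0 : 0 ≤ Ex fun u => ind (u ∈ P) * ind (K u z) := Ex_nonneg fun u => mul_nonneg И И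
      have t1 : (Ex fun u => ind (u ∈ P) * ind (K u z)) ≤ 1 := Ex_le_one fun u => mul_le_one₀ (ind_le_one _) И (ind_le_one _)
      by_cases hz : z ∈ A \ Q
      · rw [ind_true hz, one_mul]
        by_cases hz' : z ∈ Q'
        · rw [ind_true (show z ∈ Q' \ Q from mem_sdiff.2 ⟨hz', (mem_sdiff.1 hz).2⟩)]; linarith
        · have := hN z (mem_sdiff.1 hz).1 hz'; have := ind_nonneg (z ∈ Q' \ Q); linarith
      · rw [ind_false hz, zero_mul]; have := ind_nonneg (z ∈ Q' \ Q); linarith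
    have := Ex_mono this
    rw [Ex_add, Ex_const] at this
    have h9 : (Ex fun z => ind (z ∈ Q' \ Q)) = ms (Q' \ Q) := rfl
    linarith
  have hγX : ms (A \ X j) ≤ γ := by
    have hmono : ms (X 0) ≤ ms (X j) := ms_mono (monotone_nat_of_le_succ (f := X) hXm (Nat.zero_le j))
    refine dcover hK hβ hβ1 hγ hγ1 (ε := 2 * η) (by rw [hη_def]; linarith) (hXA j) (hYA j) hcut hbig ¶ ?_ ?_
    · refine eb (X j) (Y j) (Y (j+1)) (hYm j) ?_ ¶
      intro z hzA hz; by_contra! hge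
      apply hz; simp only [Y, mem_filter]; refine ⟨hzA, ?_⟩
      have := Wk_step K (2*j+1) x z (cj_pos hδ hη j).le (D := X j) (fun z hz => (mem_filter.1 hz).2) hge
      rw [mul_comm] at this
      exact len (2*j+1) z (mul_pos hη (cj_pos hδ hη j)).le this
    · refine eb (Y j) (X j) (X (j+1)) (hXm j) ?_ ¶
      intro z hzA hz; by_contra! hge
      apply hz; simp only [X, mem_filter]; refine ⟨hzA, ?_⟩
      have := Wk_step K (2*j+2) x z (cj_pos hδ hη j).le (D := Y j) (fun z hz => (mem_filter.1 hz).2) hge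
      rw [mul_comm] at this
      exact (cj_succ_le hδ hδ1 hη hη1 j).2.trans this
  have hfin : e0 ≤ Wk K (2*j+2) x y := by
    have h1 : δ/2 ≤ Ex fun z => ind (z ∈ X j) * ind (K z y) := by
      have h2 : (Ex fun z => ind (K y z)) ≤ Ex fun z => ind (z ∈ X j) * ind (K z y) + ind (z ∈ A \ X j) :=
        Ex_mono fun z => by
          by_cases hk : K y z
          · rw [ind_true hk, ind_true (hK _ _ hk)]
            have := ind_mem_add (hXA j) z
            rw [ind_true (hA z y (hK _ _ hk))] at this; linarith
          · rw [ind_false hk]; have := ind_nonneg (z ∈ A \ X j)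
            have := mul_nonneg (ind_nonneg (z ∈ X j)) (ind_nonneg (K z y)); linarith
      rw [Ex_add] at h2
      have h3 := hdeg y hy
      have h9 : (Ex fun z => ind (z ∈ A \ X j)) = ms (A \ X j) := rfl
      linarith
    have h2 := Wk_step K (2*j+1) x y (cj_pos hδ hη j).le (D := X j) (fun z hz => (mem_filter.1 hz).2) h1
    exact (mlr (cj_anti hδ hδ1 hη hη1 hjJ.le) §).trans h2
  have hall : ∀ i, ej δ e0 i ≤ Wk K (2*j+2+2*i) x y := by
    intro i
    induction i with
    | zero => exact hfin
    | succ i ih =>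
      have q := len (2*j+1+2*i) y (ej_pos hδ he0p i).le
      rw [show 2*j+1+2*i+1 = 2*j+2+2*i by ring, show 2*j+1+2*i+3 = 2*j+2+2*(i+1) by ring] at q
      exact q ih
  have h1 := hall (J - j)
  have h2 : 2*j+2+2*(J-j) = 2*(J+1) := by omega
  rw [h2] at h1
  exact (ej_anti hδ hδ1 he0p he01 (Nat.sub_le J j)).trans h1
end
section
variable {V : Type} [Fintype V] [DecidableEq V]
lemma box_fin [Nonempty V] (b r : ℕ) (P : (Fin r → V) → Prop) :
    (Ex fun x => ind (P x)) ^ (b ^ r) ≤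
      Ex fun x : Fin r → Fin b → V => ind (∀ s : Fin r → Fin b, P fun i => x i (s i)) := by
  induction r with
  | zero =>
    rw [pow_zero, pow_one]
    have e1 : ∀ x : Fin 0 → V, ind (P x) = ind (P Fin.elim0) := fun x => by congr 2; exact Subsingleton.elim _ _
    have e2 : ∀ x : Fin 0 → Fin b → V, ind (∀ s : Fin 0 → Fin b, P fun i => x i (s i)) = ind (P Fin.elim0) := fun x => by
      congr 1; simp only [eq_iff_iff]
      constructor
      · intro h; convert h Fin.elim0 using 1
      · intro h s; convert h using 1
    rw [Ex_congr e1, Ex_congr e2, Ex_const, Ex_const]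
  | succ r ih =>
    rw [Ex_cons]
    set Q : (Fin b → V) → (Fin r → V) → Prop := fun A y => ∀ j, P (Fin.cons (A j) y) with hQ
    have h1 : ∀ A : Fin b → V, (Ex fun y => ind (Q A y)) ^ (b^r) ≤
        Ex fun y : Fin r → Fin b → V => ind (∀ s : Fin (r+1) → Fin b, P fun i =>
          (Fin.cons A y : Fin (r+1) → Fin b → V) i (s i)) := fun A =>
      (ih (Q A)).trans (Ex_ind_mono fun y hy s => by
        have := hy (fun i => s i.succ) (s 0)
        convert this using 1
        ext i; refine Fin.cases ?_ (fun i => ?_) i <;> simp)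
    rw [Ex_cons (V := Fin b → V)]
    refine le_trans ?_ (Ex_mono h1)
    refine le_trans ?_ (Ex_pow_le (fun A => Ex_ind_nonneg _) (b^r))
    rw [pow_succ, mul_comm, pow_mul]
    refine pll (pow_nonneg (Ex_nonneg fun _ => Ex_ind_nonneg _) _) ?_ _
    rw [Ex_comm, Ex_comm (Ω := Fin b → V)]
    refine (Ex_pow_le (fun A => Ex_ind_nonneg _) b).trans (Ex_mono fun y => ?_)
    have := Ex_pi_prod (ι := Fin b) (fun _ a => ind (P (Fin.cons a y)))
    rw [Finset.prod_const, card_univ, Fintype.card_fin] at this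
    rw [← this]
    exact (Ex_congr fun A => (ind_forall _).symm).le
lemma box [Nonempty V] {ι : Type} [Fintype ι] [DecidableEq ι] (b : ℕ) (P : (ι → V) → Prop) :
    (Ex fun x => ind (P x)) ^ (b ^ Fintype.card ι) ≤
      Ex fun x : ι → Fin b → V => ind (∀ s : ι → Fin b, P fun i => x i (s i)) := by
  let e := Fintype.equivFin ι
  have h := box_fin b (Fintype.card ι) (fun y => P (fun i => y (e i)))
  have e1 := Ex_equiv (Equiv.arrowCongr e (Equiv.refl V)) (fun y => ind (P (fun i => y (e i))))
  have e2 := Ex_equiv (Equiv.arrowCongr e (Equiv.refl (Fin b → V)))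
    (fun y => ind (∀ s : Fin (Fintype.card ι) → Fin b, P fun i => y (e i) (s (e i))))
  rw [← e1, ← e2] at h
  simp only [Equiv.arrowCongr_apply, Function.comp, Equiv.symm_apply_apply, Equiv.refl_apply] at h
  refine h.trans (Ex_ind_mono fun x hx s => ?_)
  simpa using hx (fun j => s (e.symm j))
noncomputable def dens (r : ℕ) (Q : List V → Prop) : ℝ := Ex fun τ : Fin r → V => ind (Q (ofFn τ))
lemma dens_mono {r : ℕ} {Q Q' : List V → Prop} (h : ∀ l, l.length = r → Q l → Q' l) : dens r Q ≤ dens r Q' :=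
  Ex_ind_mono fun τ hτ => h _ £ hτ
lemma dens_avoid [Nonempty V] (r : ℕ) (Q : List V → Prop) (X : Finset V) :
    dens r Q ≤ dens r (fun l => Q l ∧ l.Nodup ∧ ∀ v ∈ l, v ∉ X) + ((r:ℝ)^2 + r * X.card) / Ξ := by
  have h := avoid (V := V) (ι := Fin r) X
  rw [Fintype.card_fin] at h
  refine (Ex_ind_le_add _ (fun z => (Function.Injective z ∧ ∀ i, z i ∉ X))).trans (add_le_add ?_ h)
  refine Ex_ind_mono fun τ hτ => ⟨hτ.1, ?_, ?_⟩
  · exact List.nodup_ofFn.2 hτ.2.1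
  · intro v hv; rw [List.mem_ofFn] at hv; obtain ⟨i, rfl⟩ := hv; exact hτ.2.2 i
lemma dens_exists {r : ℕ} {Q : List V → Prop} (h : 0 < dens r Q) : ∃ l, l.length = r ∧ Q l := by
  obtain ⟨τ, h⟩ := Ex_ind_exists h; exact ⟨_, by simp, h⟩
lemma dens_find [Nonempty V] {r : ℕ} {Q : List V → Prop} {X : Finset V} {c : ℝ} (hc : c ≤ dens r Q)
    (hX : (r:ℝ)^2 + r * X.card < c * Ξ) :
    ∃ l, l.length = r ∧ Q l ∧ l.Nodup ∧ ∀ v ∈ l, v ∉ X := by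
  refine dens_exists ?_
  have h := dens_avoid r Q X
  have hV : ø < Ξ := by exact_mod_cast Fintype.card_pos
  have : ((r:ℝ)^2 + r * X.card) / Ξ < c := by rwa [div_lt_iff₀ hV]
  linarith
lemma dens_of_box [Nonempty V] {ι : Type} [Fintype ι] [DecidableEq ι] (P : (ι → V) → Prop) (b : ℕ)
    (ls : List (ι × ℕ)) (hnd : ls.Nodup) (hb : ∀ p ∈ ls, p.2 < b) (Q : List V → Prop)
    (h : ∀ x : ι → ℕ → V, (∀ s : ι → ℕ, P fun i => x i (s i)) → Q (ls.map fun p => x p.1 p.2))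
    {c : ℝ} (hc : 0 ≤ c) (hP : c ≤ Ex fun x => ind (P x)) :
    c ^ ((b+1) ^ Fintype.card ι) ≤ dens ls.length Q := by
  refine (pll hc hP _).trans ((box (b+1) P).trans ?_)
  rw [← Ex_equiv (Equiv.curry ι (Fin (b+1)) V)]
  let φ : Fin ls.length → ι × Fin (b+1) := fun j => (ls[j].1, Fin.ofNat (b+1) ls[j].2)
  have hφ : Function.Injective φ := by
    intro i j hij
    have hb' : ∀ j : Fin ls.length, ls[j].2 < b+1 := fun j => (hb _ (List.getElem_mem _)).trans (Nat.lt_succ_self b)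
    simp only [φ, Prod.mk.injEq, Fin.ext_iff, Fin.val_ofNat, Nat.mod_eq_of_lt (hb' i), Nat.mod_eq_of_lt (hb' j)] at hij
    have : ls[i] = ls[j] := Prod.ext hij.1 hij.2
    exact Fin.ext ((List.Nodup.getElem_inj_iff hnd).1 this)
  unfold dens
  rw [← Ex_marginal φ hφ]
  refine Ex_ind_mono fun x hx => ?_
  have := h (fun i j => x (i, Fin.ofNat (b+1) j)) (fun s => hx (fun i => Fin.ofNat (b+1) (s i)))
  convert this using 1
  apply List.ext_getElem
  · simp
  · intro i h1 h2; simp [φ]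
end
section
variable {V : Type} [DecidableEq V]
def Tight (k : ℕ) (E : Г) (l : List V) : Prop :=
  ∀ w, w <:+: l → w.length = k → w.toFinset ∈ E
lemma Tight.infix {k : ℕ} {E : Г} {l l' : List V} (h : Tight k E l) (h' : l' <:+: l) : Tight k E l' :=
  fun w hw hk => h w (hw.trans h') hk
lemma Tight.glue {k : ℕ} {E : Г} {a m b : List V} (h1 : Tight k E (a ++ m)) (h2 : Tight k E (m ++ b))
    (hm : k ≤ m.length + 1) : Tight k E (a ++ m ++ b) := by
  intro w ⟨s, t, hst⟩ hk
  by_cases hs : a.length ≤ s.length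
  · apply h2 w _ hk
    have : s = a ++ s.drop a.length := by
      have h3 : a <+: s := by
        apply List.prefix_of_prefix_length_le (l₃ := a ++ m ++ b) _ _ hs
        · exact ⟨m ++ b, by simp⟩
        · exact ⟨w ++ t, by simpa using hst⟩
      obtain ⟨u, rfl⟩ := h3; simp
    rw [this] at hst
    refine ⟨s.drop a.length, t, ?_⟩
    have := hst
    simp only [List.append_assoc, List.append_cancel_left_eq] at this
    simpa using this
  · apply h1 w _ hk
    have h3 : s ++ w <+: a ++ m := by
      apply List.prefix_of_prefix_length_le (l₃ := a ++ m ++ b)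
      · exact ⟨t, by simpa using hst⟩
      · exact ⟨b, by simp⟩
      · simp; omega
    obtain ⟨u, hu⟩ := h3
    exact ⟨s, u, hu⟩
lemma Tight.of_short {k : ℕ} {E : Г} {l : List V} (h : l.length < k) : Tight k E l := by
  intro w hw hk; have := hw.length_le; omega
def Ed {k : ℕ} (E : Г) (x : Fin k → V) : Prop := univ.image x ∈ E
def Mix {k : ℕ} (E : Г) (x y : Fin k → V) : Prop :=
  ∀ t : ℕ, t ≤ k → Ed E fun i : Fin k => if i.1 < t then y i else x i
lemma Mix.tight {k : ℕ} {E : Г} {x y : Fin k → V} (h : Mix E x y) :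
    Tight k E (ofFn x ++ ofFn y) := by
  intro w ⟨s, t, hst⟩ hk
  have hl := congrArg List.length hst
  simp at hl
  have hs : s.length ≤ k := by omega
  have := h s.length hs
  unfold Ed at this
  convert this using 1
  ext v
  simp only [List.mem_toFinset, mem_image, mem_univ, true_and]
  have hget : ∀ j (hj : j < k), w[j]'¿ = (ofFn x ++ ofFn y)[s.length + j]'(by simp; omega) := by
    intro j hj
    simp only [← hst]
    rw [List.getElem_append_left (by simp; omega), List.getElem_append_right ¿]
    simp
  constructor
  · intro hv
    obtain ⟨j, hj, rfl⟩ := List.getElem_of_mem hv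
    rw [hget j ¿]
    by_cases hjs : s.length + j < k
    · refine ⟨⟨s.length + j, hjs⟩, ?_⟩
      rw [List.getElem_append_left (by simpa using hjs)]; simp
    · refine ⟨⟨s.length + j - k, by omega⟩, ?_⟩
      rw [List.getElem_append_right (by simp; omega)]; simp; omega
  · rintro ⟨i, rfl⟩
    by_cases hi : i.1 < s.length
    · rw [if_pos hi]
      have := hget (k - s.length + i.1) ¿
      rw [List.getElem_append_right (by simp; omega)] at this
      rw [List.mem_iff_getElem]
      refine ⟨k - s.length + i.1, by omega, ?_⟩
      rw [this]; simp; congr 1; ext; simp; omega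
    · rw [if_neg hi]
      have := hget (i.1 - s.length) ¿
      rw [List.getElem_append_left (by simp; omega)] at this
      rw [List.mem_iff_getElem]
      refine ⟨i.1 - s.length, by omega, ?_⟩
      rw [this]; simp; congr 1; ext; simp; omega
end
section
variable {V : Type} [Fintype V] [DecidableEq V]
def KK (E : Г) (A : Finset V → Finset V) (S : Finset V) (p q : V) : Prop :=
  p ∈ A S ∧ q ∈ A S ∧ insert p (insert q S) ∈ E
structure Good (d : ℕ) (μ δ : ℝ) (L : ℕ) (c : ℝ) (E : Г) (A : Finset V → Finset V) : Prop where
  card : ∀ e ∈ E, e.card = d + 3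
  dens : ∀ S : Finset V, S.card = d + 1 → 5/9 + μ ≤ Ex fun p => Ex fun q => ind (insert p (insert q S) ∈ E)
  big : ∀ S : Finset V, S.card = d + 1 → 2/3 ≤ ms (A S)
  edges : ∀ S : Finset V, S.card = d + 1 → 5/9 + μ - (1 - ms (A S))^2 ≤ Ex fun p => Ex fun q => ind (KK E A S p q)
  deg : ∀ S : Finset V, S.card = d + 1 → ∀ p ∈ A S, δ ≤ Ex fun q => ind (KK E A S p q)
  walk : ∀ S : Finset V, S.card = d + 1 → ∀ p ∈ A S, ∀ q ∈ A S, c ≤ Wk (KK E A S) (2 * L) p q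
lemma KK_symm {E : Г} {A : Finset V → Finset V} {S : Finset V} {p q : V} (h : KK E A S p q) :
    KK E A S q p := ⟨h.2.1, h.1, by rw [Finset.insert_comm]; exact h.2.2⟩
lemma good_exists (d : ℕ) {μ : ℝ} (hμ : 0 < μ) (hμ1 : μ ≤ 1) : ∃ (μ' δ : ℝ) (L : ℕ) (c : ℝ), 0 < μ' ∧ 0 < δ ∧ 0 < c ∧
    ∀ {V : Type} [Fintype V] [DecidableEq V] [Nonempty V] (E : Г), 6 ≤ Ξ →
      (∀ e ∈ E, e.card = d + 3) →
      (∀ S : Finset V, S.card = d + 1 → 5/9 + μ ≤ Ex fun p => Ex fun q => ind (insert p (insert q S) ∈ E)) →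
      ∃ A, Good d μ' δ L c E A := by
  set β := μ / 4 with hβd
  have hβ : 0 < β := by positivity
  obtain ⟨L, c, hc, hW⟩ := walks hβ ¶
  refine ⟨μ/2, β/2, L, c, by positivity, by positivity, hc, ?_⟩
  intro V _ _ _ E hn hcard hdens
  have hn' : (6:ℝ) ≤ Ξ := by exact_mod_cast hn
  have ex : ∀ S : Finset V, ∃ A : Finset V, S.card = d + 1 → (2/3 ≤ ms A ∧
      5/9 + μ - 2 * β - (1 - ms A)^2 ≤ ee (fun p q => insert p (insert q S) ∈ E) A A ∧
      ∀ X ⊆ A, β * ms X * ms Б ≤ ee (fun p q => insert p (insert q S) ∈ E) X Б) := by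
    intro S
    by_cases hS : S.card = d + 1
    · obtain ⟨A, hA⟩ := core (G := fun p q => insert p (insert q S) ∈ E) (fun x y h => by rwa [Finset.insert_comm])
        hβ ¶ (hdens S hS)
      exact ⟨A, fun _ => hA⟩
    · exact ⟨∅, fun h => absurd h hS⟩
  choose A hA using ex
  have hee : ∀ S X Y, X ⊆ A S → Y ⊆ A S → ee (KK E A S) X Y = ee (fun p q => insert p (insert q S) ∈ E) X Y := by
    intro S X Y hX hY
    refine Ex_congr fun x => Ex_congr fun y => ?_
    by_cases h1 : x ∈ X
    · by_cases h2 : y ∈ Y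
      · congr 1; exact ind_congr ⟨fun h => h.2.2, fun h => ⟨hX h1, hY h2, h⟩⟩
      · rw [ind_false h2]; simp
    · rw [ind_false h1]; simp
  have hK : ∀ S, ee (KK E A S) (A S) (A S) = Ex fun p => Ex fun q => ind (KK E A S p q) := by
    intro S; refine Ex_congr fun x => Ex_congr fun y => ?_
    by_cases h : KK E A S x y
    · rw [ind_true h.1, ind_true h.2.1]; simp
    · rw [ind_false h]; simp
  have hdeg : ∀ S : Finset V, S.card = d + 1 → ∀ p ∈ A S, β/2 ≤ Ex fun q => ind (KK E A S p q) := by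
    intro S hS p hp
    have hcut := (hA S hS).2.2 {p} (by simpa using hp)
    rw [← hee S _ _ (by simpa using hp) sdiff_subset, ms_single] at hcut
    have hm := ms_add (show {p} ⊆ A S by simpa using hp)
    rw [ms_single] at hm
    have hb := (hA S hS).1
    set n : ℝ := (Ξ : ℝ)
    have hn0 : 0 < n := by linarith
    have h1n : 1/n ≤ 1/6 := one_div_le_one_div_of_le (by norm_num) hn'
    have hle : ee (KK E A S) {p} (A S \ {p}) ≤ 1/n * Ex fun q => ind (KK E A S p q) := by
      have : ms ({p} : Finset V) * (Ex fun q => ind (KK E A S p q)) = 1/n * Ex fun q => ind (KK E A S p q) := by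
        rw [ms_single]
      rw [← this]; unfold ee ms; rw [← Ex_mul_right]
      refine Ex_mono fun x => ?_
      by_cases hx : x ∈ ({p} : Finset V)
      · have : x = p := by simpa using hx
        subst this
        rw [ind_true hx, one_mul]
        exact Ex_mono fun y => by
          rw [one_mul]; exact mul_le_of_le_one_left И (ind_le_one _)
      · rw [ind_false hx]; simp [Ex]
    have h2 : 1/n * (β * ms (A S \ {p})) ≤ 1/n * Ex fun q => ind (KK E A S p q) := by
      calc 1/n * (β * ms (A S \ {p})) = β * (1/n) * ms (A S \ {p}) := by ring
        _ ≤ _ := hcut.trans hle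
    have h3 := le_of_mul_le_mul_left h2 §
    have h4 : 1/2 ≤ ms (A S \ {p}) := by linarith
    nlinarith
  have hedg : ∀ S : Finset V, S.card = d + 1 → 5/9 + μ/2 - (1 - ms (A S))^2 ≤ Ex fun p => Ex fun q => ind (KK E A S p q) := by
    intro S hS
    rw [← hK, hee S _ _ (le_refl _) (le_refl _)]
    have := (hA S hS).2.1; linarith
  refine ⟨A, hcard, fun S hS => by linarith [hdens S hS], fun S hS => (hA S hS).1, hedg, hdeg, ?_⟩
  intro S hS p hp q hq
  refine hW (fun x y h => KK_symm h) (fun x y h => h.1) (hdeg S hS) ?_ ?_ p hp q hq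
  · intro X hX; rw [hee S _ _ hX sdiff_subset]; exact (hA S hS).2.2 X hX
  · rw [hK]; refine le_trans ?_ (hedg S hS)
    have h1 := (hA S hS).1; have h2 := ms_le_one (A S)
    nlinarith
section
variable {d : ℕ} {μ δ : ℝ} {L : ℕ} {c : ℝ} {E : Г} {A : Finset V → Finset V} [Nonempty V]
lemma Good.dense (hg : Good d μ δ L c E A) {S : Finset V} (hS : S.card = d + 1) :
    4/9 + μ ≤ Ex fun p => Ex fun q => ind (KK E A S p q) := by
  have h1 := hg.big S hS; have h2 := hg.edges S hS; have h3 := ms_le_one (A S)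
  nlinarith
lemma Good.inter (hg : Good d μ δ L c E A) {S T : Finset V} (hS : S.card = d + 1) (hT : T.card = d + 1) :
    2 * μ ≤ Ex fun p => Ex fun q => ind (KK E A S p q ∧ KK E A T p q) := by
  have h1 := hg.big S hS; have h2 := hg.edges S hS; have h3 := ms_le_one (A S)
  have h4 := hg.big T hT; have h5 := hg.edges T hT; have h6 := ms_le_one (A T)
  set x := ms (A S); set y := ms (A T)
  set m := ms (A S ∩ A T)
  have hm : x + y - 1 ≤ m := by
    have := ms_add (inter_subset_left : A S ∩ A T ⊆ A S)
    have h8 : ms (A S \ (A S ∩ A T)) ≤ ms (univ \ A T) := ms_mono (by intro v; simp)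
    have h9 := ms_add (subset_univ (A T)); rw [ms_univ] at h9; linarith
  have hpt : ∀ p q, ind (KK E A S p q) + ind (KK E A T p q) ≤ ind (KK E A S p q ∧ KK E A T p q) +
      (ind (p ∈ A S) * ind (q ∈ A S) + ind (p ∈ A T) * ind (q ∈ A T) - ind (p ∈ A S ∩ A T) * ind (q ∈ A S ∩ A T)) := by
    intro p q
    rw [ind_and, show ind (p ∈ A S ∩ A T) = ind (p ∈ A S) * ind (p ∈ A T) by rw [← ind_and]; exact ind_congr mem_inter,
      show ind (q ∈ A S ∩ A T) = ind (q ∈ A S) * ind (q ∈ A T) by rw [← ind_and]; exact ind_congr mem_inter]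
    have a1 : ind (KK E A S p q) ≤ ind (p ∈ A S) * ind (q ∈ A S) := by rw [← ind_and]; exact ind_mono fun h => ⟨h.1, h.2.1⟩
    have a2 : ind (KK E A T p q) ≤ ind (p ∈ A T) * ind (q ∈ A T) := by rw [← ind_and]; exact ind_mono fun h => ⟨h.1, h.2.1⟩
    have b1 : ind (p ∈ A S) * ind (q ∈ A S) ≤ 1 := mul_le_one₀ (ind_le_one _) И (ind_le_one _)
    have b2 : ind (p ∈ A T) * ind (q ∈ A T) ≤ 1 := mul_le_one₀ (ind_le_one _) И (ind_le_one _)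
    have c1 := ind_nonneg (KK E A S p q)
    have c2 := ind_nonneg (KK E A T p q)
    generalize ind (KK E A S p q) = u at *
    generalize ind (KK E A T p q) = v at *
    have : ind (p ∈ A S) * ind (p ∈ A T) * (ind (q ∈ A S) * ind (q ∈ A T)) =
      (ind (p ∈ A S) * ind (q ∈ A S)) * (ind (p ∈ A T) * ind (q ∈ A T)) := by ring
    rw [this]
    generalize ind (p ∈ A S) * ind (q ∈ A S) = a at *
    generalize ind (p ∈ A T) * ind (q ∈ A T) = b at *
    nlinarith [mul_nonneg (sub_nonneg.2 a1) (sub_nonneg.2 b2), mul_nonneg (sub_nonneg.2 a2) (sub_nonneg.2 (a1.trans b1))]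
  have key := Ex_mono fun p => Ex_mono (hpt p)
  simp only [Ex_add, Ex_sub, Ex_mul_left, Ex_mul_right] at key
  change _ ≤ _ + (x * x + y * y - m * m) at key
  have hm2 : (x + y - 1)^2 ≤ m * m := by nlinarith
  nlinarith
lemma Good.inter' (hg : Good d μ δ L c E A) {S T : Finset V} (hS : S.card = d + 1) (hT : T.card = d + 1) :
    2 * μ ≤ Ex fun p => Ex fun q => ind (KK E A S p q ∧ insert p (insert q T) ∈ E) := by
  have h1 := hg.dense hS; have h2 := hg.dens T hT
  have hpt : ∀ p q, ind (KK E A S p q) + ind (insert p (insert q T) ∈ E) ≤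
      ind (KK E A S p q ∧ insert p (insert q T) ∈ E) + 1 := by
    intro p q; rw [ind_and]
    nlinarith [ind_le_one (KK E A S p q), ind_le_one (insert p (insert q T) ∈ E)]
  have key := Ex_mono fun p => Ex_mono (hpt p)
  simp only [Ex_add, Ex_const] at key
  linarith
def St {d : ℕ} (x : Λ) : Finset V := univ.image fun i : Ψ => x i.succ.succ
def FF (E : Г) (A : Finset V → Finset V) (x : Λ) : Prop := KK E A (St x) (x 0) (x 1)
lemma image_eq (x : Λ) : univ.image x = insert (x 0) (insert (x 1) (St x)) := by
  ext v; simp only [mem_image, mem_univ, true_and, mem_insert, St]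
  constructor
  · rintro ⟨i, rfl⟩
    refine Fin.cases (Or.inl rfl) (fun i => ?_) i
    refine Fin.cases (Or.inr (Or.inl rfl)) (fun i => Or.inr (Or.inr ⟨i, rfl⟩)) i
  · rintro (h | h | ⟨i, h⟩)
    · exact ⟨0, h.symm⟩
    · exact ⟨1, h.symm⟩
    · exact ⟨_, h⟩
lemma FF.ed {x : Λ} (h : FF E A x) : Ed E x := by
  unfold Ed; rw [image_eq]; exact h.2.2
lemma Good.inj (hg : Good d μ δ L c E A) {x : Λ} (h : Ed E x) : Function.Injective x := by
  have h1 := hg.card _ h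
  have : Set.InjOn x (univ : Finset (Φ)) := Finset.card_image_iff.1 (by rw [h1]; simp)
  exact fun a b hab => this £ £ hab
def RC (E : Г) (A : Finset V → Finset V) (ζ : ℝ) (x : Λ) : Prop :=
  ζ ≤ Ex fun y : Λ => ind (FF E A y ∧ Mix E x y)
def LC (E : Г) (A : Finset V → Finset V) (ζ : ℝ) (x : Λ) : Prop :=
  ζ ≤ Ex fun y : Λ => ind (FF E A y ∧ Mix E y x)
def FS (E : Г) (A : Finset V → Finset V) (ζ : ℝ) (x : Λ) : Prop :=
  FF E A x ∧ RC E A ζ x ∧ LC E A ζ x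
lemma FS_most {ε : ℝ} (hε : 0 < ε) (E : Г) (A : Finset V → Finset V) :
    (Ex fun x : Λ => ind (FF E A x ∧ ¬ FS E A ((ε/2)^(2^Δ)) x)) ≤ ε := by
  set ζ := (ε/2)^(2^Δ) with hζ
  have hζ0 : 0 < ζ := by positivity
  have hbox : ∀ B : Λ → Prop, ε/2 < (Ex fun x => ind (B x)) →
      ∃ y0 : Λ, ζ ≤ Ex fun y1 : Λ => ind (∀ s : Φ → Fin 2, B fun i => if s i = 0 then y0 i else y1 i) := by
    intro B hB
    have h1 := box 2 B
    rw [Fintype.card_fin] at h1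
    have h2 : ζ ≤ _ := (pll § hB.le _).trans h1
    let e : Λ × Λ ≃ (Φ → Fin 2 → V) :=
      (Equiv.arrowProdEquivProdArrow _ _ _).symm.trans (Equiv.arrowCongr (Equiv.refl _) (finTwoArrowEquiv V).symm)
    rw [← Ex_equiv e, Ex_prod] at h2
    obtain ⟨y0, h3⟩ := Ex_exists_ge (fun a => Ex fun b => ind (∀ s : Φ → Fin 2, B fun i => e (a, b) i (s i)))
    refine ⟨y0, (h2.trans h3).trans (Ex_ind_mono fun y1 h s => ?_)⟩
    convert h s using 1
    ext i
    have : s i = 0 ∨ s i = 1 := by omega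
    rcases this with h | h <;> simp [e, h, Equiv.arrowProdEquivProdArrow, Equiv.arrowCongr, finTwoArrowEquiv]
  have hR : (Ex fun x : Λ => ind (FF E A x ∧ ¬ RC E A ζ x)) ≤ ε/2 := by
    by_contra! h
    obtain ⟨y0, hy⟩ := hbox _ h
    obtain ⟨y1, h1⟩ := Ex_ind_exists (lt_of_lt_of_le hζ0 hy)
    have hb := h1 (fun _ => 0)
    simp only [if_true] at hb
    refine hb.2 (hy.trans (Ex_ind_mono fun y1 h1 => ⟨?_, fun t ht => ?_⟩))
    · have := (h1 (fun _ => 1)).1; simpa using this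
    · have := (h1 (fun i => if i.1 < t then 1 else 0)).1.ed
      convert this using 2; split_ifs <;> simp_all
  have hL : (Ex fun x : Λ => ind (FF E A x ∧ ¬ LC E A ζ x)) ≤ ε/2 := by
    by_contra! h
    obtain ⟨y0, hy⟩ := hbox _ h
    obtain ⟨y1, h1⟩ := Ex_ind_exists (lt_of_lt_of_le hζ0 hy)
    have hb := h1 (fun _ => 0)
    simp only [if_true] at hb
    refine hb.2 (hy.trans (Ex_ind_mono fun y1 h1 => ⟨?_, fun t ht => ?_⟩))
    · have := (h1 (fun _ => 1)).1; simpa using this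
    · have := (h1 (fun i => if i.1 < t then 0 else 1)).1.ed
      convert this using 2; split_ifs <;> simp_all
  have := Ex_ind_or_le (fun x : Λ => FF E A x ∧ ¬ RC E A ζ x) (fun x => FF E A x ∧ ¬ LC E A ζ x)
  refine le_trans (Ex_ind_mono fun x hx => ?_) (this.trans ¶)
  unfold FS at hx; tauto
end
end
section
variable {V : Type} [Fintype V] [DecidableEq V] {k : ℕ}
noncomputable def Rch (E : Г) : List (Fin k) → ((Fin k → V) → ℝ) → (Fin k → V) → ℝ
  | [], g, e => g e
  | i :: w, g, e => Ex fun v => ind (Ed E (update e i v)) * Rch E w g (update e i v)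
def PatL (E : Г) (G : (Fin k → V) → Prop) : (w : List (Fin k)) → (Fin k → V) → (Fin w.length → V) → Prop
  | [], e, _ => G e
  | i :: w, e, v => Ed E (update e i (v 0)) ∧ PatL E G w (update e i (v 0)) (fun t => v t.succ)
lemma Rch_eq [Nonempty V] (E : Г) (G : (Fin k → V) → Prop) (w : List (Fin k)) (e : Fin k → V) :
    Rch E w (fun e => ind (G e)) e = Ex fun v : Fin w.length → V => ind (PatL E G w e v) := by
  induction w generalizing e with
  | nil => simp only [Rch, PatL]; rw [Ex_const]
  | cons i w ih =>
    show _ = Ex fun v : Fin (w.length + 1) → V => _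
    rw [Ex_cons]
    simp only [Rch]
    refine Ex_congr fun a => ?_
    rw [ih, ← Ex_mul_left]
    refine Ex_congr fun v => ?_
    rw [← ind_and]; rfl
lemma Rch_append (E : Г) (w w' : List (Fin k)) (g : (Fin k → V) → ℝ) (e : Fin k → V) :
    Rch E (w ++ w') g e = Rch E w (Rch E w' g) e := by
  induction w generalizing e with
  | nil => rfl
  | cons i w ih => simp only [List.cons_append, Rch, ih]
lemma Rch_nonneg (E : Г) (w : List (Fin k)) {g : (Fin k → V) → ℝ} (hg : ∀ e, 0 ≤ g e) (e : Fin k → V) :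
    0 ≤ Rch E w g e := by
  induction w generalizing e with
  | nil => exact hg e
  | cons i w ih => exact Ex_nonneg fun v => mul_nonneg И (ih _)
def rd {ι : Type} : (w : List (Fin k)) → (Fin k → ι) → (Fin w.length → ι) → ℕ → List (ι × ℕ)
  | [], e, _, j => ofFn fun i => (e i, j)
  | a :: w, e, v, j => (ofFn fun i => (e i, j)) ++ rd w (update e a (v 0)) (fun t => v t.succ) (j+1)
lemma rd_length {ι : Type} (w : List (Fin k)) (e : Fin k → ι) (v : Fin w.length → ι) (j : ℕ) :
    (rd w e v j).length = k * (w.length + 1) := by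
  induction w generalizing e j with
  | nil => simp [rd]
  | cons a w ih => simp only [rd, List.length_append, ih]; simp; ring
lemma rd_snd {ι : Type} (w : List (Fin k)) (e : Fin k → ι) (v : Fin w.length → ι) (j : ℕ) :
    ∀ p ∈ rd w e v j, j ≤ p.2 ∧ p.2 ≤ j + w.length := by
  induction w generalizing e j with
  | nil => intro p hp; simp [rd, List.mem_ofFn] at hp; obtain ⟨i, rfl⟩ := hp; simp
  | cons a w ih =>
    intro p hp; simp only [rd, List.mem_append, List.mem_ofFn] at hp
    rcases hp with ⟨i, rfl⟩ | hp
    · simp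
    · have := ih _ _ _ p hp; simp only [List.length_cons]; omega
lemma upd_inj {ι : Type} {w : List (Fin k)} {a : Fin k} {e : Fin k → ι} {v : Fin (w.length+1) → ι}
    (h : Injective (Sum.elim e v)) : Injective (Sum.elim (update e a (v 0)) (fun t : Fin w.length => v t.succ)) := by
  have he : Injective e := fun i j hij => Sum.inl_injective (h (a₁ := Sum.inl i) (a₂ := Sum.inl j) hij)
  have hv : Injective v := fun i j hij => Sum.inr_injective (h (a₁ := Sum.inr i) (a₂ := Sum.inr j) hij)
  have hev : ∀ i t, e i ≠ v t := fun i t hit => by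
    have := h (a₁ := Sum.inl i) (a₂ := Sum.inr t) hit; simp at this
  rw [Sum.elim_injective]
  refine ⟨?_, ?_, ?_⟩
  · intro i j hij
    by_cases hi : i = a <;> by_cases hj : j = a
    · rw [hi, hj]
    · subst hi; rw [update_self, update_of_ne hj] at hij; exact absurd hij.symm (hev _ _)
    · subst hj; rw [update_self, update_of_ne hi] at hij; exact absurd hij (hev _ _)
    · rw [update_of_ne hi, update_of_ne hj] at hij; exact he hij
  · intro s t hst; exact Fin.succ_injective _ (hv hst)
  · intro i t
    by_cases hi : i = a
    · subst hi; rw [update_self]; intro h'; exact absurd (hv h').symm (Fin.succ_ne_zero t)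
    · rw [update_of_ne hi]; exact hev _ _
lemma rd_nodup {ι : Type} (w : List (Fin k)) (e : Fin k → ι) (v : Fin w.length → ι) (j : ℕ)
    (h : Injective (Sum.elim e v)) : (rd w e v j).Nodup := by
  induction w generalizing e j with
  | nil =>
    simp only [rd]; rw [List.nodup_ofFn]; intro a b hab
    simp only [Prod.mk.injEq, and_true] at hab
    exact Sum.inl_injective (h (a₁ := Sum.inl a) (a₂ := Sum.inl b) hab)
  | cons a w ih =>
    simp only [rd]; rw [List.nodup_append]
    refine ⟨?_, ih _ _ _ (upd_inj h), ?_⟩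
    · rw [List.nodup_ofFn]; intro a b hab
      simp only [Prod.mk.injEq, and_true] at hab
      exact Sum.inl_injective (h (a₁ := Sum.inl a) (a₂ := Sum.inl b) hab)
    · intro p hp q hq hpq; subst hpq
      rw [List.mem_ofFn] at hp; obtain ⟨i, rfl⟩ := hp
      have := (rd_snd _ _ _ _ _ hq).1; simp at this
lemma rd_tight {ι : Type} {E : Г} {G : (Fin k → V) → Prop} (x : ι → ℕ → V) (w : List (Fin k)) (e : Fin k → ι)
    (v : Fin w.length → ι) (j : ℕ) (h : Injective (Sum.elim e v))
    (hs : ∀ s : ι → ℕ, Ed E (fun i => x (e i) (s (e i))) ∧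
      PatL E G w (fun i => x (e i) (s (e i))) (fun t => x (v t) (s (v t)))) :
    Tight k E ((rd w e v j).map fun p => x p.1 p.2) ∧
    (∃ post, (rd w e v j).map (fun p => x p.1 p.2) = ofFn (fun i => x (e i) j) ++ post) ∧
    ∃ z pre, G z ∧ (rd w e v j).map (fun p => x p.1 p.2) = pre ++ ofFn z := by
  classical
  have he : Injective e := fun i j hij => Sum.inl_injective (h (a₁ := Sum.inl i) (a₂ := Sum.inl j) hij)
  have hmap : ∀ (e : Fin k → ι) (j : ℕ), (ofFn fun i => (e i, j)).map (fun p => x p.1 p.2) = ofFn fun i => x (e i) j := by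
    intro e j; rw [List.map_ofFn]; rfl
  induction w generalizing e j with
  | nil =>
    simp only [rd, hmap]
    refine ⟨?_, ⟨[], by simp⟩, _, [], (hs (fun _ => j)).2, by simp⟩
    intro w hw hk
    have : w = ofFn fun i => x (e i) j := hw.eq_of_length (by simp [hk])
    rw [this]
    have := (hs (fun _ => j)).1
    unfold Ed at this; convert this using 1
    ext a; simp [List.mem_ofFn]
  | cons a w ih =>
    set e' := update e a (v 0) with he'
    have hinj' := upd_inj (a := a) h
    have hei' : Injective e' := (Sum.elim_injective.1 hinj').1
    have hsec : ∀ s : ι → ℕ, (update (fun i => x (e i) (s (e i))) a (x (v 0) (s (v 0)))) = fun i => x (e' i) (s (e' i)) := by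
      intro s; ext i
      by_cases hi : i = a
      · subst hi; simp [he']
      · simp [he', update_of_ne hi]
    have hs' : ∀ s : ι → ℕ, Ed E (fun i => x (e' i) (s (e' i))) ∧
      PatL E G w (fun i => x (e' i) (s (e' i))) (fun t => x (v t.succ) (s (v t.succ))) := by
      intro s
      have := (hs s).2
      simp only [PatL] at this
      rw [← hsec]; exact this
    obtain ⟨h1, ⟨post, h2⟩, z, pre, hz, h3⟩ := ih e' (fun t => v t.succ) (j+1) hinj' hs' hei'
    have hmix : Mix E (fun i => x (e i) j) (fun i => x (e' i) (j+1)) := by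
      intro t _
      by_cases hat : a.1 < t
      · convert (hs' (fun u => if ∃ i : Fin k, i.1 < t ∧ e' i = u then j+1 else j)).1 using 2 with i
        by_cases hi : i.1 < t
        · rw [if_pos hi, if_pos ⟨i, hi, rfl⟩]
        · rw [if_neg hi, if_neg]
          · congr 1; rw [he', update_of_ne]; rintro rfl; exact hi hat
          · rintro ⟨i', hi', h'⟩; rw [hei' h'] at hi'; exact hi hi'
      · convert (hs (fun u => if ∃ i : Fin k, i.1 < t ∧ e i = u then j+1 else j)).1 using 2 with i
        by_cases hi : i.1 < t
        · rw [if_pos hi, if_pos ⟨i, hi, rfl⟩]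
          show x (e' i) (j+1) = x (e i) (j+1)
          rw [he', update_of_ne]; rintro rfl; exact hat hi
        · rw [if_neg hi, if_neg]
          rintro ⟨i', hi', h'⟩; rw [he h'] at hi'; exact hi hi'
    simp only [rd, List.map_append, hmap]
    refine ⟨?_, ⟨_, rfl⟩, z, _, hz, by rw [h3, ← List.append_assoc]⟩
    rw [h2, ← List.append_assoc]
    rw [h2] at h1
    exact hmix.tight.glue h1 £
end
section
variable {V : Type} [Fintype V] [DecidableEq V] [Nonempty V]
lemma Ex_update {ι : Type} [Fintype ι] [DecidableEq ι] (a : ι) (f : (ι → V) → ℝ) :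
    Ex f = Ex fun v => Ex fun s : ι → V => f (update s a v) := by
  have h1 := Ex_equiv (Equiv.funSplitAt a V).symm f
  rw [← h1, Ex_prod]
  refine Ex_congr fun v => ?_
  rw [← Ex_equiv (Equiv.funSplitAt a V).symm, Ex_prod]
  rw [← Ex_const (Ω := V) (Ex fun b => f ((Equiv.funSplitAt a V).symm (v, b)))]
  refine Ex_congr fun u => Ex_congr fun b => ?_
  congr 1; ext i
  by_cases hi : i = a
  · subst hi; simp [Equiv.funSplitAt, Equiv.piSplitAt]
  · rw [update_of_ne hi]; simp [Equiv.funSplitAt, Equiv.piSplitAt, hi]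
variable {d : ℕ} {μ δ : ℝ} {L : ℕ} {c : ℝ} {E : Г} {A : Finset V → Finset V}
def mkr (p q : V) (s : Ψ → V) : Φ → V := Fin.cons p (Fin.cons q s)
lemma mkr_upd0 (p q v : V) (s : Ψ → V) : update Й 0 v = mkr v q s := Fin.update_cons_zero _ _ _
lemma mkr_upd1 (p q v : V) (s : Ψ → V) : update Й 1 v = mkr p v s := by
  have := Fin.cons_update (α := fun _ => V) p (Fin.cons q s : Fin (d+2) → V) 0 v
  rw [Fin.update_cons_zero] at this; exact this.symm
lemma mkr_upd2 (p q v : V) (s : Ψ → V) (a : Ψ) : update Й a.succ.succ v = mkr p q (update s a v) := by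
  unfold mkr; rw [Fin.cons_update, Fin.cons_update]
lemma Ex_mkr (f : Λ → ℝ) : Ex f = Ex fun p => Ex fun q => Ex fun s => f Й := by
  rw [Ex_cons]; refine Ex_congr fun p => ?_; rw [Ex_cons]; rfl
lemma Ex_mkr' (f : Λ → ℝ) : Ex f = Ex fun s => Ex fun p => Ex fun q => f Й := by
  rw [Ex_mkr, Ex_comm (Ω := Ψ → V)]
  refine Ex_congr fun p => ?_; rw [Ex_comm]
def w01 (d : ℕ) : ℕ → List (Φ)
  | 0 => [0, 1]
  | L+1 => w01 d L ++ [0, 1]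
lemma Rch_01 {g : Λ → ℝ} (hg : ∀ e, 0 ≤ g e) (p q : V) (s : Ψ → V) :
    (Ex fun p' => Ex fun q' => ind (KK E A (univ.image s) q p') * ind (KK E A (univ.image s) p' q') * g (mkr p' q' s)) ≤
      Rch E [0, 1] g Й := by
  simp only [Rch, mkr_upd0, mkr_upd1]
  refine Ex_mono fun p' => ?_
  rw [← Ex_mul_left]
  refine Ex_mono fun q' => ?_
  rw [mul_assoc]
  have h1 : ind (KK E A (univ.image s) q p') ≤ ind (Ed E (mkr p' q s)) := ind_mono fun h => by
    unfold Ed; rw [image_eq]; exact (KK_symm h).2.2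
  have h2 : ind (KK E A (univ.image s) p' q') ≤ ind (Ed E (mkr p' q' s)) := ind_mono fun h => by
    unfold Ed; rw [image_eq]; exact h.2.2
  exact mul_le_mul h1 (mlr h2 (hg _)) (mul_nonneg И (hg _)) И
lemma Rch_w01 (L : ℕ) {g : Λ → ℝ} (hg : ∀ e, 0 ≤ g e) (p q : V) (s : Ψ → V) :
    (Ex fun p' => Ex fun q' => Wk (KK E A (univ.image s)) (2*L) q p' * ind (KK E A (univ.image s) p' q') * g (mkr p' q' s)) ≤
      Rch E (w01 d L) g Й := by
  induction L generalizing g with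
  | zero => exact Rch_01 hg p q s
  | succ L ih =>
    rw [w01, Rch_append]
    refine le_trans ?_ (ih (Rch_nonneg E _ hg))
    set K := KK E A (univ.image s) with hK
    have h1 : (Ex fun p1 => Ex fun q1 => Wk K (2*L) q p1 * ind (K p1 q1) *
        Ex fun p' => Ex fun q' => ind (K q1 p') * ind (K p' q') * g (mkr p' q' s)) ≤
        Ex fun p1 => Ex fun q1 => Wk K (2*L) q p1 * ind (K p1 q1) * Rch E [0, 1] g (mkr p1 q1 s) :=
      Ex_mono fun p1 => Ex_mono fun q1 => mll (Rch_01 hg p1 q1 s)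
        (mul_nonneg (Wk_nonneg _ _ _ _) И)
    refine le_trans (le_of_eq ?_) h1
    symm
    rw [Ex_comm]
    have h2 : ∀ q1, (Ex fun p1 => Wk K (2*L) q p1 * ind (K p1 q1) *
        Ex fun p' => Ex fun q' => ind (K q1 p') * ind (K p' q') * g (mkr p' q' s)) =
        Ex fun p' => Ex fun q' => Wk K (2*L+1) q q1 * ind (K q1 p') * (ind (K p' q') * g (mkr p' q' s)) := by
      intro q1
      rw [Ex_mul_right]
      rw [show (Ex fun p1 => Wk K (2*L) q p1 * ind (K p1 q1)) = Wk K (2*L+1) q q1 from rfl, ← Ex_mul_left]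
      refine Ex_congr fun p' => ?_
      rw [← Ex_mul_left]; exact Ex_congr fun q' => by ring
    rw [Ex_congr h2, Ex_comm]
    refine Ex_congr fun p' => ?_
    rw [Ex_comm]
    refine Ex_congr fun q' => ?_
    rw [Ex_mul_right, mul_assoc]; rfl
lemma Good.Rch_w01 (hG : Good d μ δ L c E A) {g : Λ → ℝ} (hg : ∀ e, 0 ≤ g e) (p q : V) (s : Ψ → V)
    (hs : Injective s) (hq : q ∈ A (univ.image s)) :
    c * (Ex fun p' => Ex fun q' => ind (KK E A (univ.image s) p' q') * g (mkr p' q' s)) ≤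
      Rch E (w01 d L) g Й := by
  refine le_trans ?_ (TH.Rch_w01 (A := A) L hg p q s)
  rw [← Ex_mul_left]; refine Ex_mono fun p' => ?_
  rw [← Ex_mul_left]; refine Ex_mono fun q' => ?_
  rw [← mul_assoc]
  refine mlr ?_ (hg _)
  by_cases h : KK E A (univ.image s) p' q'
  · exact mlr (hG.walk _ (by rw [card_image_of_injective _ hs]; simp) _ hq _ h.1) И
  · rw [ind_false h]; simp
def fullw (d L : ℕ) : List (Ψ) → List (Φ)
  | [] => w01 d L
  | a :: as => w01 d L ++ (a.succ.succ :: fullw d L as)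
def mixf (as : List (Ψ)) (s s' : Ψ → V) : Ψ → V := fun i => if i ∈ as then s' i else s i
def Mx (as : List (Ψ)) (s s' : Ψ → V) : Prop :=
  ∀ bs : List (Ψ), bs ⊆ as → Injective (mixf bs s s')
noncomputable def Gs (E : Г) (A : Finset V → Finset V) (g : Λ → ℝ) (s : Ψ → V) : ℝ :=
  Ex fun p => Ex fun q => ind (KK E A (univ.image s) p q) * g Й
lemma Good.Rch_full (hG : Good d μ δ L c E A) (hμ : 0 ≤ μ) (hc : 0 ≤ c) {g : Λ → ℝ} (hg : ∀ e, 0 ≤ g e)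
    (as : List (Ψ)) (has : as.Nodup) (p q : V) (s : Ψ → V) (hs : Injective s) (hq : q ∈ A (univ.image s)) :
    c ^ (as.length + 1) * (2*μ) ^ as.length * (Ex fun s' => ind (Mx as s s') * Gs E A g (mixf as s s')) ≤
      Rch E (fullw d L as) g Й := by
  have hGs : ∀ s : Ψ → V, 0 ≤ Gs E A g s := fun s => Ex_nonneg fun _ => Ex_nonneg fun _ => mul_nonneg И (hg _)
  induction as generalizing p q s with
  | nil =>
    have hm : ∀ s' : Ψ → V, mixf [] s s' = s := fun s' => by ext i; simp [mixf]
    have h1 : ∀ s' : Ψ → V, ind (Mx [] s s') * Gs E A g (mixf [] s s') ≤ Gs E A g s := fun s' => by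
      rw [hm]; exact mul_le_of_le_one_left (hGs s) (ind_le_one _)
    have h2 := Ex_mono h1
    rw [Ex_const] at h2
    refine le_trans ?_ (hG.Rch_w01 hg p q s hs hq)
    simp only [List.length_nil, zero_add, pow_one, pow_zero, mul_one]
    exact mll h2 hc
  | cons a as ih =>
    rw [fullw, Rch_append]
    refine le_trans ?_ (hG.Rch_w01 (Rch_nonneg E _ hg) p q s hs hq)
    set C := c ^ (as.length + 1) * (2*μ) ^ as.length with hC
    have hC0 : 0 ≤ C := by positivity
    set H : V → ℝ := fun v => Ex fun s' => ind (Mx as (update s a v) s') * Gs E A g (mixf as (update s a v) s') with hH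
    have hH0 : ∀ v, 0 ≤ H v := fun v => Ex_nonneg fun _ => mul_nonneg И (hGs _)
    have hcS : (univ.image s).card = d + 1 := by rw [card_image_of_injective _ hs]; simp
    have h1 : ∀ p' q', (Ex fun v => ind (Injective (update s a v)) * ind (KK E A (univ.image (update s a v)) p' q') * (C * H v)) ≤
        Rch E (a.succ.succ :: fullw d L as) g (mkr p' q' s) := by
      intro p' q'
      simp only [Rch, mkr_upd2]
      refine Ex_mono fun v => ?_
      by_cases h2 : Injective (update s a v)
      · by_cases h3 : KK E A (univ.image (update s a v)) p' q'
        · have h4 : Ed E (mkr p' q' (update s a v)) := by unfold Ed; rw [image_eq]; exact h3.2.2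
          rw [ind_true h2, ind_true h3, ind_true h4, one_mul, one_mul, one_mul]
          exact ih (List.nodup_cons.1 has).2 p' q' (update s a v) h2 h3.2.1
        · rw [ind_false h3]; simp; exact mul_nonneg И (Rch_nonneg E _ hg _)
      · rw [ind_false h2]; simp; exact mul_nonneg И (Rch_nonneg E _ hg _)
    have h5 : (Ex fun s' => ind (Mx (a :: as) s s') * Gs E A g (mixf (a :: as) s s')) ≤
        Ex fun v => ind (Injective (update s a v)) * H v := by
      rw [Ex_update a]
      refine Ex_mono fun v => ?_
      rw [hH]; simp only
      rw [← Ex_mul_left]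
      refine Ex_mono fun s' => ?_
      have ham : a ∉ as := (List.nodup_cons.1 has).1
      have e1 : ∀ bs : List (Ψ), bs ⊆ as → mixf (a :: bs) s (update s' a v) = mixf bs (update s a v) s' := by
        intro bs hbs; ext i
        by_cases hi : i = a
        · subst hi; simp [mixf]; intro h; exact absurd (hbs h) ham
        · simp [mixf, hi]
      rw [e1 as (List.Subset.refl _), ← mul_assoc, ← ind_and]
      refine mlr (ind_mono fun h => ⟨?_, fun bs hbs => ?_⟩) (hGs _)
      · have := h [a] £
        rw [e1 [] £] at this
        convert this using 1; ext i; simp [mixf]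
      · rw [← e1 bs hbs]; exact h _ (List.cons_subset_cons _ hbs)
    have h6 : (2*μ) * (Ex fun v => ind (Injective (update s a v)) * H v) * C ≤
        Ex fun p' => Ex fun q' => ind (KK E A (univ.image s) p' q') *
          Ex fun v => ind (Injective (update s a v)) * ind (KK E A (univ.image (update s a v)) p' q') * (C * H v) := by
      have e2 : (Ex fun p' => Ex fun q' => ind (KK E A (univ.image s) p' q') *
          Ex fun v => ind (Injective (update s a v)) * ind (KK E A (univ.image (update s a v)) p' q') * (C * H v)) =
          Ex fun v => ind (Injective (update s a v)) * H v * C * Ex fun p' => Ex fun q' =>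
            ind (KK E A (univ.image s) p' q' ∧ KK E A (univ.image (update s a v)) p' q') := by
        simp only [← Ex_mul_left]
        rw [Ex_congr fun p' => Ex_comm _, Ex_comm]
        refine Ex_congr fun v => Ex_congr fun p' => Ex_congr fun q' => ?_
        rw [ind_and]; ring
      rw [e2, ← Ex_mul_left, ← Ex_mul_right]
      refine Ex_mono fun v => ?_
      by_cases h2 : Injective (update s a v)
      · have := hG.inter hcS (T := univ.image (update s a v)) (by rw [card_image_of_injective _ h2]; simp)
        have h7 : 0 ≤ ind (Injective (update s a v)) * H v * C := mul_nonneg (mul_nonneg И (hH0 v)) hC0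
        calc _ = ind (Injective (update s a v)) * H v * C * (2 * μ) := by ring
          _ ≤ _ := mll this h7
      · rw [ind_false h2]; simp
    calc c ^ ((a :: as).length + 1) * (2*μ) ^ (a :: as).length * (Ex fun s' => ind (Mx (a :: as) s s') * Gs E A g (mixf (a :: as) s s'))
        ≤ c ^ ((a :: as).length + 1) * (2*μ) ^ (a :: as).length * Ex fun v => ind (Injective (update s a v)) * H v :=
          mll h5 §
      _ = c * ((2*μ) * (Ex fun v => ind (Injective (update s a v)) * H v) * C) := by
          rw [hC]; simp only [List.length_cons, pow_succ]; ring
      _ ≤ _ := mll (h6.trans (Ex_mono fun p' => Ex_mono fun q' =>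
          mll (h1 p' q') И)) hc
lemma Ex_sum_elim {α β : Type} [Fintype α] [Fintype β] [DecidableEq α] [DecidableEq β] (f : (α ⊕ β → V) → ℝ) :
    Ex f = Ex fun a : α → V => Ex fun b : β → V => f (Sum.elim a b) := by
  rw [← Ex_equiv (Equiv.sumArrowEquivProdArrow α β V).symm f, Ex_prod]; rfl
lemma Good.pattern (hG : Good d μ δ L c E A) (hμ : 0 ≤ μ) (hμ1 : μ ≤ 1/2) (hc : 0 ≤ c) (hc1 : c ≤ 1) (F G : Λ → Prop)
    (hF : ∀ x, F x → FF E A x) (hG' : ∀ x, G x → FF E A x) :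
    c ^ (d+2) * (2*μ)^Ы * ((Ex fun x => ind (F x)) * (Ex fun x => ind (G x)) - (2*d+2)^2 / Ξ) ≤
      Ex fun e => ind (F e) * Rch E (fullw d L (List.finRange Ы)) (fun e => ind (G e)) e := by
  set as := List.finRange Ы
  set C := c ^ (d+2) * (2*μ)^Ы with hC
  have hC0 : 0 ≤ C := by positivity
  have hlen : as.length = d + 1 := by simp [as]
  have hmx : ∀ s s' : Ψ → V, mixf as s s' = s' := fun s s' => by ext i; simp [mixf, as]
  have key : ∀ s p q, C * (Ex fun s' => ind (F Й) * (ind (Mx as s s') * Ex fun p' => Ex fun q' => ind (G (mkr p' q' s')))) ≤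
      ind (F Й) * Rch E (fullw d L as) (fun e => ind (G e)) Й := by
    intro s p q
    by_cases h : F Й
    · have hK := hF _ h
      have hs : Injective s := by
        have := hG.inj hK.ed
        intro i j hij
        exact Fin.succ_injective _ (Fin.succ_injective _ (this (a₁ := i.succ.succ) (a₂ := j.succ.succ) hij))
      have := hG.Rch_full hμ hc (g := fun e => ind (G e)) (fun e => ind_nonneg _) as (List.nodup_finRange _) p q s hs hK.2.1
      rw [hlen] at this
      simp only [ind_true h, one_mul]
      refine le_trans ?_ this
      refine mll (Ex_mono fun s' => ?_) hC0
      rw [hmx]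
      refine mll (Ex_mono fun p' => Ex_mono fun q' => ?_) И
      rw [← ind_and]; exact ind_mono fun h => ⟨hG' _ h, h⟩
    · simp [ind_false h, Ex]
  rw [Ex_mkr' (fun e => ind (F e) * _)]
  refine le_trans ?_ (Ex_mono fun s => Ex_mono fun p => Ex_mono fun q => key s p q)
  simp only [Ex_mul_left]
  refine mll ?_ hC0
  have e1 : (Ex fun s : Ψ → V => Ex fun p => Ex fun q => ind (F Й) *
      Ex fun s' => ind (Mx as s s') * Ex fun p' => Ex fun q' => ind (G (mkr p' q' s'))) =
      Ex fun s => Ex fun s' => ind (Mx as s s') * ((Ex fun p => Ex fun q => ind (F Й)) * Ex fun p' => Ex fun q' => ind (G (mkr p' q' s'))) := by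
    refine Ex_congr fun s => ?_
    rw [Ex_congr fun p => Ex_mul_right _ _, Ex_mul_right, ← Ex_mul_left]
    exact Ex_congr fun s' => by ring
  rw [e1]
  have e2 : (Ex fun x => ind (F x)) * (Ex fun x => ind (G x)) =
      Ex fun s => Ex fun s' => (Ex fun p => Ex fun q => ind (F Й)) * Ex fun p' => Ex fun q' => ind (G (mkr p' q' s')) := by
    rw [Ex_mkr' (fun x => ind (F x)), Ex_mkr' (fun x => ind (G x)), ← Ex_mul_right]
    refine Ex_congr fun s => ?_
    rw [← Ex_mul_left]
  rw [e2]
  have h3 := avoid (V := V) (ι := Ψ ⊕ Ψ) ∅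
  rw [Ex_sum_elim] at h3
  simp only [Fintype.card_sum, Fintype.card_fin, card_empty] at h3
  have h4 : (Ex fun s => Ex fun s' => (Ex fun p => Ex fun q => ind (F Й)) * Ex fun p' => Ex fun q' => ind (G (mkr p' q' s'))) ≤
     Ex fun s => Ex fun s' => ind (Mx as s s') * ((Ex fun p => Ex fun q => ind (F Й)) * Ex fun p' => Ex fun q' => ind (G (mkr p' q' s')))
       + ind (¬ (Injective (Sum.elim s s') ∧ ∀ i, Sum.elim s s' i ∉ (∅ : Finset V))) := by
    refine Ex_mono fun s => Ex_mono fun s' => ?_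
    by_cases h : Injective (Sum.elim s s')
    · have : Mx as s s' := by
        intro bs _ i j hij
        simp only [mixf] at hij
        split_ifs at hij with h1 h2 h2
        · exact Sum.inr_injective (h (a₁ := Sum.inr i) (a₂ := Sum.inr j) hij)
        · have := h (a₁ := Sum.inr i) (a₂ := Sum.inl j) hij; simp at this
        · have := h (a₁ := Sum.inl i) (a₂ := Sum.inr j) hij; simp at this
        · exact Sum.inl_injective (h (a₁ := Sum.inl i) (a₂ := Sum.inl j) hij)
      rw [ind_true this, one_mul]; linarith [ind_nonneg (¬ (Injective (Sum.elim s s') ∧ ∀ i, Sum.elim s s' i ∉ (∅ : Finset V)))]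
    · rw [ind_true (show ¬ (Injective (Sum.elim s s') ∧ ∀ i, Sum.elim s s' i ∉ (∅ : Finset V)) from fun h' => h h'.1)]
      have a1 : (Ex fun p => Ex fun q => ind (F Й)) ≤ 1 := Ex_le_one fun p => Ex_ind_le_one _
      have a2 : (Ex fun p => Ex fun q => ind (G (mkr p q s'))) ≤ 1 := Ex_le_one fun p => Ex_ind_le_one _
      have a3 : 0 ≤ (Ex fun p => Ex fun q => ind (F Й)) := Ex_nonneg fun p => Ex_ind_nonneg _
      have a4 : 0 ≤ (Ex fun p => Ex fun q => ind (G (mkr p q s'))) := Ex_nonneg fun p => Ex_ind_nonneg _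
      have := mul_le_one₀ a1 a4 a2
      have := mul_nonneg (ind_nonneg (Mx as s s')) (mul_nonneg a3 a4)
      linarith
  simp only [Ex_add] at h4
  push_cast at h3
  have e5 : ((d:ℝ) + 1 + Ы)^2 + ((d:ℝ)+1 + Ы) * 0 = (2*d+2)^2 := by ring
  rw [e5] at h3
  linarith
def cW (d L : ℕ) : List (Φ) := fullw d L (List.finRange Ы)
def cR (d L : ℕ) : ℕ := Δ * ((cW d L).length + 1)
lemma conn (d : ℕ) {μ : ℝ} (δ : ℝ) (L : ℕ) {c ζ : ℝ} (hμ : 0 < μ) (hμ1 : μ ≤ 1/2) (hc : 0 < c) (hc1 : c ≤ 1) (hζ : 0 < ζ) :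
    ∃ (c' : ℝ) (n0 : ℕ), 0 < c' ∧ ∀ {V : Type} [Fintype V] [DecidableEq V] [Nonempty V] (E : Г) (A : Finset V → Finset V),
      Good d μ δ L c E A → n0 ≤ Ξ → ∀ y0 x0 : Λ, RC E A ζ y0 → LC E A ζ x0 →
      c' ≤ dens (cR d L) fun l => Tight Δ E (ofFn y0 ++ l ++ ofFn x0) := by
  set W := cW d L with hW
  set N := W.length with hN
  set c1 := c^(d+2) * (2*μ)^Ы * (ζ^2/2) with hc1d
  have hc10 : 0 < c1 := by positivity
  obtain ⟨n0, hn0⟩ := exists_nat_gt ((2*(d:ℝ)+2)^2 / (ζ^2/2))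
  refine ⟨c1 ^ ((N+1+1)^(Fintype.card (Φ ⊕ Fin N))), n0, by positivity, ?_⟩
  intro V _ _ _ E A hG hn y0 x0 hy hx
  set F : Λ → Prop := fun e => FF E A e ∧ Mix E y0 e with hF
  set G : Λ → Prop := fun e => FF E A e ∧ Mix E e x0 with hGd
  set P : (Φ ⊕ Fin N → V) → Prop := fun x => F (fun i => x (Sum.inl i)) ∧ PatL E G W (fun i => x (Sum.inl i)) (fun t => x (Sum.inr t)) with hPd
  have hP : c1 ≤ Ex fun x => ind (P x) := by
    have h1 := hG.pattern hμ.le hμ1 hc.le hc1 F G (fun x h => h.1) (fun x h => h.1)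
    rw [Ex_sum_elim]
    have h2 : (Ex fun a : Λ => Ex fun b : Fin N → V => ind (P (Sum.elim a b))) =
        Ex fun e => ind (F e) * Rch E W (fun e => ind (G e)) e := by
      refine Ex_congr fun e => ?_
      rw [Rch_eq, ← Ex_mul_left]
      refine Ex_congr fun v => ?_
      rw [← ind_and]; rfl
    rw [h2]
    refine le_trans ?_ h1
    rw [hc1d]
    refine mll ?_ §
    have hy' : ζ ≤ Ex fun x => ind (F x) := hy
    have hx' : ζ ≤ Ex fun x => ind (G x) := hx
    have h3 := mul_le_mul hy' hx' hζ.le (hζ.le.trans hy')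
    have hV : ø < Ξ := by exact_mod_cast Fintype.card_pos
    have h4 : (2*(d:ℝ)+2)^2 / Ξ ≤ ζ^2/2 := by
      rw [dli hV]
      rw [div_lt_iff₀ §] at hn0
      have : (n0:ℝ) ≤ Ξ := by exact_mod_cast hn
      nlinarith [sq_nonneg ζ]
    nlinarith
  have hinj : Injective (Sum.elim (Sum.inl : Φ → Φ ⊕ Fin N) Sum.inr) := by
    intro a b; cases a <;> cases b <;> simp
  have := dens_of_box P (N+1) (rd W Sum.inl Sum.inr 0) (rd_nodup _ _ _ _ hinj)
    (fun p hp => by have := (rd_snd _ _ _ _ p hp).2; omega)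
    (fun l => Tight Δ E (ofFn y0 ++ l ++ ofFn x0)) ?_ hc10.le hP
  · rw [rd_length] at this; exact this
  · intro x hs
    obtain ⟨h1, ⟨post, h2⟩, z, pre, hz, h3⟩ := rd_tight (E := E) (G := G) x W Sum.inl Sum.inr 0 hinj
      (fun s => ⟨(hs s).1.1.ed, (hs s).2⟩)
    set l := (rd W Sum.inl Sum.inr 0).map fun p => x p.1 p.2
    have h4 : Tight Δ E (ofFn y0 ++ l) := by
      rw [h2] at h1 ⊢; rw [← List.append_assoc]
      exact (hs (fun _ => 0)).1.2.tight.glue h1 £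
    rw [h3] at h4 ⊢
    rw [← List.append_assoc] at h4 ⊢
    exact h4.glue hz.2.tight £
lemma dens_app {r s : ℕ} {P : List V → Prop} {Q : List V → List V → Prop} {a b : ℝ} (hb : 0 ≤ b) (hP : a ≤ dens r P)
    (hQ : ∀ l, l.length = r → P l → b ≤ dens s (Q l)) :
    a * b ≤ dens (r+s) fun l => P (l.take r) ∧ Q (l.take r) (l.drop r) := by
  unfold dens at *
  rw [Ex_append]
  refine (mlr hP hb).trans ?_
  rw [← Ex_mul_right]
  refine Ex_mono fun x => ?_
  have e : ∀ y : Fin s → V, ofFn (Fin.append x y) = ofFn x ++ ofFn y := fun y => List.ofFn_fin_append x y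
  have e1 : ∀ y : Fin s → V, (ofFn x ++ ofFn y).take r = ofFn x := fun y => by
    rw [List.take_append_of_le_length £]; simp
  have e2 : ∀ y : Fin s → V, (ofFn x ++ ofFn y).drop r = ofFn y := fun y => by
    rw [List.drop_append_of_le_length £]; simp
  simp only [e, e1, e2]
  by_cases h : P (ofFn x)
  · rw [ind_true h, one_mul]
    exact (hQ _ £ h).trans (Ex_ind_mono fun y hy => ⟨h, hy⟩)
  · rw [ind_false h, zero_mul]; exact Ex_ind_nonneg _
lemma Ex_ninj (r : ℕ) : (Ex fun z : Fin r → V => ind (¬ Injective z)) ≤ (r:ℝ)^2 / Ξ := by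
  have := avoid (V := V) (ι := Fin r) ∅
  simp only [Fintype.card_fin, card_empty, Nat.cast_zero, mul_zero, add_zero] at this
  exact (Ex_ind_mono fun z h h' => h h'.1).trans this
structure Qd (d : ℕ) (V : Type) where
  x : Φ → V
  m : List V
  m' : List V
  y : Φ → V
variable {d : ℕ} {μ δ : ℝ} {L : ℕ} {c : ℝ} {E : Г} {A : Finset V → Finset V}
def Qd.l1 (q : Qd d V) : List V := ofFn q.x ++ q.m ++ ofFn q.y
def Qd.l2 (q : Qd d V) : List V := ofFn q.x ++ q.m' ++ ofFn q.y
structure Sw (E : Г) (A : Finset V → Finset V) (ζ : ℝ) (q : Qd d V) : Prop where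
  t1 : Tight Δ E q.l1
  t2 : Tight Δ E q.l2
  lc : LC E A ζ q.x
  rc : RC E A ζ q.y
def Qd.join (q : Qd d V) (c : List V) (r : Qd d V) : Qd d V :=
  ⟨q.x, q.m ++ ofFn q.y ++ c ++ ofFn r.x ++ r.m, q.m' ++ ofFn q.y ++ c ++ ofFn r.x ++ r.m', r.y⟩
lemma Qd.join_l1 (q : Qd d V) (c : List V) (r : Qd d V) : (q.join c r).l1 = q.l1 ++ c ++ r.l1 := by
  simp [Qd.join, Qd.l1]
lemma Qd.join_l2 (q : Qd d V) (c : List V) (r : Qd d V) : (q.join c r).l2 = q.l2 ++ c ++ r.l2 := by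
  simp [Qd.join, Qd.l2]
lemma glue3 {k : ℕ} {a b c e f : List V} (h1 : Tight k E (a ++ b)) (h2 : Tight k E (b ++ c ++ e)) (h3 : Tight k E (e ++ f))
    (hb : k ≤ b.length) (he : k ≤ e.length) : Tight k E ((a ++ b) ++ c ++ (e ++ f)) := by
  have h4 : Tight k E (a ++ b ++ (c ++ e)) := h1.glue (by rwa [List.append_assoc] at h2) ¿
  have h5 : Tight k E ((a ++ b ++ c) ++ e) := by simpa using h4
  have := h5.glue h3 ¿
  simpa using this
lemma Sw.join {ζ : ℝ} {q r : Qd d V} (hq : Sw E A ζ q) (hr : Sw E A ζ r) {c : List V}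
    (hc : Tight Δ E (ofFn q.y ++ c ++ ofFn r.x)) : Sw E A ζ (q.join c r) := by
  refine ⟨?_, ?_, hq.lc, hr.rc⟩
  · rw [Qd.join_l1]
    have h1 := hq.t1; have h2 := hr.t1
    unfold Qd.l1 at *
    rw [List.append_assoc] at h2
    have := glue3 h1 hc h2 £ £
    simpa using this
  · rw [Qd.join_l2]
    have h1 := hq.t2; have h2 := hr.t2
    unfold Qd.l2 at *
    rw [List.append_assoc] at h2
    have := glue3 h1 hc h2 £ £
    simpa using this
def Conns (R : ℕ) (E : Г) : Λ → List (Qd d V) → List V → Prop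
  | _, [], cs => cs = []
  | y, q :: qs, cs => Tight Δ E (ofFn y ++ cs.take R ++ ofFn q.x) ∧ Conns R E q.y qs (cs.drop R)
lemma Conns_dens {R : ℕ} {ζ c' : ℝ} (hc' : 0 ≤ c') (hconn : ∀ y0 x0 : Λ, RC E A ζ y0 → LC E A ζ x0 →
      c' ≤ dens R fun l => Tight Δ E (ofFn y0 ++ l ++ ofFn x0)) (qs : List (Qd d V)) (y : Λ)
    (hy : RC E A ζ y) (hqs : ∀ q ∈ qs, Sw E A ζ q) : c' ^ qs.length ≤ dens (R * qs.length) (Conns R E y qs) := by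
  induction qs generalizing y with
  | nil =>
    simp only [List.length_nil, pow_zero, Nat.mul_zero]
    unfold dens
    rw [Ex_congr (g := fun _ => (1:ℝ)) (fun τ => ind_true (by simp [Conns])), Ex_const]
  | cons q qs ih =>
    have hq := hqs q £
    have h1 := dens_app (P := fun l => Tight Δ E (ofFn y ++ l ++ ofFn q.x)) (Q := fun _ => Conns R E q.y qs)
      § (hconn y q.x hy hq.lc) (fun l _ _ => ih q.y hq.rc (fun q' h => hqs q' (by simp [h])))
    simp only [List.length_cons]
    rw [pow_succ', show R * (qs.length + 1) = R + R * qs.length by ring]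
    exact h1
lemma join_all {R : ℕ} {ζ : ℝ} (qs : List (Qd d V)) (q0 : Qd d V) (cs : List V) (h0 : Sw E A ζ q0) (hqs : ∀ q ∈ qs, Sw E A ζ q)
    (hc : Conns R E q0.y qs cs) : ∃ q : Qd d V, Sw E A ζ q ∧ q.l1.Perm (q0.l1 ++ qs.flatMap Qd.l1 ++ cs) ∧
      q.l2.Perm (q0.l2 ++ qs.flatMap Qd.l2 ++ cs) := by
  induction qs generalizing q0 cs with
  | nil =>
    have : cs = [] := hc
    subst this
    exact ⟨q0, h0, by simp, by simp⟩
  | cons q1 qs ih =>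
    obtain ⟨q, hq, hl1, hl2⟩ := ih (q0.join (cs.take R) q1) (cs.drop R) (h0.join (hqs q1 £) hc.1)
      (fun q h => hqs q (by simp [h])) hc.2
    refine ⟨q, hq, hl1.trans ?_, hl2.trans ?_⟩
    · rw [Qd.join_l1, List.flatMap_cons]
      rw [← Multiset.coe_eq_coe]; conv_rhs => rw [← List.take_append_drop R cs]
      simp only [← Multiset.coe_add]; abel
    · rw [Qd.join_l2, List.flatMap_cons]
      rw [← Multiset.coe_eq_coe]; conv_rhs => rw [← List.take_append_drop R cs]
      simp only [← Multiset.coe_add]; abel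
lemma Ex_mkr_inj {g : Λ → ℝ} {a : ℝ} (ha0 : 0 ≤ a) (ha : a ≤ 1) (hg : ∀ x, 0 ≤ g x)
    (h : ∀ s : Ψ → V, Injective s → a ≤ Ex fun p => Ex fun q => g Й) :
    a - Ы^2 / Ξ ≤ Ex g := by
  rw [Ex_mkr']
  have h1 : a ≤ Ex fun s : Ψ → V => (Ex fun p => Ex fun q => g Й) + ind (¬ Injective s) := by
    rw [← Ex_const (Ω := Ψ → V) a]
    refine Ex_mono fun s => ?_
    by_cases hs : Injective s
    · have := h s hs; have := ind_nonneg (¬ Injective s); linarith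
    · rw [ind_true hs]
      have : 0 ≤ Ex fun p => Ex fun q => g Й := Ex_nonneg fun _ => Ex_nonneg fun _ => hg _
      linarith
  rw [Ex_add] at h1
  have := Ex_ninj (V := V) Ы
  push_cast at this
  linarith
lemma Good.FF_dense (hG : Good d μ δ L c E A) (hμ : 0 ≤ μ) :
    4/9 - Ы^2 / Ξ ≤ Ex fun x : Λ => ind (FF E A x) := by
  refine Ex_mkr_inj (by norm_num) (by norm_num) (fun x => ind_nonneg _) fun s hs => ?_
  have := hG.dense (S := univ.image s) (by rw [card_image_of_injective _ hs]; simp)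
  exact le_trans ¶ this
end
section
variable {V : Type} [Fintype V] [DecidableEq V] [Nonempty V]
variable {d : ℕ} {μ δ : ℝ} {L : ℕ} {c : ℝ} {E : Г} {A : Finset V → Finset V}
lemma toF_ofFn {n : ℕ} (f : Fin n → V) : (ofFn f).toFinset = univ.image f := by
  ext a; simp [List.mem_ofFn]
lemma ofFn_tight {n : ℕ} {f : Fin n → V} (h : Ed E f) : (ofFn f).toFinset ∈ E := by rw [toF_ofFn]; exact h
noncomputable def zz (d : ℕ) (ε : ℝ) : ℝ := (ε/2)^(2^Δ)
lemma Good.arc (hG : Good d μ δ L c E A) (hμ : 0 ≤ μ) (hδ : 0 ≤ δ) (hδ1 : δ ≤ 1) {ε : ℝ} (hε : 0 < ε) (hε1 : ε ≤ δ/36)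
    (hn : 72 * Ы^2 ≤ Ξ) :
    δ/36 ≤ Ex fun u : Fin (d+4) → V => ind (FS E A Ц (fun i => u i.castSucc) ∧ FS E A Ц (fun i => u i.succ)) := by
  have hV : ø < Ξ := by exact_mod_cast Fintype.card_pos
  have herr : ((d:ℝ)+1)^2 / Ξ ≤ 1/72 := by
    rw [dli hV]
    have : (72 * ((d:ℝ)+1)^2) ≤ Ξ := by exact_mod_cast hn
    linarith
  have h1 : δ * (1/12) ≤ Ex fun u : Fin (d+4) → V => ind (FF E A (fun i : Φ => u i.castSucc) ∧ FF E A (fun i : Φ => u i.succ)) := by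
    rw [Ex_cons, Ex_comm]
    have h2 : ∀ f : Λ, δ * (ind (FF E A f) + ind (f 0 ∈ A (univ.image fun i : Ψ => f i.castSucc.succ)) + (-1)) ≤
        Ex fun p => ind (FF E A (fun i : Φ => (Fin.cons p f : Fin (d+4) → V) i.castSucc) ∧ FF E A (fun i : Φ => (Fin.cons p f : Fin (d+4) → V) i.succ)) := by
      intro f
      have hnn : 0 ≤ Ex fun p => ind (FF E A (fun i : Φ => (Fin.cons p f : Fin (d+4) → V) i.castSucc) ∧ FF E A (fun i : Φ => (Fin.cons p f : Fin (d+4) → V) i.succ)) := Ex_ind_nonneg _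
      have b1 := ind_le_one (FF E A f)
      have b2 := ind_le_one (f 0 ∈ A (univ.image fun i : Ψ => f i.castSucc.succ))
      by_cases hf : FF E A f
      · by_cases h0 : f 0 ∈ A (univ.image fun i : Ψ => f i.castSucc.succ)
        · rw [ind_true hf, ind_true h0]
          have hi := hG.inj hf.ed
          have := hG.deg (univ.image fun i : Ψ => f i.castSucc.succ) (by
            rw [card_image_of_injective _ (fun a b hab => Fin.castSucc_injective _ (Fin.succ_injective _ (hi hab)))]; simp) _ h0
          refine le_trans (by nlinarith) (this.trans (Ex_ind_mono fun p hp => ⟨?_, hf⟩))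
          exact KK_symm hp
        · rw [ind_false h0]; refine le_trans ?_ hnn; nlinarith
      · rw [ind_false hf]; refine le_trans ?_ hnn; nlinarith
    refine le_trans ?_ (Ex_mono h2)
    rw [Ex_mul_left]
    refine mll ?_ hδ
    rw [Ex_add, Ex_add, Ex_const]
    have h3 := hG.FF_dense hμ
    have h5 : 2/3 - Ы^2 / Ξ ≤ Ex fun f : Λ => ind (f 0 ∈ A (univ.image fun i : Ψ => f i.castSucc.succ)) := by
      rw [Ex_cons, Ex_comm]
      have h6 : ∀ g : Fin (d+2) → V, 2/3 - ind (¬ Injective fun i : Ψ => g i.castSucc) ≤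
          Ex fun a => ind ((Fin.cons a g : Λ) 0 ∈ A (univ.image fun i : Ψ => (Fin.cons a g : Λ) i.castSucc.succ)) := by
        intro g
        by_cases hg : Injective fun i : Ψ => g i.castSucc
        · have := hG.big (univ.image fun i : Ψ => g i.castSucc) (by rw [card_image_of_injective _ hg]; simp)
          have b := ind_nonneg (¬ Injective fun i : Ψ => g i.castSucc)
          refine le_trans ¶ this
        · rw [ind_true hg]; exact le_trans (by norm_num) (Ex_ind_nonneg _)
      refine le_trans ?_ (Ex_mono h6)
      rw [Ex_sub, Ex_const, Ex_marginal (fun i : Ψ => i.castSucc) (Fin.castSucc_injective _) (fun z => ind (¬ Injective z))]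
      have := Ex_ninj (V := V) Ы
      push_cast at this; linarith
    linarith
  have e1 : (Ex fun u : Fin (d+4) → V => ind (FF E A (fun i : Φ => u i.castSucc) ∧ ¬ FS E A Ц (fun i : Φ => u i.castSucc))) ≤ ε := by
    rw [Ex_marginal (fun i : Φ => i.castSucc) (Fin.castSucc_injective _) (fun z => ind (FF E A z ∧ ¬ FS E A Ц z))]
    exact FS_most hε E A
  have e2 : (Ex fun u : Fin (d+4) → V => ind (FF E A (fun i : Φ => u i.succ) ∧ ¬ FS E A Ц (fun i : Φ => u i.succ))) ≤ ε := by
    rw [Ex_marginal (fun i : Φ => i.succ) (Fin.succ_injective _) (fun z => ind (FF E A z ∧ ¬ FS E A Ц z))]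
    exact FS_most hε E A
  have h7 := Ex_mono fun u : Fin (d+4) → V => show ind (FF E A (fun i : Φ => u i.castSucc) ∧ FF E A (fun i : Φ => u i.succ)) ≤
      ind (FS E A Ц (fun i => u i.castSucc) ∧ FS E A Ц (fun i => u i.succ)) +
      (ind (FF E A (fun i : Φ => u i.castSucc) ∧ ¬ FS E A Ц (fun i : Φ => u i.castSucc)) +
       ind (FF E A (fun i : Φ => u i.succ) ∧ ¬ FS E A Ц (fun i : Φ => u i.succ))) from by
    refine le_trans ?_ (add_le_add_right (ind_or_le _ _) _)
    refine le_trans ?_ (ind_or_le _ _)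
    exact ind_mono fun h => by tauto
  rw [Ex_add, Ex_add] at h7
  linarith
lemma Good.spec (hG : Good d μ δ L c E A) (hμ : 0 ≤ μ) (hδ : 0 ≤ δ) (hδ1 : δ ≤ 1) {ε : ℝ} (hε : 0 < ε) (hε1 : ε ≤ δ/36)
    (hn : 72 * Ы^2 ≤ Ξ) :
    (δ/36)^(3^(d+4)) ≤ TH.dens (2*Δ+1) fun l => ∃ q : Qd d V, Sw E A Ц q ∧ q.l1 = l := by
  have key := hG.arc hμ hδ hδ1 hε hε1 hn
  have := dens_of_box _ 2 ((ofFn fun i : Φ => (i.castSucc, 0)) ++ [(0,1)] ++ ofFn fun i : Φ => (i.succ, 1))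
    ?_ ?_ (fun l => ∃ q : Qd d V, Sw E A Ц q ∧ q.l1 = l) ?_ § key
  · simp only [Fintype.card_fin, List.length_append, List.length_ofFn, List.length_singleton] at this
    rwa [show d + 3 + 1 + Δ = 2*Δ+1 by ring] at this
  · rw [List.nodup_append, List.nodup_append, List.nodup_ofFn, List.nodup_ofFn]
    refine ⟨⟨fun a b h => ?_, by simp, ?_⟩, fun a b h => ?_, ?_⟩
    · simpa using h
    · intro a ha b hb hab; subst hab; simp only [List.mem_ofFn, List.mem_singleton] at ha hb; subst hb; simp at ha
    · simpa using h
    · intro a ha b hb hab; subst hab; simp only [List.mem_append, List.mem_ofFn, List.mem_singleton] at ha hb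
      obtain ⟨j, rfl⟩ := hb
      simp [Fin.succ_ne_zero] at ha
  · intro p hp; simp only [List.mem_append, List.mem_ofFn, List.mem_singleton] at hp; rcases hp with (⟨i, rfl⟩ | rfl) | ⟨i, rfl⟩ <;> simp
  · intro x hs
    set e : Φ → V := fun i => x i.castSucc 0
    set f : Φ → V := fun i => x i.succ 1
    set e' : Φ → V := fun i => x i.castSucc 1
    have hm : Mix E e e' := by
      intro t _
      have := (hs (fun j => if j.1 < t then 1 else 0)).1.1.ed
      convert this using 2 with i
      simp only [Fin.val_castSucc, e, e']; split_ifs <;> rfl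
    have hef : x 0 1 :: ofFn f = ofFn e' ++ [x (Fin.last _) 1] := by
      have a1 : ofFn (fun i : Fin (d+4) => x i 1) = x 0 1 :: ofFn f := List.ofFn_succ
      have a2 := List.ofFn_succ' (fun i : Fin (d+4) => x i 1)
      rw [← a1, a2, List.concat_eq_append]
    have ht2 : Tight Δ E (ofFn e' ++ [x (Fin.last _) 1]) := by
      intro w ⟨s, t, hst⟩ hk
      have hl := congrArg List.length hst
      simp [hk] at hl
      by_cases hs0 : s.length = 0
      · rw [List.length_eq_zero_iff] at hs0; subst hs0
        have : w = ofFn e' := by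
          have := congrArg (List.take Δ) hst
          rw [List.nil_append, List.take_append_of_le_length ¿, List.take_append_of_le_length £] at this
          rwa [List.take_of_length_le ¿, List.take_of_length_le (by rw [List.length_ofFn])] at this
        rw [this]; exact ofFn_tight (hs (fun _ => 1)).1.1.ed
      · have ht0 : t = [] := by rw [← List.length_eq_zero_iff]; omega
        subst ht0
        have hs1 : s.length = 1 := by simp at hl; omega
        rw [← hef, List.append_nil] at hst
        obtain ⟨a, rfl⟩ := List.length_eq_one_iff.1 hs1
        simp only [List.singleton_append, List.cons.injEq] at hst
        rw [hst.2]; exact ofFn_tight (hs (fun _ => 1)).2.1.ed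
    have ht : Tight Δ E (ofFn e ++ [x 0 1] ++ ofFn f) := by
      rw [List.append_assoc, List.singleton_append, hef, ← List.append_assoc]
      exact hm.tight.glue ht2 £
    refine ⟨⟨e, [x 0 1], [x 0 1], f⟩, ⟨ht, ht, (hs (fun _ => 0)).1.2.2, (hs (fun _ => 1)).2.2.1⟩, ?_⟩
    simp only [Qd.l1, List.map_append, List.map_ofFn, List.map_cons, List.map_nil]; rfl
lemma Good.inter_upd (hG : Good d μ δ L c E A) (hμ : 0 ≤ μ) (hμ1 : μ ≤ 1/2) (u v : V) :
    2*μ - (d+2)^2 / Ξ ≤ Ex fun f : Λ => ind (FF E A (update f (0 : Ψ).succ.succ u) ∧ Ed E (update f (0 : Ψ).succ.succ v)) := by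
  rw [Ex_mkr']
  simp only [mkr_upd2]
  have h1 : ∀ s : Ψ → V, 2*μ - ind (¬ (Injective s ∧ ∀ i, s i ∉ ({u, v} : Finset V))) ≤
      Ex fun p => Ex fun q => ind (FF E A (mkr p q (update s 0 u)) ∧ Ed E (mkr p q (update s 0 v))) := by
    intro s
    by_cases hs : Injective s ∧ ∀ i, s i ∉ ({u, v} : Finset V)
    · have hu : ∀ a ∈ ({u, v} : Finset V), Injective (update s 0 a) := by
        intro a ha i j hij
        by_cases hi : i = 0 <;> by_cases hj : j = 0
        · rw [hi, hj]
        · subst hi; rw [update_self, update_of_ne hj] at hij; exact absurd (hij ▸ ha) (hs.2 j)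
        · subst hj; rw [update_self, update_of_ne hi] at hij; exact absurd (hij ▸ ha) (hs.2 i)
        · rw [update_of_ne hi, update_of_ne hj] at hij; exact hs.1 hij
      have := hG.inter' (S := univ.image (update s 0 u)) (T := univ.image (update s 0 v))
        (by rw [card_image_of_injective _ (hu u £)]; simp) (by rw [card_image_of_injective _ (hu v £)]; simp)
      have b := ind_nonneg (¬ (Injective s ∧ ∀ i, s i ∉ ({u, v} : Finset V)))
      refine le_trans ¶ (this.trans (Ex_mono fun p => Ex_ind_mono fun q h => ⟨h.1, ?_⟩))
      unfold Ed; rw [image_eq]; exact h.2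
    · rw [ind_true hs]; exact le_trans ¶ (Ex_nonneg fun _ => Ex_ind_nonneg _)
  refine le_trans ?_ (Ex_mono h1)
  rw [Ex_sub, Ex_const]
  have h2 := avoid (V := V) (ι := Ψ) {u, v}
  have hc : (({u, v} : Finset V).card : ℝ) ≤ 2 := by exact_mod_cast card_le_two
  have hV : ø < Ξ := by exact_mod_cast Fintype.card_pos
  have h3 : (((Fintype.card (Ψ) : ℕ):ℝ)^2 + (Fintype.card (Ψ) : ℕ) * (({u, v} : Finset V).card : ℝ)) / Ξ ≤ (d+2)^2 / Ξ := by
    refine ddr ?_ hV.le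
    simp only [Fintype.card_fin]; push_cast; nlinarith
  linarith
def AbsP (E : Г) (A : Finset V → Finset V) (ζ : ℝ) (v : Λ) (x : Φ ⊕ (Φ × Φ) → V) : Prop :=
  FS E A ζ (fun i => x (Sum.inl i)) ∧ ∀ i, FS E A ζ (update (fun j => x (Sum.inr (i, j))) (0 : Ψ).succ.succ (x (Sum.inl i))) ∧
    Ed E (update (fun j => x (Sum.inr (i, j))) (0 : Ψ).succ.succ (v i))
lemma Good.absP (hG : Good d μ δ L c E A) (hμ : 0 < μ) (hμ1 : μ ≤ 1/2) {ε : ℝ} (hε : 0 < ε) (hε1 : ε ≤ μ / (18 * Δ))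
    (hn : (d+2)^2 / (Ξ : ℝ) ≤ μ/9) (v : Λ) :
    (1/9) * μ^Δ ≤ Ex fun x => ind (AbsP E A Ц v x) := by
  set ζ := zz d ε
  set j2 := (0 : Ψ).succ.succ
  set h : V → ℝ := fun u => Ex fun f : Λ => ind (FF E A (update f j2 u) ∧ ¬ FS E A ζ (update f j2 u)) with hh
  set g : Φ → V → ℝ := fun i u => Ex fun f : Λ => ind (FS E A ζ (update f j2 u) ∧ Ed E (update f j2 (v i))) with hg
  have hd : ø ≤ d := ncn d
  have hg1 : ∀ i u, h u < μ/2 → μ ≤ g i u := by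
    intro i u hu
    have h1 := hG.inter_upd hμ.le hμ1 u (v i)
    have h2 : (Ex fun f : Λ => ind (FF E A (update f j2 u) ∧ Ed E (update f j2 (v i)))) ≤ g i u + h u := by
      rw [hg, hh]; simp only; rw [← Ex_add]
      exact Ex_mono fun f => le_trans (ind_mono fun h => by tauto) (ind_or_le _ _)
    linarith
  have hFS : (Ex fun x : Λ => ind (FF E A x ∧ ¬ FS E A ζ x)) ≤ ε := FS_most hε E A
  have hEh : Ex h ≤ ε := by rw [Ex_update j2] at hFS; exact hFS
  have hbad : (Ex fun u => ind (μ/2 ≤ h u)) ≤ 2 * ε / μ := by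
    have := Ex_markov (f := h) (fun u => Ex_ind_nonneg _) (t := μ/2)
    rw [le_div_iff₀ hμ]; linarith
  have hw : 1/9 ≤ Ex fun w : Λ => ind (FS E A ζ w ∧ ∀ i, h (w i) < μ/2) := by
    have h1 := hG.FF_dense hμ.le
    have h2 : (Ex fun x : Λ => ind (FF E A x)) ≤ (Ex fun w : Λ => ind (FS E A ζ w ∧ ∀ i, h (w i) < μ/2)) +
        ((Ex fun x : Λ => ind (FF E A x ∧ ¬ FS E A ζ x)) + Ex fun w : Λ => ∑ i, ind (μ/2 ≤ h (w i))) := by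
      rw [← Ex_add, ← Ex_add]
      refine Ex_mono fun w => ?_
      refine le_trans ?_ (add_le_add_right (add_le_add_right (ind_exists_le univ _) _) _)
      refine le_trans ?_ (add_le_add_right (ind_or_le _ _) _)
      refine le_trans (ind_mono fun h' => ?_) (ind_or_le _ _)
      by_cases a : FS E A ζ w
      · by_cases b : ∀ i, h (w i) < μ/2
        · exact Or.inl ⟨a, b⟩
        · push Not at b; obtain ⟨i, hi⟩ := b; exact Or.inr (Or.inr ⟨i, mem_univ _, hi⟩)
      · exact Or.inr (Or.inl ⟨h', a⟩)
    have h3 : (Ex fun w : Λ => ∑ i, ind (μ/2 ≤ h (w i))) ≤ 1/9 := by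
      rw [Ex_sum]
      calc _ = ∑ i : Φ, Ex fun u => ind (μ/2 ≤ h u) := sum_congr rfl fun i _ => Ex_coord i (fun u => ind (μ/2 ≤ h u))
        _ ≤ ∑ i : Φ, 2 * ε / μ := sum_le_sum fun i _ => hbad
        _ = Δ * (2 * ε / μ) := by simp
        _ ≤ 1/9 := by
          rw [le_div_iff₀ §] at hε1
          rw [← mul_div_assoc, dli hμ]; linarith
    have h4 : ε ≤ 1/36 := hε1.trans (by rw [dli §]; nlinarith)
    have h5 : ((d:ℝ)+1)^2 / Ξ ≤ (d+2)^2 / Ξ :=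
      ddr (by nlinarith) (ncn _)
    linarith
  rw [Ex_sum_elim]
  have key : ∀ w : Λ, (Ex fun b => ind (AbsP E A ζ v (Sum.elim w b))) = ind (FS E A ζ w) * ∏ i, g i (w i) := by
    intro w
    rw [← Ex_equiv (Equiv.curry (Φ) (Φ) V).symm]
    have : ∀ F : Φ → Φ → V, ind (AbsP E A ζ v (Sum.elim w ((Equiv.curry (Φ) (Φ) V).symm F))) =
        ind (FS E A ζ w) * ∏ i, ind (FS E A ζ (update (F i) j2 (w i)) ∧ Ed E (update (F i) j2 (v i))) := by
      intro F; rw [← ind_forall, ← ind_and]; rfl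
    rw [Ex_congr this, Ex_mul_left, Ex_pi_prod (fun i f => ind (FS E A ζ (update f j2 (w i)) ∧ Ed E (update f j2 (v i))))]
  rw [Ex_congr key]
  calc (1/9) * μ^Δ ≤ (Ex fun w : Λ => ind (FS E A ζ w ∧ ∀ i, h (w i) < μ/2)) * μ^Δ :=
        mlr hw §
    _ = Ex fun w : Λ => ind (FS E A ζ w ∧ ∀ i, h (w i) < μ/2) * μ^Δ := by rw [Ex_mul_right]
    _ ≤ _ := Ex_mono fun w => by
      by_cases hw : FS E A ζ w ∧ ∀ i, h (w i) < μ/2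
      · rw [ind_true hw, ind_true hw.1, one_mul, one_mul]
        calc μ^Δ = ∏ i : Φ, μ := by simp
          _ ≤ _ := prod_le_prod (fun _ _ => hμ.le) fun i _ => hg1 i _ (hw.2 i)
      · rw [ind_false hw, zero_mul]
        exact mul_nonneg И (prod_nonneg fun i _ => Ex_ind_nonneg _)
lemma mix_upd {k : ℕ} {f f' : Fin k → V} {j : Fin k} {u u' : V}
    (h : ∀ s : Fin k → Prop, ∀ g : Fin k → V, (∀ i, s i → g i = f' i) → (∀ i, ¬ s i → g i = f i) → Ed E (update g j u) ∧ Ed E (update g j u')) :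
    Mix E (update f j u) (update f' j u') := by
  intro t _
  have := h (fun i => i.1 < t) (fun i => if i.1 < t then f' i else f i) (fun i hi => if_pos hi) (fun i hi => if_neg hi)
  by_cases hj : j.1 < t
  · convert this.2 using 1; ext i
    by_cases hi : i = j
    · subst hi; simp [hj]
    · simp [update_of_ne hi]
  · convert this.1 using 1; ext i
    by_cases hi : i = j
    · subst hi; simp [hj]
    · simp [update_of_ne hi]
lemma coe_ofFn {n : ℕ} (f : Fin n → V) : ((ofFn f : List V) : Multiset V) = ∑ i, {f i} := by
  induction n with
  | zero => simp
  | succ n ih => rw [List.ofFn_succ, Fin.sum_univ_succ, ← ih]; rfl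
lemma coe_flat {n : ℕ} {α : Type} (f : Fin n → α) (l : α → List V) : ((((List.finRange n).map f).flatMap l : List V) : Multiset V) = ∑ i, (l (f i) : Multiset V) := by
  rw [List.map_eq_flatMap, List.flatMap_assoc]
  simp only [List.flatMap_cons, List.flatMap_nil, List.append_nil]
  induction n with
  | zero => simp
  | succ n ih => rw [List.finRange_succ, Fin.sum_univ_succ, ← ih (fun i => f i.succ), List.flatMap_cons, ← Multiset.coe_add, List.flatMap_map]
lemma coe_upd {n : ℕ} (f : Fin n → V) (j : Fin n) (v : V) : ((ofFn (update f j v) : List V) : Multiset V) + {f j} = (ofFn f : List V) + {v} := by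
  rw [coe_ofFn, coe_ofFn, ← Finset.add_sum_erase _ _ (mem_univ j), ← Finset.add_sum_erase univ (fun i => ({f i} : Multiset V)) (mem_univ j), update_self]
  rw [sum_congr rfl (g := fun i => ({f i} : Multiset V))]
  · abel
  · intro i hi; rw [update_of_ne (ne_of_mem_erase hi)]
def rnd (d : ℕ) (i : Φ) (t σ : ℕ) : Φ → (Φ ⊕ (Φ × Φ)) × ℕ :=
  update (fun j => (Sum.inr (i, j), t)) (0 : Ψ).succ.succ (Sum.inl i, σ)
def absL (d : ℕ) : List ((Φ ⊕ (Φ × Φ)) × ℕ) :=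
  (ofFn fun i => (Sum.inl i, 0)) ++ (ofFn fun i => (Sum.inl i, 1)) ++
    (List.finRange Δ).flatMap fun i => ofFn (rnd d i 0 3) ++ ofFn (rnd d i 1 2) ++ ofFn (rnd d i 2 4)
lemma mem_rnd {i : Φ} {t σ : ℕ} {p} (h : p ∈ ofFn (rnd d i t σ)) : p = (Sum.inl i, σ) ∨ ∃ j, p = (Sum.inr (i, j), t) := by
  rw [List.mem_ofFn] at h; obtain ⟨j, rfl⟩ := h
  unfold rnd
  by_cases hj : j = (0 : Ψ).succ.succ
  · subst hj; left; simp
  · right; exact ⟨j, by rw [update_of_ne hj]⟩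
lemma rnd_nodup (i : Φ) (t σ : ℕ) : (ofFn (rnd d i t σ)).Nodup := by
  rw [List.nodup_ofFn]; intro a b hab
  unfold rnd at hab
  by_cases ha : a = (0 : Ψ).succ.succ <;> by_cases hb : b = (0 : Ψ).succ.succ
  · rw [ha, hb]
  · subst ha; rw [update_self, update_of_ne hb] at hab; simp at hab
  · subst hb; rw [update_self, update_of_ne ha] at hab; simp at hab
  · rw [update_of_ne ha, update_of_ne hb] at hab; simpa using hab
lemma mem_rnd3 {i : Φ} {p} (h : p ∈ ofFn (rnd d i 0 3) ++ ofFn (rnd d i 1 2) ++ ofFn (rnd d i 2 4)) :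
    (∃ σ, 2 ≤ σ ∧ σ ≤ 4 ∧ p = (Sum.inl i, σ)) ∨ ∃ j t, t ≤ 4 ∧ p = (Sum.inr (i, j), t) := by
  rw [List.mem_append, List.mem_append] at h
  rcases h with (h | h) | h <;> rcases mem_rnd h with rfl | ⟨j, rfl⟩
  · exact Or.inl ⟨3, by simp⟩
  · exact Or.inr ⟨j, 0, by simp⟩
  · exact Or.inl ⟨2, by simp⟩
  · exact Or.inr ⟨j, 1, by simp⟩
  · exact Or.inl ⟨4, by simp⟩
  · exact Or.inr ⟨j, 2, by simp⟩
lemma absL_nodup (d : ℕ) : (absL d).Nodup := by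
  unfold absL
  rw [List.nodup_append, List.nodup_append]
  refine ⟨⟨?_, ?_, ?_⟩, ?_, ?_⟩
  · rw [List.nodup_ofFn]; intro a b h; simpa using h
  · rw [List.nodup_ofFn]; intro a b h; simpa using h
  · intro a ha b hb hab; subst hab; rw [List.mem_ofFn] at ha hb
    obtain ⟨i, rfl⟩ := ha; obtain ⟨j, h⟩ := hb; simp at h
  · rw [List.nodup_flatMap]
    refine ⟨fun i _ => ?_, ?_⟩
    · rw [List.nodup_append, List.nodup_append]
      refine ⟨⟨rnd_nodup _ _ _, rnd_nodup _ _ _, ?_⟩, rnd_nodup _ _ _, ?_⟩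
      · intro a ha b hb hab; subst hab
        rcases mem_rnd ha with rfl | ⟨j, rfl⟩ <;> rcases mem_rnd hb with h | ⟨j, h⟩ <;> simp at h
      · intro a ha b hb hab; subst hab
        rw [List.mem_append] at ha
        rcases ha with ha | ha <;> rcases mem_rnd ha with rfl | ⟨j, rfl⟩ <;> rcases mem_rnd hb with h | ⟨j, h⟩ <;> simp at h
    · refine (List.nodup_finRange _).imp ?_
      intro i j hij a ha hb
      rcases mem_rnd3 ha with ⟨σ, _, _, rfl⟩ | ⟨t, s, _, rfl⟩ <;> rcases mem_rnd3 hb with ⟨σ, _, _, h⟩ | ⟨t, s, _, h⟩ <;> simp at h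
      · exact hij h.1
      · exact hij h.1.1
  · intro a ha b hb hab; subst hab
    rw [List.mem_append, List.mem_ofFn, List.mem_ofFn] at ha
    rw [List.mem_flatMap] at hb
    obtain ⟨j, _, hj⟩ := hb
    rcases ha with ⟨i, rfl⟩ | ⟨i, rfl⟩ <;> rcases mem_rnd3 hj with ⟨σ, h2, _, h⟩ | ⟨t, s, _, h⟩ <;> simp at h <;> omega
lemma absL_lt (d : ℕ) : ∀ p ∈ absL d, p.2 < 5 := by
  intro p hp; unfold absL at hp
  rw [List.mem_append, List.mem_append, List.mem_ofFn, List.mem_ofFn, List.mem_flatMap] at hp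
  rcases hp with (⟨i, rfl⟩ | ⟨i, rfl⟩) | ⟨i, _, h⟩
  · simp
  · simp
  · rcases mem_rnd3 h with ⟨σ, h2, _, rfl⟩ | ⟨t, s, _, rfl⟩ <;> simp <;> omega
lemma absL_length (d : ℕ) : (absL d).length = Δ * (2 + 3*Δ) := by
  unfold absL
  rw [List.length_append, List.length_append, List.length_ofFn, List.length_ofFn, List.length_flatMap]
  simp only [List.length_append, List.length_ofFn, List.map_const', List.sum_replicate, List.length_finRange, smul_eq_mul]
  ring
lemma three_tight {k : ℕ} {a b c : Fin k → V} (h1 : Mix E a b) (h2 : Mix E b c) :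
    Tight k E (ofFn a ++ ofFn b ++ ofFn c) :=
  h1.tight.glue h2.tight £
def Blk (E : Г) (A : Finset V → Finset V) (ζ : ℝ) (v : Λ) (l : List V) : Prop :=
  ∃ (q0 : Qd d V) (qs : List (Qd d V)), qs.length = d+3 ∧ Sw E A ζ q0 ∧ (∀ q ∈ qs, Sw E A ζ q) ∧
    l = q0.l1 ++ qs.flatMap Qd.l1 ∧ (q0.l2 ++ qs.flatMap Qd.l2).Perm (l ++ ofFn v)
lemma blk_of {ζ : ℝ} {v : Λ} (x : Φ ⊕ (Φ × Φ) → ℕ → V)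
    (hs : ∀ s : Φ ⊕ (Φ × Φ) → ℕ, AbsP E A ζ v fun i => x i (s i)) :
    Blk E A ζ v ((absL d).map fun p => x p.1 p.2) := by
  classical
  set j2 := (0 : Ψ).succ.succ with hj2
  set w : ℕ → Φ → V := fun t i => x (Sum.inl i) t with hw
  set f : Φ → ℕ → Φ → V := fun i t j => x (Sum.inr (i, j)) t with hf
  have hmw : ∀ a b, Mix E (w a) (w b) := by
    intro a b t _
    have := (hs (Sum.elim (fun i => if i.1 < t then b else a) (fun _ => 0))).1.1.ed
    convert this using 2 with i
    simp only [Sum.elim_inl, hw]; split_ifs <;> rfl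
  have hsec : ∀ i t t' σ (s : Φ → Prop) (g : Λ), (∀ j, s j → g j = f i t' j) → (∀ j, ¬ s j → g j = f i t j) →
      FS E A ζ (update g j2 (x (Sum.inl i) σ)) ∧ Ed E (update g j2 (v i)) := by
    intro i t t' σ s g h1 h2
    have := (hs (Sum.elim (fun _ => σ) (fun p => if s p.2 then t' else t))).2 i
    have e : (fun j => x (Sum.inr (i, j)) ((Sum.elim (fun _ : Φ => σ) (fun p : Φ × Φ => if s p.2 then t' else t)) (Sum.inr (i, j)))) = g := by
      ext j; simp only [Sum.elim_inr]
      by_cases hj : s j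
      · rw [if_pos hj, h1 j hj]
      · rw [if_neg hj, h2 j hj]
    simp only [e] at this
    exact this
  have hm1 : ∀ i t t' σ σ', Mix E (update (f i t) j2 (x (Sum.inl i) σ)) (update (f i t') j2 (x (Sum.inl i) σ')) := fun i t t' σ σ' =>
    mix_upd fun s g h1 h2 => ⟨(hsec i t t' σ s g h1 h2).1.1.ed, (hsec i t t' σ' s g h1 h2).1.1.ed⟩
  have hm2 : ∀ i t t' σ, Mix E (update (f i t) j2 (x (Sum.inl i) σ)) (update (f i t') j2 (v i)) := fun i t t' σ =>
    mix_upd fun s g h1 h2 => ⟨(hsec i t t' σ s g h1 h2).1.1.ed, (hsec i t t' σ s g h1 h2).2⟩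
  have hm3 : ∀ i t t' σ, Mix E (update (f i t) j2 (v i)) (update (f i t') j2 (x (Sum.inl i) σ)) := fun i t t' σ =>
    mix_upd fun s g h1 h2 => ⟨(hsec i t t' σ s g h1 h2).2, (hsec i t t' σ s g h1 h2).1.1.ed⟩
  have hFS : ∀ i t σ, FS E A ζ (update (f i t) j2 (x (Sum.inl i) σ)) := fun i t σ =>
    (hsec i t t σ (fun _ => True) (f i t) (fun _ _ => rfl) (fun _ _ => rfl)).1
  set q0 : Qd d V := ⟨w 0, [], ofFn (w 2), w 1⟩ with hq0
  set q : Φ → Qd d V := fun i => ⟨update (f i 0) j2 (x (Sum.inl i) 3), ofFn (update (f i 1) j2 (x (Sum.inl i) 2)),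
    ofFn (update (f i 1) j2 (v i)), update (f i 2) j2 (x (Sum.inl i) 4)⟩ with hq
  have hr : ∀ i t σ, (ofFn (rnd d i t σ)).map (fun p => x p.1 p.2) = ofFn (update (f i t) j2 (x (Sum.inl i) σ)) := by
    intro i t σ; rw [List.map_ofFn]; congr 1; unfold rnd; rw [Function.comp_update]; rfl
  have hl : (absL d).map (fun p => x p.1 p.2) = q0.l1 ++ ((List.finRange Δ).map q).flatMap Qd.l1 := by
    unfold absL
    rw [List.map_append, List.map_append, List.map_flatMap, List.flatMap_map, List.map_ofFn, List.map_ofFn]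
    simp only [List.map_append, hr]
    simp only [Qd.l1, hq0, hq, List.append_nil]; rfl
  refine ⟨q0, (List.finRange Δ).map q, by simp, ⟨?_, ?_, (hs (fun _ => 0)).1.2.2, (hs (fun _ => 1)).1.2.1⟩, ?_, hl, ?_⟩
  · have := (hmw 0 1).tight; simpa [Qd.l1, hq0] using this
  · exact three_tight (hmw 0 2) (hmw 2 1)
  · intro q' hq'
    rw [List.mem_map] at hq'
    obtain ⟨i, _, rfl⟩ := hq'
    exact ⟨three_tight (hm1 _ _ _ _ _) (hm1 _ _ _ _ _), three_tight (hm2 _ _ _ _) (hm3 _ _ _ _), (hFS _ _ _).2.2, (hFS _ _ _).2.1⟩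
  · rw [hl, ← Multiset.coe_eq_coe]
    simp only [← Multiset.coe_add]
    rw [coe_flat, coe_flat, coe_ofFn v]
    have h1 : (q0.l2 : Multiset V) = q0.l1 + ∑ i, {w 2 i} := by
      rw [← coe_ofFn]; simp only [Qd.l1, Qd.l2, hq0, List.append_nil, ← Multiset.coe_add]; abel
    have h2 : ∀ i, ((q i).l2 : Multiset V) + {w 2 i} = (q i).l1 + {v i} := by
      intro i
      have := coe_upd (update (f i 1) j2 (x (Sum.inl i) 2)) j2 (v i)
      rw [update_idem, update_self] at this
      simp only [Qd.l1, Qd.l2, hq, ← Multiset.coe_add]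
      calc _ = ((ofFn (update (f i 0) j2 (x (Sum.inl i) 3)) : List V) : Multiset V) + (((ofFn (update (f i 1) j2 (v i)) : List V) : Multiset V) + {x (Sum.inl i) 2}) + ((ofFn (update (f i 2) j2 (x (Sum.inl i) 4)) : List V) : Multiset V) := by
            simp only [hw]; abel
        _ = _ := by rw [this]; abel
    have h3 := Finset.sum_congr (rfl : (univ : Finset (Φ)) = univ) (fun i _ => h2 i)
    rw [sum_add_distrib, sum_add_distrib] at h3
    rw [h1, add_assoc, add_comm (∑ i, ({w 2 i} : Multiset V)), h3, add_assoc]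
def Abs (E : Г) (A : Finset V → Finset V) (ζ : ℝ) (v : Λ) (l : List V) : Prop :=
  ∃ q : Qd d V, Sw E A ζ q ∧ q.l1.Perm l ∧ q.l2.Perm (l ++ ofFn v)
def absR (d R : ℕ) : ℕ := Δ * (2 + 3*Δ) + R * Δ
noncomputable def absC (d : ℕ) (μ c1 : ℝ) : ℝ := ((1/9) * μ^Δ)^(6^(Δ + Δ*Δ)) * c1^Δ
lemma Good.absorber (hG : Good d μ δ L c E A) (hμ : 0 < μ) (hμ1 : μ ≤ 1/2) {ε : ℝ} (hε : 0 < ε) (hε1 : ε ≤ μ / (18 * Δ))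
    (hn : (d+2)^2 / (Ξ : ℝ) ≤ μ/9) {R : ℕ} {c1 : ℝ} (hc1 : 0 ≤ c1)
    (hconn : ∀ y0 x0 : Λ, RC E A Ц y0 → LC E A Ц x0 →
      c1 ≤ TH.dens R fun l => Tight Δ E (ofFn y0 ++ l ++ ofFn x0)) (v : Λ) :
    absC d μ c1 ≤ TH.dens (absR d R) (Abs E A Ц v) := by
  have h1 := dens_of_box _ 5 (absL d) (absL_nodup d) (absL_lt d) (Blk E A Ц v) (fun x hs => blk_of x hs) §
    (hG.absP hμ hμ1 hε hε1 hn v)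
  rw [absL_length] at h1
  simp only [Fintype.card_sum, Fintype.card_prod, Fintype.card_fin] at h1
  have h2 := dens_app (s := R * Δ) (b := c1^Δ) (Q := fun l cs => ∃ (q0 : Qd d V) (qs : List (Qd d V)), Sw E A Ц q0 ∧ (∀ q ∈ qs, Sw E A Ц q) ∧
    l = q0.l1 ++ qs.flatMap Qd.l1 ∧ (q0.l2 ++ qs.flatMap Qd.l2).Perm (l ++ ofFn v) ∧ Conns R E q0.y qs cs) § h1 (by
      rintro l _ ⟨q0, qs, hlen, h0, hqs, hl, hp⟩
      have := Conns_dens hc1 hconn qs q0.y h0.rc hqs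
      rw [hlen] at this
      exact this.trans (dens_mono fun cs _ hcs => ⟨q0, qs, h0, hqs, hl, hp, hcs⟩))
  refine h2.trans (dens_mono fun l _ hl => ?_)
  obtain ⟨_, q0, qs, h0, hqs, hl, hp, hcs⟩ := hl
  obtain ⟨q, hq, hq1, hq2⟩ := join_all qs q0 _ h0 hqs hcs
  refine ⟨q, hq, ?_, ?_⟩
  · rw [← hl, List.take_append_drop] at hq1; exact hq1
  · refine hq2.trans ?_
    refine (hp.append_right _).trans ?_
    conv_rhs => rw [← List.take_append_drop (Δ * (2 + 3*Δ)) l]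
    rw [← Multiset.coe_eq_coe]; simp only [← Multiset.coe_add]; abel
end
section
variable {V : Type} [Fintype V] [DecidableEq V] [Nonempty V]
lemma chernoff {Ω : Type} [Fintype Ω] [DecidableEq Ω] [Nonempty Ω] {P : Ω → Prop} [DecidablePred P] {c : ℝ}
    (hc : c ≤ Ex fun ω => ind (P ω)) (N m : ℕ) :
    (Ex fun τ : Fin N → Ω => ind ((univ.filter fun j => P (τ j)).card ≤ m)) ≤ 2^m * (1 - c/2)^N := by
  have h1 : ∀ τ : Fin N → Ω, ind ((univ.filter fun j => P (τ j)).card ≤ m) ≤ 2^m * ∏ j, (1 - ind (P (τ j)) / 2) := by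
    intro τ
    have e : ∏ j, (1 - ind (P (τ j)) / 2) = (1/2:ℝ)^(univ.filter fun j => P (τ j)).card := by
      rw [← Finset.prod_filter_mul_prod_filter_not univ (fun j => P (τ j)), Finset.prod_congr rfl (g := fun _ => (1/2:ℝ)),
        Finset.prod_congr (rfl : filter (fun j => ¬ P (τ j)) univ = _) (g := fun _ => (1:ℝ)), prod_const, prod_const_one, mul_one]
      · intro j hj; rw [mem_filter] at hj; rw [ind_false hj.2]; norm_num
      · intro j hj; rw [mem_filter] at hj; rw [ind_true hj.2]; norm_num
    rw [e]
    by_cases h : (univ.filter fun j => P (τ j)).card ≤ m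
    · rw [ind_true h, one_div, inv_pow, ← div_eq_mul_inv, one_le_div §]
      exact pow_le_pow_right₀ (by norm_num) h
    · rw [ind_false h]; positivity
  refine (Ex_mono h1).trans ?_
  rw [Ex_mul_left, Ex_pi_prod (fun (_ : Fin N) ω => 1 - ind (P ω) / 2)]
  rw [prod_const, card_univ, Fintype.card_fin]
  refine mll (pll ?_ ?_ _) §
  · exact Ex_nonneg fun ω => by have := ind_le_one (P ω); linarith
  · rw [Ex_sub, Ex_const]
    have : (Ex fun ω => ind (P ω) / 2) = (Ex fun ω => ind (P ω)) / 2 := by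
      simp only [div_eq_mul_inv]; rw [Ex_mul_right]
    rw [this]; linarith
lemma exp_small (D : ℕ) {a : ℝ} (ha : 0 < a) : ∃ n0 : ℕ, ∀ n : ℕ, n0 ≤ n → (n:ℝ)^D * Real.exp (-(a * n)) < 1/4 := by
  have h := (Real.tendsto_pow_mul_exp_neg_atTop_nhds_zero D)
  have h2 : Filter.Tendsto (fun n : ℕ => a * (n:ℝ)) Filter.atTop Filter.atTop :=
    Filter.Tendsto.const_mul_atTop ha tendsto_natCast_atTop_atTop
  have h3 := ((h.comp h2).const_mul ((a^D)⁻¹))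
  rw [mul_zero] at h3
  have h4 := h3.eventually (gt_mem_nhds (show ø < 1/4 by norm_num))
  obtain ⟨n0, h5⟩ := Filter.eventually_atTop.1 h4
  refine ⟨n0, fun n hn => ?_⟩
  have := h5 n hn
  simp only [Function.comp] at this
  rw [mul_pow, mul_assoc, ← mul_assoc, inv_mul_cancel₀ §, one_mul] at this
  exact this
def Bd {r N : ℕ} (τ : Fin N → Fin r → V) (j : Fin N) : Prop :=
  ¬ Injective (τ j) ∨ ∃ j', j' ≠ j ∧ ∃ a b, τ j a = τ j' b
lemma Bd_le {r N : ℕ} (j : Fin N) : (Ex fun τ : Fin N → Fin r → V => ind (Bd τ j)) ≤ (r:ℝ)^2 * (1 + N) / Ξ := by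
  have h1 : (Ex fun τ : Fin N → Fin r → V => ind (¬ Injective (τ j))) ≤ (r:ℝ)^2 / Ξ := by
    rw [Ex_coord j (fun x : Fin r → V => ind (¬ Injective x))]
    have := avoid (V := V) (ι := Fin r) ∅
    rw [Fintype.card_fin] at this; simp at this; simpa using this
  have h2 : ∀ j', j' ≠ j → (Ex fun τ : Fin N → Fin r → V => ind (∃ a b, τ j a = τ j' b)) ≤ (r:ℝ)^2 / Ξ := by
    intro j' hj
    rw [Ex_coord2 hj.symm (fun x y : Fin r → V => ind (∃ a b, x a = y b))]
    have : ∀ x : Fin r → V, (Ex fun y : Fin r → V => ind (∃ a b, x a = y b)) ≤ (r:ℝ)^2 / Ξ := by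
      intro x
      refine (Ex_mono (g := fun y : Fin r → V => ∑ a, ∑ b, ind (x a = y b)) fun y => ?_).trans ?_
      · have e := ind_exists_le univ (fun a => ∃ b, x a = y b)
        simp only [mem_univ, true_and] at e
        refine e.trans (sum_le_sum fun a _ => ?_)
        have e := ind_exists_le univ (fun b => x a = y b)
        simp only [mem_univ, true_and] at e
        exact e
      · rw [Ex_sum]
        have : ∀ a, (Ex fun y : Fin r → V => ∑ b, ind (x a = y b)) = r / Ξ := by
          intro a; rw [Ex_sum]
          simp only [fun b => Ex_coord b (fun v => ind (x a = v)), Ex_eq]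
          simp; ring
        simp only [this]; simp; apply le_of_eq; ring
    exact (Ex_mono this).trans (by rw [Ex_const])
  have h3 : ∀ τ : Fin N → Fin r → V, ind (Bd τ j) ≤ ind (¬ Injective (τ j)) + ∑ j' ∈ univ.filter (· ≠ j), ind (∃ a b, τ j a = τ j' b) := by
    intro τ
    refine (ind_or_le _ _).trans (add_le_add le_rfl ?_)
    have e := ind_exists_le (univ.filter (· ≠ j)) (fun j' => ∃ a b, τ j a = τ j' b)
    simpa only [mem_filter, mem_univ, true_and] using e
  refine (Ex_mono h3).trans ?_
  rw [Ex_add, Ex_sum]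
  have h4 : ∑ j' ∈ univ.filter (· ≠ j), (Ex fun τ : Fin N → Fin r → V => ind (∃ a b, τ j a = τ j' b)) ≤ N * ((r:ℝ)^2 / Ξ) := by
    refine (sum_le_sum fun j' hj' => h2 j' (mem_filter.1 hj').2).trans ?_
    rw [sum_const, nsmul_eq_mul]
    refine mlr ?_ §
    exact_mod_cast (card_filter_le _ _).trans £
  calc _ ≤ _ := add_le_add h1 h4
    _ = _ := by ring
lemma select (r D : ℕ) (hr : 0 < r) {c η : ℝ} (hc : 0 < c) (hc1 : c ≤ 1) (hη : 0 < η) (hη1 : η * (64 * r^2) ≤ c) :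
    ∃ n0 : ℕ, ∀ {V : Type} [Fintype V] [DecidableEq V] [Nonempty V], n0 ≤ Ξ →
      ∀ {ι : Type} [Fintype ι] (P : ι → (Fin r → V) → Prop), (Fintype.card ι : ℝ) ≤ (Ξ : ℝ)^D →
      (∀ i, c ≤ Ex fun τ => ind (P i τ)) →
      ∃ T : Finset (Fin r → V), (∀ τ ∈ T, Injective τ) ∧ (∀ τ ∈ T, ∀ τ' ∈ T, τ ≠ τ' → ∀ a b, τ a ≠ τ' b) ∧
        (T.card : ℝ) ≤ η * Ξ ∧ ∀ i, c * η / 16 * Ξ ≤ ((T.filter fun τ => ind (P i τ) = 1).card : ℝ) := by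
  classical
  obtain ⟨n1, h1⟩ := exp_small D (a := c*η/8) §
  obtain ⟨n2, h2⟩ := exists_nat_ge (2/η + 64*r^2/c)
  refine ⟨max n1 (max n2 1), fun {V} _ _ _ hn {ι} _ P hι hP => ?_⟩
  set n := Ξ with hnd
  have hn1 := h1 n (le_trans (le_max_left _ _) hn)
  have hn2 : 2/η + 64*r^2/c ≤ (n:ℝ) := h2.trans (by exact_mod_cast (le_trans (le_trans (le_max_left _ _) (le_max_right _ _)) hn))
  have hr1 : (1:ℝ) ≤ r := by exact_mod_cast hr
  have hn0 : ø < n := lt_of_lt_of_le § hn2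
  set N := ⌊η * n⌋₊ with hN
  have hNle : (N:ℝ) ≤ η * n := Nat.floor_le §
  have hηn : 2 ≤ η * n := by
    have : 2/η ≤ n := le_trans (by have : 0 ≤ 64*(r:ℝ)^2/c := by positivity
                                   linarith) hn2
    rw [dli hη] at this; linarith
  have hNge : η * n / 2 ≤ N := by
    have := Nat.lt_floor_add_one (η * n); rw [← hN] at this; linarith
  have hNpos : ø < N := by linarith
  have hb1 : (Ex fun τ : Fin N → Fin r → V => ind (c * N / 8 ≤ ∑ j, ind (Bd τ j))) ≤ 1/4 := by
    have hm := Ex_markov (f := fun τ : Fin N → Fin r → V => ∑ j, ind (Bd τ j)) (t := c * N / 8) (fun τ => sum_nonneg fun _ _ => ind_nonneg _)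
    have hs : (Ex fun τ : Fin N → Fin r → V => ∑ j, ind (Bd τ j)) ≤ N * (c/32) := by
      rw [Ex_sum]
      refine (sum_le_sum fun j _ => (Bd_le j).trans (?_ : _ ≤ c/32)).trans £
      rw [dli hn0]
      have e1 : 64*(r:ℝ)^2/c ≤ n := le_trans (by have : 0 ≤ 2/η := by positivity
                                                 linarith) hn2
      rw [dli hc] at e1
      have e2 : (r:ℝ)^2 * N ≤ r^2 * (η * n) := mll hNle §
      linarith [mlr hη1 hn0.le]
    have : 0 < c * N / 8 := by positivity
    have h4 : c * N / 8 * (Ex fun τ : Fin N → Fin r → V => ind (c * N / 8 ≤ ∑ j, ind (Bd τ j))) ≤ c * N / 8 * (1/4) := by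
      linarith
    exact le_of_mul_le_mul_left h4 this
  set m := ⌊c * N / 4⌋₊ with hm
  have hmle : (m:ℝ) ≤ c * N / 4 := Nat.floor_le §
  have hb2 : (Ex fun τ : Fin N → Fin r → V => ind (∃ i, (univ.filter fun j => ind (P i (τ j)) = 1).card ≤ m)) < 1/4 := by
    refine lt_of_le_of_lt ?_ hn1
    have e : ∀ τ : Fin N → Fin r → V, ind (∃ i, (univ.filter fun j => ind (P i (τ j)) = 1).card ≤ m) ≤
        ∑ i, ind ((univ.filter fun j => ind (P i (τ j)) = 1).card ≤ m) := by
      intro τ; have e := ind_exists_le univ (fun i => (univ.filter fun j => ind (P i (τ j)) = 1).card ≤ m)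
      simpa only [mem_univ, true_and] using e
    refine (Ex_mono e).trans ?_
    rw [Ex_sum]
    have e2 : ∀ i, (Ex fun τ : Fin N → Fin r → V => ind ((univ.filter fun j => ind (P i (τ j)) = 1).card ≤ m)) ≤ Real.exp (-(c*η/8*n)) := by
      intro i
      refine (chernoff (P := fun x => ind (P i x) = 1) (c := c) ?_ N m).trans ?_
      · refine (hP i).trans (Ex_mono fun x => ?_)
        by_cases h : P i x
        · rw [ind_true h, ind_true]; rfl
        · rw [ind_false h]; exact ind_nonneg _
      · calc (2:ℝ)^m * (1 - c/2)^N ≤ Real.exp 1 ^ m * Real.exp (-(c/2))^N := by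
              have : (2:ℝ) ≤ Real.exp 1 := by have := Real.add_one_le_exp (1:ℝ); linarith
              have h3 : 1 - c/2 ≤ Real.exp (-(c/2)) := by have := Real.add_one_le_exp (-(c/2)); linarith
              refine mul_le_mul (pll (by norm_num) this _) (pll ¶ h3 _) (pow_nonneg ¶ _) §
          _ = Real.exp (m + N * (-(c/2))) := by
              rw [← Real.exp_nat_mul, ← Real.exp_nat_mul, ← Real.exp_add, mul_one]
          _ ≤ _ := Real.exp_le_exp.2 (by nlinarith)
    refine (sum_le_sum fun i _ => e2 i).trans ?_
    rw [sum_const, nsmul_eq_mul, card_univ]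
    exact mlr hι §
  obtain ⟨τ, hτ⟩ : ∃ τ : Fin N → Fin r → V, ¬ ((c * N / 8 ≤ ∑ j, ind (Bd τ j)) ∨ ∃ i, (univ.filter fun j => ind (P i (τ j)) = 1).card ≤ m) := by
    apply Ex_ind_exists
    rw [Ex_ind_not]
    have := Ex_ind_or_le (fun τ : Fin N → Fin r → V => (c * N / 8 ≤ ∑ j, ind (Bd τ j))) (fun τ => ∃ i, (univ.filter fun j => ind (P i (τ j)) = 1).card ≤ m)
    linarith
  push Not at hτ
  obtain ⟨g1, g2⟩ := hτ
  set J := univ.filter fun j => ¬ Bd τ j with hJ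
  have hinj : ∀ j ∈ J, ∀ j' ∈ J, τ j = τ j' → j = j' := by
    intro j hj j' hj' h
    by_contra hne
    apply (mem_filter.1 hj).2
    exact Or.inr ⟨j', fun h => hne h.symm, ⟨0, hr⟩, ⟨0, hr⟩, by rw [h]⟩
  refine ⟨J.image τ, ?_, ?_, ?_, ?_⟩
  · intro t ht; rw [mem_image] at ht; obtain ⟨j, hj, rfl⟩ := ht
    by_contra h; exact (mem_filter.1 hj).2 (Or.inl h)
  · intro t ht t' ht' hne a b hab
    rw [mem_image] at ht ht'
    obtain ⟨j, hj, rfl⟩ := ht; obtain ⟨j', hj', rfl⟩ := ht'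
    exact (mem_filter.1 hj).2 (Or.inr ⟨j', fun h => hne (by rw [h]), a, b, hab⟩)
  · have : (J.image τ).card ≤ N := card_image_le.trans ((card_filter_le _ _).trans £)
    exact le_trans (by exact_mod_cast this) hNle
  · intro i
    have e1 : ((univ.filter fun j => ind (P i (τ j)) = 1) \ (univ.filter fun j => Bd τ j)).image τ ⊆ (J.image τ).filter fun t => ind (P i t) = 1 := by
      intro t ht; rw [mem_image] at ht; obtain ⟨j, hj, rfl⟩ := ht
      rw [mem_sdiff, mem_filter, mem_filter] at hj
      rw [mem_filter]
      refine ⟨mem_image_of_mem _ (mem_filter.2 ⟨mem_univ _, fun h => hj.2 ⟨mem_univ _, h⟩⟩), hj.1.2⟩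
    have e2 := card_le_card e1
    rw [card_image_of_injOn] at e2
    swap
    · intro j hj j' hj' h
      have : ∀ j, j ∈ ((univ.filter fun j => ind (P i (τ j)) = 1) \ (univ.filter fun j => Bd τ j)) → j ∈ J := by
        intro j hj; rw [mem_sdiff, mem_filter, mem_filter] at hj
        exact mem_filter.2 ⟨mem_univ _, fun h => hj.2 ⟨mem_univ _, h⟩⟩
      exact hinj j (this j hj) j' (this j' hj') h
    have e3 := le_card_sdiff (univ.filter fun j => Bd τ j) (univ.filter fun j => ind (P i (τ j)) = 1)
    have e4 : ((univ.filter fun j => Bd τ j).card : ℝ) = ∑ j, ind (Bd τ j) := by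
      rw [card_filter]; push_cast; exact sum_congr rfl fun j _ => by unfold ind; split_ifs <;> rfl
    have e5 := g2 i
    have e6 : c * N / 4 < (univ.filter fun j => ind (P i (τ j)) = 1).card := (Nat.floor_lt §).1 e5
    have e7 : ((univ.filter fun j => ind (P i (τ j)) = 1).card : ℝ) ≤ ((J.image τ).filter fun t => ind (P i t) = 1).card + (univ.filter fun j => Bd τ j).card := by
      exact_mod_cast (by omega : _ ≤ _)
    linarith [mll hNge hc.le]
end
section
lemma hall_def {I : Type} [Fintype I] [DecidableEq I] (R : I → I → Prop) [DecidableRel R] (A : Finset I) (M : ℕ) (hM : M ≤ A.card)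
    (h : ∀ X, X ⊆ A → X.card ≤ (X.biUnion fun p => univ.filter (R p)).card + (A.card - M)) :
    ∃ P : Finset (I × I), M ≤ P.card ∧ (∀ p ∈ P, R p.1 p.2) ∧ (∀ p ∈ P, ∀ q ∈ P, p.1 = q.1 → p = q) ∧ (∀ p ∈ P, ∀ q ∈ P, p.2 = q.2 → p = q) := by
  classical
  set D := A.card - M with hD
  let t : A → Finset (I ⊕ Fin D) := fun p => (univ.filter (R p.1)).disjSum univ
  obtain ⟨f, hf, hft⟩ := (Finset.all_card_le_biUnion_card_iff_exists_injective t).1 (by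
    intro s
    rcases s.eq_empty_or_nonempty with rfl | ⟨p0, hp0⟩
    · simp
    have h1 := h (s.map (Embedding.subtype _)) (by intro x hx; simp at hx; exact hx.1)
    rw [card_map] at h1
    refine h1.trans ?_
    have : ((s.map (Embedding.subtype _)).biUnion fun p => univ.filter (R p)).disjSum (univ : Finset (Fin D)) ⊆ s.biUnion t := by
      intro x hx
      rw [mem_biUnion]
      rcases x with x | x
      · rw [inl_mem_disjSum, mem_biUnion] at hx
        obtain ⟨p, hp, hx⟩ := hx
        rw [mem_map] at hp; obtain ⟨q, hq, rfl⟩ := hp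
        exact ⟨q, hq, inl_mem_disjSum.2 hx⟩
      · exact ⟨p0, hp0, inr_mem_disjSum.2 (mem_univ _)⟩
    have := card_le_card this
    rwa [card_disjSum, card_univ, Fintype.card_fin] at this)
  set Q := (univ : Finset A).filter fun p => (f p).isLeft with hQ
  have hQc : M ≤ Q.card := by
    have h1 : ((univ : Finset A).filter fun p => ¬ (f p).isLeft).card ≤ D := by
      have : (((univ : Finset A).filter fun p => ¬ (f p).isLeft).image f) ⊆ (univ : Finset (Fin D)).map Embedding.inr := by
        intro x hx; rw [mem_image] at hx; obtain ⟨p, hp, rfl⟩ := hx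
        rw [mem_filter] at hp
        rcases hfp : f p with y | y
        · rw [hfp] at hp; simp at hp
        · simp
      have := card_le_card this
      rw [card_image_of_injective _ hf] at this; simpa using this
    have h2 : Q.card + _ = (univ : Finset A).card := card_filter_add_card_filter_not (s := (univ : Finset A)) (fun p => (f p).isLeft = true)
    rw [card_univ, Fintype.card_coe] at h2
    omega
  have hleft : ∀ p ∈ Q, ∃ y, f p = Sum.inl y ∧ R p.1 y := by
    intro p hp
    rw [mem_filter] at hp
    obtain ⟨y, hy⟩ := Sum.isLeft_iff.1 hp.2
    have := hft p; rw [hy] at this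
    exact ⟨y, hy, (mem_filter.1 (inl_mem_disjSum.1 this)).2⟩
  choose g hg using hleft
  refine ⟨Q.attach.image fun p => (p.1.1, g p.1 p.2), ?_, ?_, ?_, ?_⟩
  · rw [card_image_of_injective, card_attach]; exact hQc
    intro p q h; simp only [Prod.mk.injEq] at h; exact Subtype.ext (Subtype.ext h.1)
  · intro p hp; rw [mem_image] at hp; obtain ⟨q, _, rfl⟩ := hp; exact (hg _ _).2
  · intro p hp q hq h; rw [mem_image] at hp hq
    obtain ⟨p, _, rfl⟩ := hp; obtain ⟨q, _, rfl⟩ := hq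
    have : p = q := Subtype.ext (Subtype.ext h)
    rw [this]
  · intro p hp q hq h; rw [mem_image] at hp hq
    obtain ⟨p, _, rfl⟩ := hp; obtain ⟨q, _, rfl⟩ := hq
    have : f p.1 = f q.1 := by rw [(hg p.1 p.2).1, (hg q.1 q.2).1]; exact congrArg _ h
    have : p = q := Subtype.ext (hf this)
    rw [this]
lemma num1 {a x y ν : ℝ} (hν : 0 < ν) (ha : 2/3 ≤ a) (ha1 : a ≤ 1) (hx : 0 ≤ x) (hxy : x ≤ y) (hy : y ≤ a) (hs : 2*a - 2/3 - ν ≤ x + y) :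
    2*a^2 - 2*a + 4/9 ≤ x*(2*y-x) + 3*ν + ν^2 := by
  have key : 2*a^2 - 2*a + 4/9 ≤ (x+ν)*(2*(y+ν)-(x+ν)) := by
    set X := x + ν with hX
    set Y := y + ν with hY
    have h1 : X ≤ Y := by linarith
    have h2 : 2*a - 2/3 ≤ X + Y := by linarith
    have h3 : a - 2/3 ≤ X := by linarith
    have h0 : 0 ≤ X := by linarith
    by_cases h : a - 1/3 ≤ X
    · nlinarith [mul_nonneg h0 (sub_nonneg.2 h1), mul_nonneg (sub_nonneg.2 ha1) (by linarith : 0 ≤ a - 1/3)]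
    · push Not at h
      have e1 : X * (2*(2*a-2/3) - 3*X) ≤ X*(2*Y-X) := mll ¶ h0
      have e2 : 2*a^2 - 2*a + 4/9 ≤ X * (2*(2*a-2/3) - 3*X) := by
        nlinarith [mul_nonneg (sub_nonneg.2 h3) (sub_nonneg.2 h.le), mul_nonneg (sub_nonneg.2 ha1) (sub_nonneg.2 ha),
          mul_nonneg (sub_nonneg.2 h3) (sub_nonneg.2 ha1), mul_nonneg (sub_nonneg.2 ha) (sub_nonneg.2 h.le), mul_nonneg (sub_nonneg.2 ha1) (sub_nonneg.2 h.le)]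
      linarith
  nlinarith
lemma num2 {a x y ν : ℝ} (hν : 0 < ν) (hν1 : ν ≤ 1) (ha : 2/3 ≤ a) (ha1 : a ≤ 1) (hx : 0 ≤ x) (hxy : x ≤ y) (hy : y ≤ a)
    (hs : 2*a - 2/3 - ν/8 ≤ x + y) (h : 5/9 + ν ≤ a^2 + x^2 - 2*x*y + (1-a)^2) : False := by
  have := num1 (ν := ν/8) § ha ha1 hx hxy hy hs
  have h2 : ν^2 ≤ ν := by nlinarith
  nlinarith
lemma matching {I : Type} [Fintype I] [DecidableEq I] [Nonempty I] (R : I → I → Prop) [DecidableRel R] (hR : ∀ p q, R p q → R q p) (A : Finset I)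
    (hA : ∀ p q, R p q → p ∈ A) {ν N a : ℝ} (hν : 0 < ν) (hν1 : ν ≤ 1) (hN : N = Fintype.card I) (haA : a = A.card) (ha : N/3 ≤ a)
    (he : (5/9 + ν) * N^2 ≤ ((univ : Finset (I × I)).filter fun p => R p.1 p.2).card + (N - a)^2) :
    ∃ P : Finset (I × I), (2/3 + ν/8) * N ≤ P.card ∧ (∀ p ∈ P, R p.1 p.2) ∧ (∀ p ∈ P, ∀ q ∈ P, p.1 = q.1 → p = q) ∧ (∀ p ∈ P, ∀ q ∈ P, p.2 = q.2 → p = q) := by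
  classical
  have hN0 : 0 < N := by rw [hN]; exact_mod_cast Fintype.card_pos
  have haN : a ≤ N := by rw [hN, haA]; exact_mod_cast card_le_univ A
  set M := ⌈(2/3 + ν/8) * N⌉₊ with hM
  have hM1 : (2/3 + ν/8) * N ≤ M := Nat.le_ceil _
  have hM2 : (M:ℝ) < (2/3 + ν/8) * N + 1 := Nat.ceil_lt_add_one §
  obtain ⟨al, hal⟩ := ex_ (a / N : ℝ)
  have haal : a = al * N := by rw [hal]; exact (div_mul_cancel₀ _ hN0.ne').symm
  have hal1 : al ≤ 1 := by rw [hal, div_le_one hN0]; exact haN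
  have hal3 : 1/3 ≤ al := by rw [hal, le_div_iff₀ hN0]; linarith
  obtain ⟨e, hedef⟩ := ex_ ((((univ : Finset (I × I)).filter fun p => R p.1 p.2).card : ℝ) : ℝ)
  rw [← hedef] at he
  have hsub : ((univ : Finset (I × I)).filter fun p => R p.1 p.2) ⊆ A ×ˢ A := by
    intro p hp; rw [mem_filter] at hp; rw [mem_product]; exact ⟨hA _ _ hp.2, hA _ _ (hR _ _ hp.2)⟩
  by_cases hMA : M ≤ A.card
  swap
  · exfalso
    have h1 : a < (2/3 + ν/8) * N := by
      rw [haA]; exact Nat.lt_ceil.1 (not_le.1 hMA)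
    have h2 : al < 2/3 + ν/8 := by rw [hal, div_lt_iff₀ hN0]; exact h1
    have h3 : e ≤ a^2 := by
      have := card_le_card hsub; rw [card_product] at this
      rw [hedef, haA, sq]; exact_mod_cast this
    have h4 : (5/9 + ν) * N^2 ≤ (al^2 + (1-al)^2) * N^2 := by rw [haal] at h3 he; linarith
    have h5 := le_of_mul_le_mul_right h4 §
    clear * - h5 h2 hal3 hν hν1
    nlinarith [mul_nonneg (sub_nonneg.2 hal3) (sub_nonneg.2 h2.le)]
  have hal2 : 2/3 + ν/8 ≤ al := by
    rw [hal, le_div_iff₀ hN0]; refine hM1.trans ?_; rw [haA]; exact_mod_cast hMA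
  obtain ⟨P, hP, hP2⟩ := hall_def R A M hMA (by
    intro X hX
    by_contra hcon
    push Not at hcon
    set NX := X.biUnion fun p => univ.filter (R p) with hNX
    have hNXA : NX ⊆ A := by
      intro q hq; rw [mem_biUnion] at hq; obtain ⟨p, _, hq⟩ := hq
      exact hA q p (hR _ _ (mem_filter.1 hq).2)
    set Y := A \ NX with hY
    have hYc : Y.card + NX.card = A.card := card_sdiff_add_card_eq_card hNXA
    have hYA : Y ⊆ A := sdiff_subset
    have hno : ∀ p ∈ X, ∀ q ∈ Y, ¬ R p q := by
      intro p hp q hq h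
      rw [hY, mem_sdiff] at hq
      exact hq.2 (mem_biUnion.2 ⟨p, hp, mem_filter.2 ⟨mem_univ _, h⟩⟩)
    have hdis : Disjoint ((univ : Finset (I × I)).filter fun p => R p.1 p.2) (X ×ˢ Y ∪ Y ×ˢ X) := by
      rw [Finset.disjoint_left]; intro p hp hq
      rw [mem_filter] at hp; rw [mem_union, mem_product, mem_product] at hq
      rcases hq with hq | hq
      · exact hno _ hq.1 _ hq.2 hp.2
      · exact hno _ hq.2 _ hq.1 (hR _ _ hp.2)
    have hun : ((univ : Finset (I × I)).filter fun p => R p.1 p.2) ∪ (X ×ˢ Y ∪ Y ×ˢ X) ⊆ A ×ˢ A :=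
      union_subset hsub (union_subset (product_subset_product hX hYA) (product_subset_product hYA hX))
    have hc1 := card_le_card hun
    rw [card_union_of_disjoint hdis] at hc1
    have hc2 := card_union_add_card_inter (X ×ˢ Y) (Y ×ˢ X)
    rw [product_inter_product, inter_comm Y X] at hc2
    simp only [card_product] at hc1 hc2
    have hz1 : (X ∩ Y).card ≤ X.card := card_le_card inter_subset_left
    have hz2 : (X ∩ Y).card ≤ Y.card := card_le_card inter_subset_right
    have hsum : 2 * A.card + 1 ≤ X.card + Y.card + M := by omega
    have hxA := card_le_card hX
    have hyA := card_le_card hYA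
    obtain ⟨x, hx⟩ := ex_ (X.card / N : ℝ)
    obtain ⟨y, hy⟩ := ex_ (Y.card / N : ℝ)
    have hx' : (X.card : ℝ) = x * N := by rw [hx]; exact (div_mul_cancel₀ _ hN0.ne').symm
    have hy' : (Y.card : ℝ) = y * N := by rw [hy]; exact (div_mul_cancel₀ _ hN0.ne').symm
    have hx0 : 0 ≤ x := by rw [hx]; exact div_nonneg (ncn _) hN0.le
    have hy0 : 0 ≤ y := by rw [hy]; exact div_nonneg (ncn _) hN0.le
    have hxa : x ≤ al := by rw [hx, hal, haA]; exact ddr (by exact_mod_cast hxA) hN0.le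
    have hya : y ≤ al := by rw [hy, hal, haA]; exact ddr (by exact_mod_cast hyA) hN0.le
    have hs : 2*al - 2/3 - ν/8 ≤ x + y := by
      have h1 : 2 * a + 1 ≤ x * N + y * N + M := by rw [haA, ← hx', ← hy']; exact_mod_cast hsum
      have : (2*al - 2/3 - ν/8) * N ≤ (x + y) * N := by rw [haal] at h1; linarith
      exact le_of_mul_le_mul_right this hN0
    have hz : ((X ∩ Y).card : ℝ)^2 ≤ (min x y * N)^2 := by
      apply pll (ncn _)
      rw [min_mul_of_nonneg _ _ hN0.le, ← hx', ← hy']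
      exact le_min (by exact_mod_cast hz1) (by exact_mod_cast hz2)
    have hee : e + 2 * (x * N * (y * N)) ≤ a^2 + (min x y * N)^2 := by
      have h1 : e + ((X ×ˢ Y ∪ Y ×ˢ X).card : ℝ) ≤ a * a := by rw [hedef, haA]; exact_mod_cast hc1
      have h2 : ((X ×ˢ Y ∪ Y ×ˢ X).card : ℝ) + (X ∩ Y).card * (X ∩ Y).card = X.card * Y.card + Y.card * X.card := by exact_mod_cast hc2
      rw [hx', hy'] at h2
      linarith
    have hfin : (5/9 + ν) * N^2 ≤ (al^2 + (min x y)^2 - 2*x*y + (1-al)^2) * N^2 := by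
      rw [haal] at hee he; linarith
    have hfin := le_of_mul_le_mul_right hfin (pow_pos hN0 2)
    rcases le_total x y with h | h
    · rw [min_eq_left h] at hfin
      exact num2 hν hν1 ¶ hal1 hx0 h hya hs hfin
    · rw [min_eq_right h] at hfin
      exact num2 hν hν1 ¶ hal1 hy0 h hxa ¶ ¶)
  exact ⟨P, hM1.trans (by exact_mod_cast hP), hP2⟩
end
section
variable {V : Type} [Fintype V] [DecidableEq V] [Nonempty V]
lemma ind_iff {P : Prop} : ind P = 1 ↔ P := by
  constructor
  · intro h; by_contra h'; rw [ind_false h'] at h; norm_num at h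
  · exact ind_true
lemma emb_le {T : Type} [Fintype T] [Nonempty T] (φ : T → V) (hφ : Injective φ) {θ : ℝ}
    (hθ : (1 - θ) * Ξ ≤ Fintype.card T) {f : V → ℝ} (h0 : ∀ v, 0 ≤ f v) (h1 : ∀ v, f v ≤ 1) :
    Ex f ≤ (Ex fun t => f (φ t)) + θ := by
  classical
  have hn : ø < Ξ := by exact_mod_cast Fintype.card_pos
  have ht : ø < Fintype.card T := by exact_mod_cast Fintype.card_pos
  have htn : (Fintype.card T : ℝ) ≤ Ξ := by exact_mod_cast Fintype.card_le_of_injective φ hφ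
  unfold Ex
  have e1 : ∑ t, f (φ t) = ∑ v ∈ univ.image φ, f v := by rw [sum_image fun _ _ _ _ h => hφ h]
  have e2 : ∑ v, f v ≤ ∑ v ∈ univ.image φ, f v + θ * Ξ := by
    rw [← sum_sdiff (subset_univ (univ.image φ)), add_comm]
    refine add_le_add le_rfl ((sum_le_sum fun v _ => h1 v).trans ?_)
    rw [sum_const, nsmul_eq_mul, mul_one]
    have : ((univ \ univ.image φ).card : ℝ) + Fintype.card T = Ξ := by
      have := card_sdiff_add_card_eq_card (subset_univ (univ.image φ))
      rw [card_image_of_injective _ hφ, card_univ, card_univ] at this; exact_mod_cast this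
    linarith
  rw [← e1] at e2
  rw [dli hn]
  have h3 : 0 ≤ ∑ t, f (φ t) := sum_nonneg fun _ _ => h0 _
  have h4 : ∑ t, f (φ t) ≤ (∑ t, f (φ t)) / Fintype.card T * Ξ := by
    rw [div_mul_eq_mul_div, le_div_iff₀ ht]; exact mll htn h3
  linarith
lemma emb_ge {T : Type} [Fintype T] [Nonempty T] (φ : T → V) (hφ : Injective φ) {θ : ℝ}
    (hθ : (1 - θ) * Ξ ≤ Fintype.card T) {f : V → ℝ} (h0 : ∀ v, 0 ≤ f v) (h1 : ∀ v, f v ≤ 1) :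
    (Ex fun t => f (φ t)) ≤ Ex f + θ := by
  have := emb_le φ hφ hθ (f := fun v => 1 - f v) (fun v => by linarith [h1 v]) (fun v => by linarith [h0 v])
  rw [Ex_sub, Ex_sub, Ex_const, Ex_const] at this; linarith
variable {J : Type} [Fintype J] [DecidableEq J] [Nonempty J] {k b m : ℕ} [NeZero k] [NeZero b] [NeZero m]
lemma sum_fin_Ex (F : Fin k → ℝ) : ∑ p, F p = k * Ex F := by
  have hk : (k:ℝ) ≠ 0 := Nat.cast_ne_zero.2 (NeZero.ne k)
  unfold Ex; rw [Fintype.card_fin, mul_div_assoc', mul_div_cancel_left₀ _ hk]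
lemma samp1 (φ : J → Fin k → Fin b → V) (f : V → ℝ) :
    (Ex fun j : Fin m → J => Ex fun i : Fin m × Fin k → Fin b => ∑ u, f (Ю u)) =
      m * k * Ex fun t : J × Fin k × Fin b => f (Я) := by
  have h1 : ∀ u : Fin m × Fin k, (Ex fun j : Fin m → J => Ex fun i : Fin m × Fin k → Fin b => f (Ю u)) =
      Ex fun j : J => Ex fun i : Fin b => f (φ j u.2 i) := by
    intro u
    have : ∀ j : Fin m → J, (Ex fun i : Fin m × Fin k → Fin b => f (Ю u)) = Ex fun i : Fin b => f (φ (j u.1) u.2 i) :=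
      fun j => Ex_coord u (fun i => f (φ (j u.1) u.2 i))
    simp only [this]
    exact Ex_coord u.1 (fun j => Ex fun i : Fin b => f (φ j u.2 i))
  simp only [Ex_sum, h1]
  rw [Fintype.sum_prod_type]
  simp only [sum_const, card_univ, Fintype.card_fin, nsmul_eq_mul]
  rw [sum_fin_Ex, Ex_prod, mul_assoc, Ex_comm]
  simp only [Ex_prod]
lemma samp2 (φ : J → Fin k → Fin b → V) (f : V → V → ℝ) :
    (Ex fun j : Fin m → J => Ex fun i : Fin m × Fin k → Fin b => ∑ u, ∑ u', ind (u.1 ≠ u'.1) * f (Ю u) (Ю u')) =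
      m * (m - 1) * k^2 * Ex fun t : J × Fin k × Fin b => Ex fun t' : J × Fin k × Fin b => f (Я) (φ t'.1 t'.2.1 t'.2.2) := by
  set G : Fin k → Fin k → ℝ := fun p p' => Ex fun j : J => Ex fun j' : J => Ex fun i : Fin b => Ex fun i' : Fin b => f (φ j p i) (φ j' p' i') with hG
  have h1 : ∀ u u' : Fin m × Fin k, (Ex fun j : Fin m → J => Ex fun i : Fin m × Fin k → Fin b => ind (u.1 ≠ u'.1) * f (Ю u) (Ю u')) =
      ind (u.1 ≠ u'.1) * G u.2 u'.2 := by
    intro u u'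
    simp only [Ex_mul_left]
    by_cases huu : u.1 = u'.1
    · rw [ind_false (not_not.2 huu)]; simp
    have hne : u ≠ u' := fun h => huu (by rw [h])
    congr 1
    have : ∀ j : Fin m → J, (Ex fun i : Fin m × Fin k → Fin b => f (Ю u) (Ю u')) =
        Ex fun i : Fin b => Ex fun i' : Fin b => f (φ (j u.1) u.2 i) (φ (j u'.1) u'.2 i') :=
      fun j => Ex_coord2 hne (fun i i' => f (φ (j u.1) u.2 i) (φ (j u'.1) u'.2 i'))
    simp only [this]
    exact Ex_coord2 huu (fun j j' => Ex fun i : Fin b => Ex fun i' : Fin b => f (φ j u.2 i) (φ j' u'.2 i'))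
  simp only [Ex_sum, h1]
  rw [Fintype.sum_prod_type]
  simp only [Fintype.sum_prod_type]
  have h2 : ∀ a : Fin m, ∑ p, ∑ a' : Fin m, ∑ p', ind (a ≠ a') * G p p' = (m-1) * ∑ p, ∑ p', G p p' := by
    intro a
    have e : ∀ p, ∑ a' : Fin m, ∑ p', ind (a ≠ a') * G p p' = (m-1) * ∑ p', G p p' := by
      intro p
      simp only [← mul_sum]
      rw [← sum_mul]; congr 1
      have : ∀ a' : Fin m, ind (a ≠ a') = 1 - ind (a = a') := fun a' => ind_not _
      have e1 : ∑ a' : Fin m, ind (a = a') = 1 := by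
        rw [Finset.sum_eq_single a (fun b _ hb => ind_false hb.symm) (fun h => absurd (mem_univ _) h), ind_true rfl]
      simp only [this, sum_sub_distrib]
      rw [e1]; simp
    rw [Finset.sum_congr rfl fun p _ => e p, ← mul_sum]
  rw [Finset.sum_congr rfl fun a _ => h2 a]
  simp only [sum_const, card_univ, Fintype.card_fin, nsmul_eq_mul, sum_fin_Ex, Ex_mul_left]
  have h3 : (Ex fun p => Ex fun p' => G p p') = Ex fun t : J × Fin k × Fin b => Ex fun t' : J × Fin k × Fin b => f (Я) (φ t'.1 t'.2.1 t'.2.2) := by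
    simp only [Ex_prod, hG]
    rw [Ex_comm (Ω := J)]
    refine Ex_congr fun p => ?_
    calc _ = Ex fun j : J => Ex fun p' => Ex fun j' : J => Ex fun i : Fin b => Ex fun i' : Fin b => f (φ j p i) (φ j' p' i') := Ex_comm _
      _ = _ := Ex_congr fun j => ?_
    calc _ = Ex fun p' => Ex fun i : Fin b => Ex fun j' : J => Ex fun i' : Fin b => f (φ j p i) (φ j' p' i') := Ex_congr fun p' => Ex_comm _
      _ = Ex fun i : Fin b => Ex fun p' => Ex fun j' : J => Ex fun i' : Fin b => f (φ j p i) (φ j' p' i') := Ex_comm _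
      _ = _ := Ex_congr fun i => Ex_comm _
  rw [← h3]; ring
lemma num3 {al a e N ν : ℝ} (hN : 0 < N) (hal : 2/3 ≤ al) (hal1 : al ≤ 1) (hν : 0 < ν) (ha0 : 0 ≤ a) (haN : a ≤ N) (he : e ≤ a^2)
    (h : (5/9 + ν) * N^2 ≤ e + N^2*(1-al)^2 + 2*(1-al)*N*(al*N - a)) : N/3 ≤ a ∧ (5/9 + ν) * N^2 ≤ e + (N - a)^2 := by
  constructor
  · by_contra hc
    push Not at hc
    have h1 : (5/9 + ν) * N^2 ≤ a^2 + N^2*(1-al)^2 + 2*(1-al)*N*(al*N - a) := by linarith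
    have h2 : 0 < ν * N^2 := by positivity
    have h3 : 0 ≤ (al - 1/3)^2 * N^2 := by positivity
    have h4 : 0 ≤ a * (N/3 - a) := mul_nonneg ha0 ¶
    have h5 : 0 ≤ (al - 2/3) * (N * (N/3 - a)) := mul_nonneg ¶ (mul_nonneg hN.le ¶)
    have h6 : 0 ≤ (al - 2/3) * N^2 := mul_nonneg ¶ §
    have h7 : 0 ≤ (al - 2/3) * (1 - al) * N^2 := mul_nonneg (mul_nonneg ¶ ¶) §
    have h8 : 0 ≤ (1-al) * (N * a) := mul_nonneg ¶ §
    nlinarith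
  · nlinarith [sq_nonneg ((N - a) - (1-al)*N)]
def Mt (μ : ℝ) (m k : ℕ) (P : Finset ((Fin m × Fin k) × (Fin m × Fin k))) : Prop :=
  (2/3 + μ/16) * (m * k) ≤ P.card ∧ (∀ p ∈ P, ∀ q ∈ P, p.1 = q.1 → p = q) ∧ (∀ p ∈ P, ∀ q ∈ P, p.2 = q.2 → p = q)
lemma samp_graph (φ : J → Fin k → Fin b → V) (hφ : Injective fun t : J × Fin k × Fin b => Я) {θ : ℝ} (hθ0 : 0 ≤ θ)
    (hθ : (1 - θ) * Ξ ≤ Fintype.card J * k * b) (A X' : Finset V) (hA : 2/3 ≤ ms A) (R : V → V → Prop)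
    (hR : ∀ p q, R p q → R q p) (hRA : ∀ p q, R p q → p ∈ A) {μ β : ℝ} (hμ : 0 < μ) (hμ1 : μ ≤ 1) 
    (he : 5/9 + μ - (1 - ms A)^2 - β ≤ Ex fun p => Ex fun q => ind (R p q)) (hm : 4*θ + 1/m ≤ μ/8)
    (hX : m * k * (ms X' + θ) + m^2 / Fintype.card J ≤ μ/32) :
    μ/16 - β/4 ≤ Ex fun j : Fin m → J => Ex fun i : Fin m × Fin k → Fin b =>
      ind (Injective j ∧ (∀ u, Ю u ∉ X') ∧ ∃ P, Mt μ m k P ∧ ∀ p ∈ P, R (Ю p.1) (Ю p.2)) := by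
  classical
  set al := ms A with hal
  have hal1 : al ≤ 1 := ms_le_one _
  have hm0 : ø < m := by exact_mod_cast Nat.pos_of_ne_zero (NeZero.ne m)
  have hk0 : ø < k := by exact_mod_cast Nat.pos_of_ne_zero (NeZero.ne k)
  obtain ⟨N, hN⟩ := ex_ (m * k : ℝ)
  have hN0 : 0 < N := by rw [hN]; positivity
  set y : (Fin m → J) → (Fin m × Fin k → Fin b) → Fin m × Fin k → V := fun j i u => Ю u with hy
  set eF : (Fin m → J) → (Fin m × Fin k → Fin b) → ℝ := fun j i => ∑ u, ∑ u', ind (u.1 ≠ u'.1) * ind (R (y j i u) (y j i u')) with heF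
  set aF : (Fin m → J) → (Fin m × Fin k → Fin b) → ℝ := fun j i => ∑ u, ind (y j i u ∈ A) with haF
  set T : (Fin m → J) → (Fin m × Fin k → Fin b) → ℝ := fun j i => eF j i + (N^2*(1-al)^2 + 2*(1-al)*N*(al*N)) - 2*(1-al)*N * aF j i with hT
  have hcT : (1 - θ) * Ξ ≤ Fintype.card (J × Fin k × Fin b) := by
    simp only [Fintype.card_prod, Fintype.card_fin]; push_cast; linarith
  have E1 : (Ex fun j => Ex fun i => aF j i) ≤ N * (al + θ) := by
    simp only [haF, hy]
    rw [samp1 φ (fun v => ind (v ∈ A)), ← hN]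
    exact mll (emb_ge _ hφ hcT (f := fun v => ind (v ∈ A)) (fun _ => ind_nonneg _) (fun _ => ind_le_one _)) hN0.le
  have E2 : N^2 * (5/9 + μ - (1 - al)^2 - β - 2*θ - 1/m) ≤ Ex fun j => Ex fun i => eF j i := by
    simp only [heF, hy]
    rw [samp2 φ (fun v v' => ind (R v v'))]
    set x := Ex fun t : J × Fin k × Fin b => Ex fun t' : J × Fin k × Fin b => ind (R (Я) (φ t'.1 t'.2.1 t'.2.2)) with hx
    have hx1 : x ≤ 1 := Ex_le_one fun _ => Ex_ind_le_one _
    have h1 : (Ex fun p => Ex fun q => ind (R p q)) ≤ x + 2*θ := by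
      have h2 := emb_le _ hφ hcT (f := fun v => Ex fun q => ind (R v q)) (fun _ => Ex_ind_nonneg _) (fun _ => Ex_ind_le_one _)
      have h3 : ∀ v, (Ex fun q => ind (R v q)) ≤ (Ex fun t' : J × Fin k × Fin b => ind (R v (φ t'.1 t'.2.1 t'.2.2))) + θ := fun v =>
        emb_le _ hφ hcT (f := fun q => ind (R v q)) (fun _ => ind_nonneg _) (fun _ => ind_le_one _)
      have h4 := Ex_mono (fun t : J × Fin k × Fin b => h3 (Я))
      rw [Ex_add, Ex_const] at h4
      linarith
    have h5 : (m:ℝ) * (m-1) * k^2 = N^2 * (1 - 1/m) := by rw [hN]; field_simp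
    rw [h5, mul_assoc]
    refine mll ?_ §
    have h6 : 1/(m:ℝ) * x ≤ 1/m := mul_le_of_le_one_right § hx1
    linarith
  have E3 : N^2 * (5/9 + 7*μ/8 - β) ≤ Ex fun j => Ex fun i => T j i := by
    have e : (Ex fun j => Ex fun i => T j i) = (Ex fun j => Ex fun i => eF j i) + (N^2*(1-al)^2 + 2*(1-al)*N*(al*N)) - 2*(1-al)*N * Ex fun j => Ex fun i => aF j i := by
      simp only [hT, Ex_sub, Ex_add, Ex_const, Ex_mul_left]
    rw [e]
    have h1 : 2*(1-al)*N * (Ex fun j => Ex fun i => aF j i) ≤ 2*(1-al)*N * (N * (al + θ)) :=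
      mll E1 (by
        have : 0 ≤ 1 - al := by linarith
        positivity)
    have h2 : N^2 * (4*θ + 1/m) ≤ N^2 * (μ/8) := mll hm §
    have h3 : 0 ≤ N^2 * θ * al := by have : 0 ≤ al := by linarith
                                     positivity
    linarith
  have ha0 : ∀ j i, 0 ≤ aF j i := fun j i => sum_nonneg fun _ _ => ind_nonneg _
  have hcI : (Fintype.card (Fin m × Fin k) : ℝ) = N := by rw [Fintype.card_prod, Fintype.card_fin, Fintype.card_fin, hN]; push_cast; rfl
  have haN : ∀ j i, aF j i ≤ N := fun j i => by
    refine (sum_le_sum fun _ _ => ind_le_one _).trans ?_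
    rw [sum_const, card_univ, nsmul_eq_mul, mul_one, hcI]
  have hea : ∀ j i, eF j i ≤ aF j i ^ 2 := fun j i => by
    simp only [heF, haF]
    rw [sq, sum_mul_sum]
    refine sum_le_sum fun u _ => sum_le_sum fun u' _ => ?_
    refine (mul_le_of_le_one_left И (ind_le_one _)).trans ?_
    rw [← ind_and]; exact ind_mono fun h => ⟨hRA _ _ h, hRA _ _ (hR _ _ h)⟩
  have hT4 : ∀ j i, T j i ≤ 4 * N^2 := fun j i => by
    have h1 := hea j i
    have h2 : aF j i ^ 2 ≤ N^2 := pll (ha0 j i) (haN j i) 2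
    have h3 : 0 ≤ 2*(1-al)*N * aF j i := by have := ha0 j i; have : 0 ≤ 1 - al := by linarith
                                            positivity
    have h4 : (1-al)^2 + 2*(1-al)*al ≤ 1 := by linarith [sq_nonneg al]
    have h5 := mll h4 (sq_nonneg N)
    simp only [hT]; linarith [sq_nonneg N]
  have key : ∀ j i, (5/9 + μ/2) * N^2 ≤ T j i → ∃ P, Mt μ m k P ∧ ∀ p ∈ P, R (Ю p.1) (Ю p.2) := by
    intro j i h
    obtain ⟨g1, g2⟩ := num3 hN0 hA hal1 (show 0 < μ/2 by positivity) (ha0 j i) (haN j i) (hea j i) (by simp only [hT] at h; linarith)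
    have hc1 : (((univ : Finset ((Fin m × Fin k) × (Fin m × Fin k))).filter fun p => p.1.1 ≠ p.2.1 ∧ R (y j i p.1) (y j i p.2)).card : ℝ) = eF j i := by
      rw [card_filter]; push_cast
      rw [Fintype.sum_prod_type]
      refine sum_congr rfl fun u _ => sum_congr rfl fun u' _ => ?_
      rw [← ind_and]; unfold ind; split_ifs <;> rfl
    have hc2 : ((univ.filter fun u => y j i u ∈ A).card : ℝ) = aF j i := by
      rw [card_filter]; push_cast
      refine sum_congr rfl fun u _ => ?_
      unfold ind; split_ifs <;> rfl
    obtain ⟨P, h1, h2, h3, h4⟩ := matching (I := Fin m × Fin k) (fun u u' => u.1 ≠ u'.1 ∧ R (y j i u) (y j i u')) (fun p q h => ⟨h.1.symm, hR _ _ h.2⟩)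
      (univ.filter fun u => y j i u ∈ A) (fun p q h => mem_filter.2 ⟨mem_univ _, hRA _ _ h.2⟩) (ν := μ/2) § ¶ hcI.symm hc2.symm g1
      (by rw [hc1]; exact g2)
    exact ⟨P, ⟨by rw [← hN]; linarith, h3, h4⟩, fun p hp => (h2 p hp).2⟩
  have P1 : 3*μ/32 - β/4 ≤ Ex fun j => Ex fun i => ind ((5/9 + μ/2) * N^2 ≤ T j i) := by
    have h1 : ∀ j i, T j i ≤ (5/9 + μ/2) * N^2 + 4 * N^2 * ind ((5/9 + μ/2) * N^2 ≤ T j i) := by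
      intro j i
      by_cases h : (5/9 + μ/2) * N^2 ≤ T j i
      · rw [ind_true h]; have := hT4 j i; have : 0 ≤ (5/9 + μ/2) * N^2 := by positivity
        linarith
      · rw [ind_false h]; linarith
    have h2 := Ex_mono fun j => Ex_mono fun i => h1 j i
    simp only [Ex_add, Ex_const, Ex_mul_left] at h2
    have h3 : N^2 * (3*μ/32 - β/4) ≤ N^2 * Ex fun j => Ex fun i => ind ((5/9 + μ/2) * N^2 ≤ T j i) := by linarith
    exact le_of_mul_le_mul_left h3 §
  have P2 : (Ex fun j : Fin m → J => Ex fun i : Fin m × Fin k → Fin b => ind (¬ Injective j)) ≤ m^2 / Fintype.card J := by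
    simp only [Ex_const]
    exact Ex_ninj m
  have P3 : (Ex fun j => Ex fun i => ind (∃ u, y j i u ∈ X')) ≤ m * k * (ms X' + θ) := by
    have h1 : ∀ j i, ind (∃ u, y j i u ∈ X') ≤ ∑ u, ind (y j i u ∈ X') := by
      intro j i; have e := ind_exists_le univ (fun u => y j i u ∈ X')
      simpa only [mem_univ, true_and] using e
    refine (Ex_mono fun j => Ex_mono fun i => h1 j i).trans ?_
    simp only [hy]
    rw [samp1 φ (fun v => ind (v ∈ X'))]
    exact mll (emb_ge _ hφ hcT (f := fun v => ind (v ∈ X')) (fun _ => ind_nonneg _) (fun _ => ind_le_one _)) §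
  have P4 : ∀ j i, ind ((5/9 + μ/2) * N^2 ≤ T j i) ≤ ind (Injective j ∧ (∀ u, Ю u ∉ X') ∧ ∃ P, Mt μ m k P ∧ ∀ p ∈ P, R (Ю p.1) (Ю p.2))
      + (ind (¬ Injective j) + ind (∃ u, y j i u ∈ X')) := by
    intro j i
    refine (ind_le_add _ (Injective j ∧ ¬ ∃ u, y j i u ∈ X')).trans (add_le_add (ind_mono ?_) ?_)
    · rintro ⟨h1, h2, h3⟩; exact ⟨h2, fun u hu => h3 ⟨u, hu⟩, key j i h1⟩
    · exact (ind_mono (fun h => by tauto)).trans (ind_or_le _ _)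
  have P5 := Ex_mono fun j => Ex_mono fun i => P4 j i
  simp only [Ex_add] at P5
  linarith
end
section
variable {V : Type} [Fintype V] [DecidableEq V] [Nonempty V]
variable {d : ℕ} {μ δ : ℝ} {L : ℕ} {c : ℝ} {E : Г} {A : Finset V → Finset V}
variable {J : Type} [Fintype J] [DecidableEq J] [Nonempty J] {b m : ℕ} [NeZero b] [NeZero m]
def PT (d m : ℕ) : ℕ := Fintype.card (Finset (Щ × Щ))
lemma PT_pos (d m : ℕ) : 0 < PT d m := Fintype.card_pos
lemma Good.unit_prob (hG : Good d μ δ L c E A) (hμ : 0 < μ) (hμ1 : μ ≤ 1) {ε : ℝ} (hε : 0 < ε)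
    (φ : J → Φ → Fin b → V) (hφ : Injective fun t : J × Φ × Fin b => Я) {θ : ℝ} (hθ0 : 0 ≤ θ)
    (hθ : (1 - θ) * Ξ ≤ Fintype.card J * Θ * b) (U0 X' : Finset V) {γ : ℝ} (hγ0 : 0 < γ)
    (hγ : γ ≤ (ms U0)^Ы - (d+1:ℕ)^2 / Ξ) (hεγ : ε ≤ μ*γ/16) (hm : 4*θ + 1/m ≤ μ/8)
    (hX : m * Θ * (ms X' + θ) + m^2 / Fintype.card J ≤ μ/32) :
    ∃ (j : Fin m → J) (P : Finset (Щ × Щ)), Injective j ∧ Mt μ m Δ P ∧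
      μ*γ/32/PT d m ≤ Ex fun s : Ψ → V => Ex fun i : Fin m × Φ → Fin b =>
        ind ((∀ r, s r ∈ U0) ∧ (∀ u, Ю u ∉ X') ∧ ∀ p ∈ P, FS E A Ц (mkr (Ю p.1) (Ю p.2) s)) := by
  classical
  set Rs : (Ψ → V) → V → V → Prop := fun s p q => FS E A Ц Й ∧ FS E A Ц (mkr q p s) with hRs
  set β : (Ψ → V) → ℝ := fun s => Ex fun p => Ex fun q => ind (KK E A (univ.image s) p q ∧ ¬ Rs s p q) with hβ
  set w : (Ψ → V) → Prop := fun s => Injective s ∧ ∀ r, s r ∈ U0 with hw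
  set Q : (Ψ → V) → (Fin m → J) → (Fin m × Φ → Fin b) → Finset (Щ × Щ) → Prop :=
    fun s j i P => ∀ p ∈ P, Rs s (Ю p.1) (Ю p.2) with hQ
  set G : (Ψ → V) → (Fin m → J) → (Fin m × Φ → Fin b) → Prop := fun s j i =>
    Injective j ∧ (∀ u, Ю u ∉ X') ∧ ∃ P, Mt μ m Δ P ∧ Q s j i P with hGd
  have hβ2 : Ex β ≤ 2*ε := by
    have h1 := FS_most (d := d) hε E A
    rw [Ex_mkr'] at h1
    have h2 : ∀ s p q, ind (KK E A (univ.image s) p q ∧ ¬ Rs s p q) ≤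
        ind (FF E A Й ∧ ¬ FS E A Ц Й) + ind (FF E A (mkr q p s) ∧ ¬ FS E A Ц (mkr q p s)) := by
      intro s p q
      refine (ind_mono ?_).trans (ind_or_le _ _)
      rintro ⟨ha, hb⟩
      by_cases h : FS E A Ц Й
      · exact Or.inr ⟨KK_symm ha, fun h' => hb ⟨h, h'⟩⟩
      · exact Or.inl ⟨ha, h⟩
    have h3 := Ex_mono fun s => Ex_mono fun p => Ex_mono fun q => h2 s p q
    simp only [Ex_add] at h3
    have h4 : ∀ s : Ψ → V, (Ex fun p => Ex fun q => ind (FF E A (mkr q p s) ∧ ¬ FS E A Ц (mkr q p s))) = Ex fun p => Ex fun q => ind (FF E A Й ∧ ¬ FS E A Ц Й) :=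
      fun s => Ex_comm _
    rw [Ex_congr h4] at h3
    have h5 : (Ex fun s : Ψ → V => Ex fun p => Ex fun q => ind (FF E A Й ∧ ¬ FS E A Ц Й)) ≤ ε := h1
    linarith
  have hs : ∀ s, w s → μ/16 - β s/4 ≤ Ex fun j => Ex fun i => ind (G s j i) := by
    intro s hws
    have hc : (univ.image s).card = d+1 := by rw [card_image_of_injective _ hws.1, card_univ, Fintype.card_fin]
    refine samp_graph φ hφ hθ0 hθ (A (univ.image s)) X' (hG.big _ hc) (Rs s) (fun p q h => ⟨h.2, h.1⟩) (fun p q h => h.1.1.1) hμ hμ1 ?_ hm hX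
    have h1 := hG.edges _ hc
    have h2 : (Ex fun p => Ex fun q => ind (KK E A (univ.image s) p q)) ≤ (Ex fun p => Ex fun q => ind (Rs s p q)) + β s := by
      simp only [hβ, ← Ex_add]
      refine Ex_mono fun p => Ex_mono fun q => (ind_mono (fun h => ?_)).trans (ind_or_le _ _)
      by_cases h' : Rs s p q
      · exact Or.inl h'
      · exact Or.inr ⟨h, h'⟩
    linarith
  have hw1 : γ ≤ Ex fun s => ind (w s) := by
    have h1 := Ex_ind_le_add (fun s : Ψ → V => ∀ r, s r ∈ U0) (fun s => Injective s)
    have h2 := Ex_ninj (V := V) Ы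
    have h3 : (Ex fun s : Ψ → V => ind (∀ r, s r ∈ U0)) = (ms U0)^Ы := by
      rw [Ex_congr fun s => ind_forall _, Ex_pi_prod (fun _ v => ind (v ∈ U0))]
      simp [ms]
    have h4 := Ex_ind_mono (P := fun s : Ψ → V => (∀ r, s r ∈ U0) ∧ Injective s) (Q := w) (fun s h => ⟨h.2, h.1⟩)
    linarith
  have hβ0 : ∀ s, 0 ≤ β s := fun s => Ex_nonneg fun _ => Ex_ind_nonneg _
  have h1 : μ*γ/32 ≤ Ex fun s => Ex fun j => Ex fun i => ind (w s ∧ G s j i) := by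
    have h2 : ∀ s, μ/16 * ind (w s) - 1/4 * β s ≤ Ex fun j => Ex fun i => ind (w s ∧ G s j i) := by
      intro s
      by_cases h : w s
      · have := hs s h
        simp only [ind_and, ind_true h, one_mul, mul_one]; linarith
      · simp only [ind_false h, mul_zero, zero_sub]
        exact (by linarith [hβ0 s] : - (1/4 * β s) ≤ 0).trans (Ex_nonneg fun _ => Ex_ind_nonneg _)
    have h3 := Ex_mono h2
    rw [Ex_sub, Ex_mul_left, Ex_mul_left] at h3
    have : μ * γ ≤ μ * Ex fun s => ind (w s) := mll hw1 hμ.le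
    linarith
  rw [Ex_comm] at h1
  obtain ⟨j, hj⟩ := Ex_exists_ge (fun j => Ex fun s => Ex fun i => ind (w s ∧ G s j i))
  have h5 := h1.trans hj
  set H : Finset (Щ × Щ) → ℝ := fun P => Ex fun s => Ex fun i => ind ((w s ∧ Injective j ∧ ∀ u, Ю u ∉ X') ∧ Mt μ m Δ P ∧ Q s j i P) with hH
  have h6 : μ*γ/32 ≤ ∑ P, H P := by
    refine h5.trans ?_
    simp only [hH, ← Ex_sum]
    refine Ex_mono fun s => Ex_mono fun i => ?_
    have := ind_exists_le univ (fun P => (w s ∧ Injective j ∧ ∀ u, Ю u ∉ X') ∧ Mt μ m Δ P ∧ Q s j i P)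
    refine (ind_mono ?_).trans this
    rintro ⟨a, b, c, P, e⟩
    exact ⟨P, mem_univ _, ⟨a, b, c⟩, e⟩
  obtain ⟨P, hP⟩ : ∃ P, μ*γ/32/PT d m ≤ H P := by
    have h7 : μ*γ/32/PT d m ≤ Ex H := ddr h6 §
    obtain ⟨P, hP⟩ := Ex_exists_ge H
    exact ⟨P, h7.trans hP⟩
  have hpos : 0 < H P := lt_of_lt_of_le (by have := PT_pos d m; positivity) hP
  have hex : Injective j ∧ Mt μ m Δ P := by
    by_contra hcon
    have : H P = 0 := by
      simp only [hH]
      rw [Ex_congr fun s => Ex_congr fun i => ind_false (fun h => hcon ⟨h.1.2.1, h.2.1⟩)]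
      simp [Ex]
    linarith
  refine ⟨j, P, hex.1, hex.2, hP.trans (Ex_mono fun s => Ex_ind_mono fun i h => ⟨h.1.1.2, h.1.2.2, fun p hp => (h.2.2 p hp).1⟩)⟩
lemma Ex_fst {κ Ω1 Ω2 : Type} [Fintype κ] [DecidableEq κ] [Fintype Ω1] [Fintype Ω2] [Nonempty Ω2] (g : (κ → Ω1) → ℝ) :
    (Ex fun z : κ → Ω1 × Ω2 => g fun a => (z a).1) = Ex g := by
  have := Ex_equiv (Equiv.arrowProdEquivProdArrow κ (fun _ => Ω1) (fun _ => Ω2)) (fun z => g z.1)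
  refine Eq.trans this ?_
  rw [Ex_prod]; simp only [Ex_const]
lemma Ex_snd {κ Ω1 Ω2 : Type} [Fintype κ] [DecidableEq κ] [Fintype Ω1] [Fintype Ω2] [Nonempty Ω1] (g : (κ → Ω2) → ℝ) :
    (Ex fun z : κ → Ω1 × Ω2 => g fun a => (z a).2) = Ex g := by
  have := Ex_equiv (Equiv.arrowProdEquivProdArrow κ (fun _ => Ω1) (fun _ => Ω2)) (fun z => g z.2)
  refine Eq.trans this ?_
  rw [Ex_prod]; simp only [Ex_const]
lemma marg {I κ Ω : Type} [Fintype I] [DecidableEq I] [Fintype κ] [DecidableEq κ] [Fintype Ω] [Nonempty Ω] {B : ℕ}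
    (h : κ → I) (hh : Injective h) (g : (κ × Fin B → Ω) → ℝ) :
    (Ex fun z : I → Fin B → Ω => g fun a => z (h a.1) a.2) = Ex g := by
  have e := Ex_equiv (Equiv.curry I (Fin B) Ω) (fun z : I → Fin B → Ω => g fun a => z (h a.1) a.2)
  rw [← e]
  exact Ex_marginal (V := Ω) (fun a : κ × Fin B => (h a.1, a.2)) (fun a b hab => by
    simp only [Prod.mk.injEq] at hab; exact Prod.ext (hh hab.1) hab.2) g
def Tl (E : Г) (A : Finset V → Finset V) (ζ : ℝ) {ι : Type} {b : ℕ} (φ : ι → Φ → Fin b → V) : Prop :=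
  (Injective fun t : ι × Φ × Fin b => Я) ∧ ∀ j (s : Φ → Fin b), FS E A ζ fun i => φ j i (s i)
def BB (d m b' : ℕ) : ℕ := m * Δ * (b' * 2)
def lab {d m b' : ℕ} (e : Щ × Fin b' × Fin 2 ≃ Ж) (p : Щ × Щ) (i : Φ) (c : Fin b') :
    (Ψ × Ж) ⊕ (Щ × Ж) :=
  mkr (Sum.inr (p.1, e (p.1, c, 0))) (Sum.inr (p.2, e (p.2, c, 1))) (fun r => Sum.inl (r, e (p.1, c, 0))) i
lemma lab_inj {d m b' : ℕ} (e : Щ × Fin b' × Fin 2 ≃ Ж) (P : Finset (Щ × Щ))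
    (h1 : ∀ p ∈ P, ∀ q ∈ P, p.1 = q.1 → p = q) (h2 : ∀ p ∈ P, ∀ q ∈ P, p.2 = q.2 → p = q) :
    Injective fun t : P × Φ × Fin b' => lab e t.1 t.2.1 t.2.2 := by
  rintro ⟨p, i, c⟩ ⟨p', i', c'⟩ h
  simp only [lab, mkr] at h
  revert h
  refine Fin.cases ?_ (fun i => Fin.cases ?_ (fun i => ?_) i) i <;> refine Fin.cases ?_ (fun i' => Fin.cases ?_ (fun i' => ?_) i') i' <;>
    simp only [Fin.cons_zero, Fin.cons_succ, Sum.inr.injEq, Sum.inl.injEq, Prod.mk.injEq, reduceCtorEq, false_imp_iff, EmbeddingLike.apply_eq_iff_eq] <;> intro h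
  · obtain ⟨ha, _, hc, _⟩ := h
    exact ⟨Subtype.ext (h1 _ p.2 _ p'.2 ha), trivial, hc⟩
  · exact absurd h.2.2.2 (by decide)
  · exact absurd h.2.2.2 (by decide)
  · obtain ⟨ha, _, hc, _⟩ := h
    exact ⟨Subtype.ext (h2 _ p.2 _ p'.2 ha), trivial, hc⟩
  · obtain ⟨hr, ha, hc, _⟩ := h
    exact ⟨Subtype.ext (h1 _ p.2 _ p'.2 ha), by rw [hr], hc⟩
lemma Good.unit_box (hG : Good d μ δ L c E A) {ζ : ℝ} (φ : J → Φ → Fin b → V)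
    (hφ : Injective fun t : J × Φ × Fin b => Я) (U0 X' : Finset V) (hUX : Disjoint U0 X')
    (j : Fin m → J) (hj : Injective j) (P : Finset (Щ × Щ)) (hP1 : ∀ p ∈ P, ∀ q ∈ P, p.1 = q.1 → p = q) (hP2 : ∀ p ∈ P, ∀ q ∈ P, p.2 = q.2 → p = q)
    {c0 : ℝ} (hc0 : 0 < c0)
    (hEx : c0 ≤ Ex fun s : Ψ → V => Ex fun i : Fin m × Φ → Fin b =>
        ind ((∀ r, s r ∈ U0) ∧ (∀ u, Ю u ∉ X') ∧ ∀ p ∈ P, FS E A ζ (mkr (Ю p.1) (Ю p.2) s)))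
    (b' : ℕ) [NeZero b']
    (hf : (m * Θ : ℝ) * ((BB d m b' : ℝ)^2 / b) + (((d+1:ℕ) * BB d m b' : ℝ)^2 + ((d+1:ℕ) * BB d m b' : ℝ) * (m * Θ * b : ℝ)) / Ξ
      < c0 ^ (BB d m b' ^ (d + 1 + m * Δ))) :
    ∃ (ψ : P → Φ → Fin b' → V), Tl E A ζ ψ ∧ (∀ p i c, ψ p i c ∉ X') ∧ 
      ∀ j0 i0, (∀ c, φ j0 i0 c ∉ U0) → (univ.filter fun c => ∃ p i c', φ j0 i0 c = ψ p i c').card ≤ 2 * b' * (if j0 ∈ univ.image j then 1 else 0) := by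
  classical
  obtain ⟨B, hB⟩ := ex_ (BB d m b')
  let e : Щ × Fin b' × Fin 2 ≃ Ж := Fintype.equivFinOfCardEq (by simp [BB])
  let Pz : (Ψ ⊕ Щ → V × Fin b) → Prop := fun z =>
    (∀ r, (z (Sum.inl r)).1 ∈ U0) ∧ (∀ u, φ (j u.1) u.2 (z (Sum.inr u)).2 ∉ X') ∧
      ∀ p ∈ P, FS E A ζ (mkr (φ (j p.1.1) p.1.2 (z (Sum.inr p.1)).2) (φ (j p.2.1) p.2.2 (z (Sum.inr p.2)).2) fun r => (z (Sum.inl r)).1)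
  have h1 : c0 ≤ Ex fun z => ind (Pz z) := by
    refine hEx.trans (le_of_eq ?_)
    rw [Ex_sum_elim (V := V × Fin b)]
    simp only [Pz, Sum.elim_inl, Sum.elim_inr]
    rw [← Ex_fst (Ω2 := Fin b) (fun s : Ψ → V => Ex fun i : Fin m × Φ → Fin b =>
        ind ((∀ r, s r ∈ U0) ∧ (∀ u, Ю u ∉ X') ∧ ∀ p ∈ P, FS E A ζ (mkr (Ю p.1) (Ю p.2) s)))]
    refine Ex_congr fun s => ?_
    rw [← Ex_snd (Ω1 := V)]
  have h2 : c0 ^ (BB d m b' ^ (d + 1 + m * Δ)) ≤ Ex fun z : Ψ ⊕ Щ → Ж → V × Fin b =>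
      ind (∀ s : Ψ ⊕ Щ → Ж, Pz fun i => z i (s i)) := by
    have := box (BB d m b') Pz
    rw [show Fintype.card (Ψ ⊕ Щ) = d + 1 + m * Δ by simp] at this
    exact (pll hc0.le h1 _).trans this
  let Xj : Finset V := univ.image fun t : Fin m × Φ × Fin b => φ (j t.1) t.2.1 t.2.2
  have hXj : (Xj.card : ℝ) ≤ m * Θ * b := by
    have : Xj.card ≤ m * (Δ * b) := card_image_le.trans £
    calc (Xj.card : ℝ) ≤ ((m * (Δ * b) : ℕ) : ℝ) := by exact_mod_cast this
      _ = _ := by push_cast; ring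
  have f1 : (Ex fun z : Ψ ⊕ Щ → Ж → V × Fin b =>
      ind (¬ Л)) ≤ (m * Θ : ℝ) * ((BB d m b' : ℝ)^2 / b) := by
    have g1 : ∀ u, (Ex fun z : Ψ ⊕ Щ → Ж → V × Fin b =>
        ind (¬ Injective fun a => (z (Sum.inr u) a).2)) ≤ (BB d m b' : ℝ)^2 / b := by
      intro u
      rw [Ex_coord (V := Ж → V × Fin b) (Sum.inr u) (fun z => ind (¬ Injective fun a => (z a).2)),
        Ex_snd (Ω1 := V) (fun z : Ж → Fin b => ind (¬ Injective z))]
      have := Ex_ninj (V := Fin b) (BB d m b')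
      rwa [Fintype.card_fin] at this
    calc _ ≤ Ex fun z : Ψ ⊕ Щ → Ж → V × Fin b => ∑ u, ind (¬ Injective fun a => (z (Sum.inr u) a).2) := by
          refine Ex_mono fun z => ?_
          have := ind_exists_le univ (fun u => ¬ Injective fun a => (z (Sum.inr u) a).2)
          refine (ind_mono fun h => ?_).trans this
          push Not at h; obtain ⟨u, hu⟩ := h; exact ⟨u, mem_univ _, hu⟩
      _ = ∑ u, Ex fun z : Ψ ⊕ Щ → Ж → V × Fin b => ind (¬ Injective fun a => (z (Sum.inr u) a).2) := Ex_sum _ _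
      _ ≤ ∑ u : Fin m × Φ, (BB d m b' : ℝ)^2 / b := sum_le_sum fun u _ => g1 u
      _ = _ := by rw [sum_const, card_univ, Fintype.card_prod, Fintype.card_fin, Fintype.card_fin, nsmul_eq_mul]; push_cast; ring
  have f2 : (Ex fun z : Ψ ⊕ Щ → Ж → V × Fin b =>
      ind (¬ Э))
      ≤ (((d+1:ℕ) * BB d m b' : ℝ)^2 + ((d+1:ℕ) * BB d m b' : ℝ) * (m * Θ * b : ℝ)) / Ξ := by
    rw [marg (I := Ψ ⊕ Щ) (Sum.inl : Ψ → _) Sum.inl_injective (fun x : Ψ × Ж → V × Fin b => ind (¬ (Injective (fun a => (x a).1) ∧ ∀ a, (x a).1 ∉ Xj))),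
      Ex_fst (Ω2 := Fin b) (fun x : Ψ × Ж → V => ind (¬ (Injective x ∧ ∀ a, x a ∉ Xj)))]
    refine (avoid Xj).trans (ddr ?_ §)
    rw [Fintype.card_prod, Fintype.card_fin, Fintype.card_fin]
    push_cast
    have := mll hXj (show ø ≤ Ы * BB d m b' by positivity)
    push_cast at this ⊢
    linarith
  obtain ⟨z, hz, hz1, hz2⟩ : ∃ z : Ψ ⊕ Щ → Ж → V × Fin b, 
      (∀ s : Ψ ⊕ Щ → Ж, Pz fun i => z i (s i)) ∧ (Л) ∧
      Э := by
    refine Ex_ind_exists ?_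
    have g1 := Ex_ind_le_add (fun z : Ψ ⊕ Щ → Ж → V × Fin b => ∀ s : Ψ ⊕ Щ → Ж, Pz fun i => z i (s i))
      (fun z => (Л) ∧ Э)
    have g2 := Ex_ind_or_le (fun z : Ψ ⊕ Щ → Ж → V × Fin b => ¬ Л)
      (fun z => ¬ Э)
    have g3 := Ex_ind_mono (Ω := Ψ ⊕ Щ → Ж → V × Fin b) (P := fun z => ¬ ((Л) ∧ Э))
      (Q := fun z => (¬ Л) ∨ ¬ Э)
      (fun z h => not_and_or.1 h)
    linarith
  let val : (Ψ × Ж) ⊕ (Щ × Ж) → V :=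
    Sum.elim (fun a => (z (Sum.inl a.1) a.2).1) (fun a => φ (j a.1.1) a.1.2 (z (Sum.inr a.1) a.2).2)
  have hval : Injective val := by
    rintro (a | a) (a' | a') h
    · exact congrArg Sum.inl (hz2.1 h)
    · exact absurd (show (z (Sum.inl a.1) a.2).1 ∈ Xj from mem_image.2 ⟨(a'.1.1, a'.1.2, (z (Sum.inr a'.1) a'.2).2), mem_univ _, h.symm⟩) (hz2.2 a)
    · exact absurd (show (z (Sum.inl a'.1) a'.2).1 ∈ Xj from mem_image.2 ⟨(a.1.1, a.1.2, (z (Sum.inr a.1) a.2).2), mem_univ _, h⟩) (hz2.2 a')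
    · have h3 := hφ (a₁ := (j a.1.1, a.1.2, (z (Sum.inr a.1) a.2).2)) (a₂ := (j a'.1.1, a'.1.2, (z (Sum.inr a'.1) a'.2).2)) h
      simp only [Prod.mk.injEq] at h3
      have h4 : a.1 = a'.1 := Prod.ext (hj h3.1) h3.2.1
      have h5 : a.2 = a'.2 := hz1 a.1 (by beta_reduce; rw [h3.2.2, h4])
      rw [Prod.ext h4 h5]
  have hne : ∀ p ∈ P, p.1 ≠ p.2 := by
    intro p hp heq
    have hB0 : 0 < BB d m b' := by
      have := NeZero.pos m; have := NeZero.pos b'; unfold BB; positivity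
    have h3 := hG.inj ((hz fun _ => ⟨0, hB0⟩).2.2 p hp).1.ed
    have h4 := @h3 0 1 (by simp [mkr, heq])
    exact absurd h4 (by simp [Fin.ext_iff])
  refine ⟨fun p i c => val (lab e p i c), ⟨?_, ?_⟩, ?_, ?_⟩
  · exact hval.comp (lab_inj e P hP1 hP2)
  · intro p s
    let sec : Ψ ⊕ Щ → Ж := Sum.elim (fun r => e (p.1.1, s r.succ.succ, 0)) (fun u => if u = p.1.1 then e (p.1.1, s 0, 0) else e (u, s 1, 1))
    have h3 := (hz sec).2.2 p.1 p.2
    have h4 : sec (Sum.inr p.1.1) = e (p.1.1, s 0, 0) := if_pos rfl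
    have h5 : sec (Sum.inr p.1.2) = e (p.1.2, s 1, 1) := if_neg (hne p.1 p.2).symm
    simp only [h4, h5] at h3
    convert h3 using 1
    funext i
    refine Fin.cases rfl (fun i => Fin.cases rfl (fun i => rfl) i) i
  · intro p i c
    have hX1 : ∀ a, val a ∉ X' := by
      rintro (a | a)
      · have := (hz (fun _ => a.2)).1 a.1
        exact fun h => disjoint_left.1 hUX this h
      · exact (hz (fun _ => a.2)).2.1 a.1
    exact hX1 _
  · intro j0 i0 hU
    by_cases hj0 : j0 ∈ univ.image j
    · rw [if_pos hj0, mul_one]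
      obtain ⟨a0, -, ha0⟩ := mem_image.1 hj0
      refine (card_le_card (t := univ.image fun x : Fin b' × Fin 2 => (z (Sum.inr (a0, i0)) (e ((a0, i0), x.1, x.2))).2) ?_).trans (card_image_le.trans (by simp [mul_comm]))
      intro c hc
      obtain ⟨p, i, c', h⟩ := (mem_filter.1 hc).2
      rw [mem_image]
      have hin : ∀ u x y, φ j0 i0 c = φ (j (u : Fin m × Φ).1) u.2 (z (Sum.inr u) (e (u, x, y))).2 → ∃ a ∈ univ, (z (Sum.inr (a0, i0)) (e ((a0, i0), (a : Fin b' × Fin 2).1, a.2))).2 = c := by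
        intro u x y h
        have h3 := hφ (a₁ := (j0, i0, c)) (a₂ := (j u.1, u.2, (z (Sum.inr u) (e (u, x, y))).2)) h
        simp only [Prod.mk.injEq] at h3
        have h4 : u = (a0, i0) := Prod.ext (hj (by rw [ha0, h3.1])) h3.2.1.symm
        subst h4
        exact ⟨(x, y), mem_univ _, h3.2.2.symm⟩
      revert h
      refine Fin.cases ?_ (fun i => Fin.cases ?_ (fun i => ?_) i) i <;> intro h
      · exact hin p.1.1 c' 0 h
      · exact hin p.1.2 c' 1 h
      · exact absurd (by rw [h]; exact (hz (fun _ => e (p.1.1, c', 0))).1 i) (hU c)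
    · rw [if_neg hj0, mul_zero]
      refine (card_eq_zero.2 (filter_eq_empty_iff.2 ?_)).le
      rintro c - ⟨p, i, c', h⟩
      have hin : ∀ u y, φ j0 i0 c = φ (j (u : Fin m × Φ).1) u.2 y → False := by
        intro u y h
        have h3 := hφ (a₁ := (j0, i0, c)) (a₂ := (j u.1, u.2, y)) h
        simp only [Prod.mk.injEq] at h3
        exact hj0 (mem_image.2 ⟨u.1, mem_univ _, h3.1.symm⟩)
      revert h
      refine Fin.cases ?_ (fun i => Fin.cases ?_ (fun i => ?_) i) i <;> intro h
      · exact hin p.1.1 _ h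
      · exact hin p.1.2 _ h
      · exact absurd (by rw [h]; exact (hz (fun _ => e (p.1.1, c', 0))).1 i) (hU c)
end
section
variable {V : Type} [Fintype V] [DecidableEq V] [Nonempty V]
variable {d : ℕ} {μ δ : ℝ} {L : ℕ} {c : ℝ} {E : Г} {A : Finset V → Finset V}
lemma emb_finset {T U : Type} [Fintype T] (s : Finset U) (h : Fintype.card T ≤ s.card) : ∃ f : T → U, Injective f ∧ ∀ t, f t ∈ s := by
  classical
  obtain ⟨f⟩ := Function.Embedding.nonempty_of_card_le (α := T) (β := s) (by simpa using h)
  exact ⟨fun t => (f t).1, fun a b h => f.injective (Subtype.ext h), fun t => (f t).2⟩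
lemma Tl.card_le {ζ : ℝ} {b : ℕ} {ι : Type} [Fintype ι] {φ : ι → Φ → Fin b → V} (h : Injective fun t : ι × Φ × Fin b => Я) :
    (univ.image fun t : ι × Φ × Fin b => Я).card = Fintype.card ι * Δ * b := by
  rw [card_image_of_injective _ h, card_univ]; simp [mul_assoc]
lemma Tl.recut {ζ : ℝ} {b b' : ℕ} (hb' : 0 < b') {ι κ : Type} [Fintype ι] [Fintype κ] {φ : ι → Φ → Fin b → V} (hφ : Tl E A ζ φ)
    {ψ : κ → Φ → Fin b' → V} (hψ : Tl E A ζ ψ) (cnt : ι → ℕ)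
    (hc : ∀ j i, (univ.filter fun c => ∃ p i' c', φ j i c = ψ p i' c').card ≤ 2 * b' * cnt j) :
    ∃ (ι' : Type) (_ : Fintype ι') (χ : ι' → Φ → Fin b' → V), Tl E A ζ χ ∧
      Fintype.card ι' = Fintype.card κ + ∑ j, (b - 2 * b' * cnt j) / b' ∧
      ∀ X : Finset V, (∀ j i c, φ j i c ∉ X) → (∀ j i c, ψ j i c ∉ X) → ∀ j i c, χ j i c ∉ X := by
  classical
  have h1 : ∀ j i, ∃ g : Fin ((b - 2 * b' * cnt j) / b') × Fin b' → Fin b, Injective g ∧ ∀ t, g t ∈ univ.filter fun c => ¬ ∃ p i' c', φ j i c = ψ p i' c' := by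
    intro j i
    refine emb_finset _ ?_
    rw [Fintype.card_prod, Fintype.card_fin, Fintype.card_fin]
    refine (Nat.div_mul_le_self _ _).trans ?_
    have h2 := card_filter_add_card_filter_not (s := (univ : Finset (Fin b))) (fun c => ∃ p i' c', φ j i c = ψ p i' c')
    rw [card_univ, Fintype.card_fin] at h2
    have := hc j i
    omega
  choose g hg1 hg2 using h1
  refine ⟨κ ⊕ (Σ j, Fin ((b - 2 * b' * cnt j) / b')), inferInstance, Sum.elim ψ (fun t i c => φ t.1 i (g t.1 i (t.2, c))), ⟨?_, ?_⟩, ?_, ?_⟩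
  · rintro ⟨p | t, i, c⟩ ⟨p' | t', i', c'⟩ h
    · have := hψ.1 (a₁ := (p, i, c)) (a₂ := (p', i', c')) h
      simp only [Prod.mk.injEq] at this; obtain ⟨rfl, rfl, rfl⟩ := this; rfl
    · exact absurd ⟨p, i, c, Eq.symm h⟩ (mem_filter.1 (hg2 t'.1 i' (t'.2, c'))).2
    · exact absurd ⟨p', i', c', h⟩ (mem_filter.1 (hg2 t.1 i (t.2, c))).2
    · obtain ⟨j, t⟩ := t; obtain ⟨j', t'⟩ := t'
      have := hφ.1 (a₁ := (j, i, g j i (t, c))) (a₂ := (j', i', g j' i' (t', c'))) h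
      simp only [Prod.mk.injEq] at this; obtain ⟨rfl, rfl, h3⟩ := this
      have h4 := hg1 j i h3
      simp only [Prod.mk.injEq] at h4; obtain ⟨rfl, rfl⟩ := h4; rfl
  · rintro (p | t) s
    · exact hψ.2 p s
    · exact hφ.2 t.1 (fun i => g t.1 i (t.2, s i))
  · simp
  · rintro X hX1 hX2 (p | t) i c
    · exact hX2 p i c
    · exact hX1 _ _ _
lemma fill {b : ℕ} (hb : 0 < b) {ι : Type} [Fintype ι] {φ : ι → Φ → Fin b → V} (hφ : Injective fun t : ι × Φ × Fin b => Я) :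
    ∃ (M : ℕ) (ω : Fin M → Φ → Fin b → V),
      (Injective fun t : (ι ⊕ Fin M) × Φ × Fin b => (Sum.elim φ ω) t.1 t.2.1 t.2.2) ∧
      Ξ ≤ Fintype.card (ι ⊕ Fin M) * Δ * b + Δ * b := by
  classical
  obtain ⟨U, hU⟩ := ex_ (univ \ univ.image fun t : ι × Φ × Fin b => Я)
  have hUc : U.card + Fintype.card ι * Δ * b = Ξ := by
    rw [← Tl.card_le (ζ := 0) hφ, hU, card_sdiff_add_card_eq_card (subset_univ _), card_univ]
  obtain ⟨f, hf1, hf2⟩ := emb_finset (T := Fin (U.card / (Δ*b)) × Φ × Fin b) U (by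
    simp only [Fintype.card_prod, Fintype.card_fin]; exact Nat.div_mul_le_self _ _)
  have hf3 : ∀ t (s : ι × Φ × Fin b), f t ≠ φ s.1 s.2.1 s.2.2 := by
    intro t s h
    have := hf2 t
    rw [hU, mem_sdiff] at this
    exact this.2 (mem_image.2 ⟨s, mem_univ _, h.symm⟩)
  refine ⟨U.card / (Δ*b), fun a i c => f (a, i, c), ?_, ?_⟩
  · rintro ⟨p | t, i, c⟩ ⟨p' | t', i', c'⟩ h
    · have := hφ (a₁ := (p, i, c)) (a₂ := (p', i', c')) h
      simp only [Prod.mk.injEq] at this; obtain ⟨rfl, rfl, rfl⟩ := this; rfl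
    · exact absurd h.symm (hf3 (t', i', c') (p, i, c))
    · exact absurd h (hf3 (t, i, c) (p', i', c'))
    · have := hf1 (a₁ := (t, i, c)) (a₂ := (t', i', c')) h
      simp only [Prod.mk.injEq] at this; obtain ⟨rfl, rfl, rfl⟩ := this; rfl
  · rw [Fintype.card_sum, Fintype.card_fin]
    have := Nat.lt_div_mul_add (a := U.card) (b := Δ*b) §
    nlinarith
def US (E : Г) (A : Finset V → Finset V) (ζ μ : ℝ) (m : ℕ) {b : ℕ} (b' : ℕ) {ι : Type} [Fintype ι] (φ : ι → Φ → Fin b → V) (X : Finset V) (Q : ℕ) : Prop :=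
  ∃ (κ : Type) (_ : Fintype κ) (ψ : κ → Φ → Fin b' → V) (cnt : ι → ℕ), Tl E A ζ ψ ∧ (∀ j i c, ψ j i c ∉ X) ∧
    (2/3 + μ/16) * (m * Θ) * Q ≤ (Fintype.card κ : ℝ) ∧ Fintype.card κ ≤ m * Δ * Q ∧ ∑ j, cnt j ≤ m * Q ∧
    ∀ j i, (univ.filter fun c => ∃ p i' c', φ j i c = ψ p i' c').card ≤ 2 * b' * cnt j
lemma Good.unit_step (hG : Good d μ δ L c E A) (hμ : 0 < μ) (hμ1 : μ ≤ 1) {ε : ℝ} (hε : 0 < ε) {b b' m : ℕ} (hb : 0 < b) (hb' : 0 < b') (hm0 : 0 < m)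
    {ι : Type} [Fintype ι] {φ : ι → Φ → Fin b → V} (hφ : Tl E A Ц φ) {X : Finset V} {ϑ γ ρ c0 : ℝ} (hϑ : 0 < ϑ) (hρϑ : ρ ≤ ϑ/2)
    (hXϑ : ϑ * Ξ + X.card + Fintype.card ι * Θ * b ≤ Ξ)
    (hγ : γ = (ϑ/2)^Ы/2) (hεγ : ε ≤ μ*γ/16) (hm : 1/(m:ℝ) ≤ μ/16)
    (hXk : m * Θ * (X.card / Ξ) ≤ μ/128) (hρ : m * Θ * ρ ≤ μ/128)
    (hc0 : c0 = μ*γ/32/PT d m)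
    (n1 : 64 * (Θ * b) / Ξ ≤ μ) (n2 : 128 * (m * Θ * (Θ * b)) / Ξ ≤ μ)
    (n3 : 256 * (m^2 * (Θ * b)) / Ξ ≤ μ) (n4 : (d+1:ℕ)^2 / (Ξ:ℝ) ≤ γ)
    (hf : (m * Θ : ℝ) * ((BB d m b' : ℝ)^2 / b) + (((d+1:ℕ) * BB d m b' : ℝ)^2 + ((d+1:ℕ) * BB d m b' : ℝ) * (m * Θ * b : ℝ)) / Ξ
      < c0 ^ (BB d m b' ^ (d + 1 + m * Δ))) {Q : ℕ}
    (κ : Type) [Fintype κ] (ψ : κ → Φ → Fin b' → V) (cnt : ι → ℕ) (hψ : Tl E A Ц ψ) (hψX : ∀ j i c, ψ j i c ∉ X)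
    (hk1 : (2/3 + μ/16) * (m * Θ) * Q ≤ (Fintype.card κ : ℝ)) (hk2 : Fintype.card κ ≤ m * Δ * Q) (hk3 : ∑ j, cnt j ≤ m * Q)
    (hk4 : ∀ j i, (univ.filter fun c => ∃ p i' c', φ j i c = ψ p i' c').card ≤ 2 * b' * cnt j)
    (hsmall : (Fintype.card κ * Θ * b' : ℝ) ≤ ρ * Ξ) :
    US E A Ц μ m b' φ X (Q+1) := by
  classical
  haveI : NeZero b := ⟨hb.ne'⟩
  haveI : NeZero b' := ⟨hb'.ne'⟩
  haveI : NeZero m := ⟨hm0.ne'⟩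
  have hn : ø < Ξ := by exact_mod_cast Fintype.card_pos
  have hm0' : ø < m := by exact_mod_cast hm0
  have hb0' : ø < b := by exact_mod_cast hb
  obtain ⟨M, ω, hω, hcard⟩ := fill hb hφ.1
  have hcardR : (Ξ : ℝ) ≤ Fintype.card (ι ⊕ Fin M) * Θ * b + Θ * b := by exact_mod_cast hcard
  obtain ⟨n, hnd⟩ := ex_ (Ξ : ℝ)
  obtain ⟨N, hNd⟩ := ex_ (Fintype.card (ι ⊕ Fin M) : ℝ)
  obtain ⟨K, hK⟩ := ex_ (Θ : ℝ)
  have hK0 : 0 < K := by rw [hK]; positivity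
  rw [← hnd, ← hNd, ← hK] at hcardR
  rw [← hnd] at hn
  rw [← hnd, ← hK] at n1 n2 n3 hXk hXϑ hsmall
  rw [← hK] at hρ
  have hN0 : 0 < N := by
    by_contra hcon
    have h1 : N * K * b ≤ 0 := by
      have h0 : N ≤ 0 := not_lt.1 hcon
      have h1 := mul_nonneg (mul_nonneg (neg_nonneg.2 h0) hK0.le) hb0'.le
      linarith
    rw [dli hn] at n1
    have : μ * n ≤ n := mul_le_of_le_one_left hn.le hμ1
    linarith
  haveI : Nonempty (ι ⊕ Fin M) := Fintype.card_pos_iff.1 (by rw [hNd] at hN0; exact_mod_cast hN0)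
  obtain ⟨W, hW⟩ := ex_ (univ.image fun t : κ × Φ × Fin b' => ψ t.1 t.2.1 t.2.2)
  obtain ⟨Y, hY⟩ := ex_ (univ.image fun t : ι × Φ × Fin b => Я)
  have hWc : (W.card : ℝ) ≤ ρ * n := by
    rw [hW, Tl.card_le (ζ := 0) hψ.1]; push_cast at hsmall ⊢; rw [hK] at hsmall; push_cast at hsmall; linarith
  have hYc : (Y.card : ℝ) = Fintype.card ι * K * b := by
    rw [hY, Tl.card_le (ζ := 0) hφ.1, hK]; push_cast; ring
  obtain ⟨U0, hU0⟩ := ex_ (univ \ (Y ∪ (X ∪ W)))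
  have hU0c : ϑ/2 ≤ ms U0 := by
    unfold ms; rw [Ex_ind_card, ← hnd, le_div_iff₀ hn]
    have h1 : U0.card + (Y ∪ (X ∪ W)).card = Ξ := by
      rw [hU0, card_sdiff_add_card_eq_card (subset_univ _), card_univ]
    have h2 : (Y ∪ (X ∪ W)).card ≤ Y.card + (X.card + W.card) := (card_union_le _ _).trans (by have := card_union_le X W; omega)
    have h3 : n ≤ U0.card + (Y.card + (X.card + W.card)) := by rw [hnd]; exact_mod_cast (by omega : Ξ ≤ U0.card + (Y.card + (X.card + W.card)))
    have h4 : ρ * n ≤ ϑ/2 * n := mlr hρϑ hn.le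
    linarith
  have hγ0 : 0 < γ := by rw [hγ]; positivity
  have hγ2 : γ ≤ (ms U0)^Ы - (d+1:ℕ)^2 / Ξ := by
    have : (ϑ/2)^Ы ≤ (ms U0)^Ы := pll § hU0c _
    have : (ϑ/2)^Ы = 2*γ := by rw [hγ]; ring
    linarith
  have hmX : ms (X ∪ W) ≤ X.card / n + ρ := by
    unfold ms; rw [Ex_ind_card, ← hnd]
    have h2 : ((X ∪ W).card : ℝ) ≤ X.card + W.card := by exact_mod_cast card_union_le X W
    rw [dli hn, add_mul, div_mul_cancel₀ _ hn.ne']; linarith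
  have hd1 : 4 * (K * b / n) + 1/(m:ℝ) ≤ μ/8 := by
    have : 64 * (K*b) / n = 64 * (K * b / n) := by ring
    linarith
  have hd2 : m * K * (ms (X ∪ W) + K * b / n) + m^2 / N ≤ μ/32 := by
    have h1 : m * K * ms (X ∪ W) ≤ m * K * (X.card / n + ρ) := mll hmX §
    have h2 : 128 * (m * K * (K*b)) / n = 128 * (m * K * (K * b / n)) := by ring
    have h3 : (m:ℝ)^2 / N ≤ μ/128 := by
      have h4 : 256 * (m^2 * (K * b)) ≤ μ * n := by rwa [dli hn] at n3
      have h5 : n ≤ 2 * (N * K * b) := by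
        have : 64 * (K * b) ≤ μ * n := by rwa [dli hn] at n1
        have : μ * n ≤ n := mul_le_of_le_one_left hn.le hμ1
        linarith
      have h6 : μ * n ≤ μ * (2 * (N * K * b)) := mll h5 hμ.le
      rw [dli hN0]
      have h7 : (K * b) * (m^2) ≤ (K * b) * (μ/128 * N) := by linarith
      exact le_of_mul_le_mul_left h7 §
    linarith
  obtain ⟨j, P, hj, hMt, hEx⟩ := hG.unit_prob hμ hμ1 hε (Sum.elim φ ω) hω (θ := K * b / n) §
    (by rw [← hnd, ← hNd, ← hK, sub_mul, one_mul, div_mul_cancel₀ _ hn.ne']; linarith) U0 (X ∪ W) hγ0 hγ2 hεγ hd1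
    (by rw [← hNd, ← hK]; exact hd2)
  rw [← hc0] at hEx
  have hc00 : 0 < c0 := by rw [hc0]; have := PT_pos d m; positivity
  obtain ⟨χ, hχ, hχX, hχc⟩ := hG.unit_box (Sum.elim φ ω) hω U0 (X ∪ W) (by
    rw [hU0]; exact disjoint_left.2 fun v h1 h2 => (mem_sdiff.1 h1).2 (mem_union_right _ h2)) j hj P hMt.2.1 hMt.2.2 hc00 hEx b' hf
  have hPc : P.card ≤ m * Δ := by
    have h1 : P.card ≤ (univ : Finset Щ).card := card_le_card_of_injOn (fun p => p.1) (fun _ _ => mem_univ _) (fun p hp q hq h => hMt.2.1 p hp q hq h)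
    simpa using h1
  refine ⟨κ ⊕ P, inferInstance, Sum.elim ψ χ, fun t => cnt t + (if Sum.inl t ∈ univ.image j then 1 else 0), ⟨?_, ?_⟩, ?_, ?_, ?_, ?_, ?_⟩
  · have hne : ∀ t i c t' i' c', ψ t i c ≠ χ t' i' c' := by
      intro t i c t' i' c' h
      refine hχX t' i' c' (mem_union_right _ ?_)
      rw [hW]; exact mem_image.2 ⟨(t, i, c), mem_univ _, h⟩
    rintro ⟨p | t, i, c⟩ ⟨p' | t', i', c'⟩ h
    · have := hψ.1 (a₁ := (p, i, c)) (a₂ := (p', i', c')) h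
      simp only [Prod.mk.injEq] at this; obtain ⟨rfl, rfl, rfl⟩ := this; rfl
    · exact absurd h (hne _ _ _ _ _ _)
    · exact absurd (Eq.symm h) (hne _ _ _ _ _ _)
    · have := hχ.1 (a₁ := (t, i, c)) (a₂ := (t', i', c')) h
      simp only [Prod.mk.injEq] at this; obtain ⟨rfl, rfl, rfl⟩ := this; rfl
  · rintro (t | t) s
    · exact hψ.2 t s
    · exact hχ.2 t s
  · rintro (t | t) i c
    · exact hψX t i c
    · exact fun h => hχX t i c (mem_union_left _ h)
  · rw [Fintype.card_sum, Fintype.card_coe]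
    have := hMt.1
    push_cast at this hk1 ⊢; linarith
  · rw [Fintype.card_sum, Fintype.card_coe, Nat.mul_succ]; omega
  · rw [sum_add_distrib, Nat.mul_succ]
    refine Nat.add_le_add hk3 ?_
    rw [← card_filter]
    calc _ ≤ (univ.image j).card := card_le_card_of_injOn Sum.inl (fun t ht => (mem_filter.1 ht).2) (fun _ _ _ _ h => Sum.inl_injective h)
      _ ≤ _ := card_image_le.trans £
  · intro t i
    have h1 := hχc (Sum.inl t) i (by
      intro c h; rw [hU0] at h
      refine (mem_sdiff.1 h).2 (mem_union_left _ ?_)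
      rw [hY]; exact mem_image.2 ⟨(t, i, c), mem_univ _, rfl⟩)
    have h2 := hk4 t i
    have h3 : (univ.filter fun c => ∃ p i' c', φ t i c = Sum.elim ψ χ p i' c') ⊆
        (univ.filter fun c => ∃ p i' c', φ t i c = ψ p i' c') ∪ (univ.filter fun c => ∃ p i' c', Sum.elim φ ω (Sum.inl t) i c = χ p i' c') := by
      intro c hc
      obtain ⟨p | p, i', c', h⟩ := (mem_filter.1 hc).2
      · exact mem_union_left _ (mem_filter.2 ⟨mem_univ _, p, i', c', h⟩)
      · exact mem_union_right _ (mem_filter.2 ⟨mem_univ _, p, i', c', h⟩)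
    calc _ ≤ _ := card_le_card h3
      _ ≤ _ := card_union_le _ _
      _ ≤ _ := Nat.add_le_add h2 h1
      _ = _ := by ring
end
lemma ev_div (C : ℝ) {τ : ℝ} (hτ : 0 < τ) : ∃ n0 : ℕ, ∀ n : ℕ, n0 ≤ n → C / n ≤ τ := by
  obtain ⟨k, hk⟩ := exists_nat_ge (C/τ)
  refine ⟨k + 1, fun n hn => ?_⟩
  have h1 : (k:ℝ) + 1 ≤ n := by exact_mod_cast hn
  have h2 : ø < n := by
    have : ø ≤ k := ncn k
    linarith
  rw [dli h2]
  rw [dli hτ] at hk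
  have : (k:ℝ) * τ ≤ n * τ := mlr ¶ hτ.le
  linarith
noncomputable def mm (μ : ℝ) : ℕ := ⌈16/μ⌉₊
noncomputable def kap (d : ℕ) (μ : ℝ) : ℝ := μ / (128 * (mm μ * Θ))
lemma mm_pos {μ : ℝ} (hμ : 0 < μ) : 0 < mm μ := Nat.ceil_pos.2 §
lemma kap_pos (d : ℕ) {μ : ℝ} (hμ : 0 < μ) : 0 < kap d μ := by
  have := mm_pos hμ; unfold kap; positivity
section
variable {V : Type} [Fintype V] [DecidableEq V] [Nonempty V]
variable {d : ℕ} {μ δ : ℝ} {L : ℕ} {c : ℝ} {E : Г} {A : Finset V → Finset V}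
lemma gain {ζ : ℝ} {b b' m : ℕ} (hb : 0 < b) (hb' : 0 < b') {ι κ : Type} [Fintype ι] [Fintype κ] {φ : ι → Φ → Fin b → V} (hφ : Tl E A ζ φ)
    {ψ : κ → Φ → Fin b' → V} (hψ : Tl E A ζ ψ) (cnt : ι → ℕ) {X : Finset V} (hφX : ∀ j i c, φ j i c ∉ X) (hψX : ∀ j i c, ψ j i c ∉ X) {Q : ℕ} (hμ : 0 < μ) {ρ : ℝ} (hρ : 0 < ρ)
    (hk1 : (2/3 + μ/16) * (m * Θ) * Q ≤ (Fintype.card κ : ℝ)) (hk2 : Fintype.card κ ≤ m * Δ * Q) (hk3 : ∑ j, cnt j ≤ m * Q)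
    (hk4 : ∀ j i, (univ.filter fun c => ∃ p i' c', φ j i c = ψ p i' c').card ≤ 2 * b' * cnt j)
    (hbig : ρ * Ξ ≤ (Fintype.card κ * Θ * b' : ℝ)) (hbb : (b':ℝ)/b ≤ μ*ρ/32) :
    ∃ (ι' : Type) (_ : Fintype ι') (χ : ι' → Φ → Fin b' → V), Tl E A ζ χ ∧ (∀ j i c, χ j i c ∉ X) ∧
      (Fintype.card ι * Θ * b + μ*ρ/32 * Ξ : ℝ) ≤ Fintype.card ι' * Θ * b' := by
  obtain ⟨ι', hι', χ, hχ, hcard, hav⟩ := Tl.recut hb' hφ hψ cnt hk4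
  refine ⟨ι', hι', χ, hχ, hav X hφX hψX, ?_⟩
  have hb0 : ø < b := by exact_mod_cast hb
  have hb0' : ø < b' := by exact_mod_cast hb'
  have hι : Fintype.card ι * Δ * b ≤ Ξ := by
    rw [← Tl.card_le (ζ := 0) hφ.1]; exact card_le_univ _
  have h1 : Fintype.card ι * b ≤ b' * (∑ j, (b - 2 * b' * cnt j) / b' + Fintype.card ι + 2 * ∑ j, cnt j) := by
    have h2 : ∀ j : ι, b ≤ b' * ((b - 2 * b' * cnt j) / b' + 1 + 2 * cnt j) := by
      intro j
      have := Nat.lt_div_mul_add (a := b - 2 * b' * cnt j) hb'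
      have e : b' * ((b - 2 * b' * cnt j) / b' + 1 + 2 * cnt j) = (b - 2 * b' * cnt j) / b' * b' + b' + 2 * b' * cnt j := by ring
      omega
    have h3 := sum_le_sum fun j (_ : j ∈ (univ : Finset ι)) => h2 j
    rw [← mul_sum, sum_add_distrib, sum_add_distrib, ← mul_sum] at h3
    simpa using h3
  obtain ⟨K, hK⟩ := ex_ (Θ : ℝ)
  have hK3 : 3 ≤ K := by rw [hK]; push_cast; linarith [(ncn d : ø ≤ d)]
  obtain ⟨n, hn⟩ := ex_ (Ξ : ℝ)
  obtain ⟨q, hq⟩ := ex_ (((∑ j, (b - 2 * b' * cnt j) / b' : ℕ) : ℝ) : ℝ)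
  obtain ⟨I, hI⟩ := ex_ (Fintype.card ι : ℝ)
  obtain ⟨k, hk⟩ := ex_ (Fintype.card κ : ℝ)
  obtain ⟨C, hC⟩ := ex_ (((∑ j, cnt j : ℕ) : ℝ) : ℝ)
  have h1' : I * b ≤ b' * (q + I + 2 * C) := by rw [hI, hq, hC]; exact_mod_cast h1
  have hk3' : C ≤ m * Q := by rw [hC]; exact_mod_cast hk3
  have hk2' : k ≤ m * K * Q := by rw [hk, hK]; exact_mod_cast hk2
  have hι2 : I * K * b ≤ n := by rw [hI, hK, hn]; exact_mod_cast hι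
  have hcard' : (Fintype.card ι' : ℝ) = k + q := by rw [hcard, hk, hq]; push_cast; ring
  rw [hcard', ← hK, ← hI, ← hn]
  rw [← hK, ← hk] at hk1
  rw [← hK, ← hk, ← hn] at hbig
  have hmQ : ø ≤ m * Q := by positivity
  have g1 : μ/16 * k ≤ k - 2 * (m * Q) := by
    have g2 : 0 ≤ (K - 3) * (m * Q) := mul_nonneg ¶ hmQ
    have g3 : μ * k ≤ μ * (m * K * Q) := mll hk2' hμ.le
    linarith
  have g4 : μ/16 * (ρ * n) ≤ μ/16 * (k * K * b') := mll hbig §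
  have g5 : K * b' * (μ/16 * k) ≤ K * b' * (k - 2 * (m * Q)) := mll g1 §
  have g6 : K * b' * I ≤ μ*ρ/32 * n := by
    have e : K * b' * I = (b'/b) * (I * K * b) := by field_simp
    rw [e]
    have hn0 : 0 ≤ n := by rw [hn]; positivity
    have hI0 : 0 ≤ I := by rw [hI]; positivity
    exact mul_le_mul hbb hι2 § §
  have g7 : K * (I * b) ≤ K * (b' * (q + I + 2 * C)) := mll h1' ¶
  have g8 : K * b' * C ≤ K * b' * (m * Q) := mll hk3' §
  linarith
end
lemma step (d : ℕ) {μ : ℝ} (hμ : 0 < μ) (hμ1 : μ ≤ 1) {ϑ : ℝ} (hϑ : 0 < ϑ) (hϑ1 : ϑ ≤ 1) : ∃ ε0 g : ℝ, 0 < ε0 ∧ 0 < g ∧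
    ∀ ε, 0 < ε → ε ≤ ε0 → ∀ b' : ℕ, 0 < b' → ∃ b0 : ℕ, ∀ b, b0 ≤ b → ∃ n0 : ℕ, 
    ∀ {V : Type} [Fintype V] [DecidableEq V] [Nonempty V] {δ : ℝ} {L : ℕ} {c : ℝ} {E : Г} {A : Finset V → Finset V}, Good d μ δ L c E A → n0 ≤ Ξ →
      ∀ X : Finset V, (X.card : ℝ) ≤ kap d μ * Ξ → ∀ (ι : Type) [Fintype ι] (φ : ι → Φ → Fin b → V), Tl E A Ц φ → (∀ j i c, φ j i c ∉ X) →
      ϑ * Ξ + X.card + Fintype.card ι * Θ * b ≤ (Ξ : ℝ) →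
      ∃ (ι' : Type) (_ : Fintype ι') (χ : ι' → Φ → Fin b' → V), Tl E A Ц χ ∧ (∀ j i c, χ j i c ∉ X) ∧
      (Fintype.card ι * Θ * b + g * Ξ : ℝ) ≤ Fintype.card ι' * Θ * b' := by
  obtain ⟨m, hm⟩ := ex_ (mm μ)
  have hm0 : 0 < m := hm ▸ mm_pos hμ
  have hmR : ø < m := by exact_mod_cast hm0
  have hm1 : 1/(m:ℝ) ≤ μ/16 := by
    have : 16/μ ≤ m := by rw [hm]; exact Nat.le_ceil _
    rw [dli hμ] at this
    rw [dli hmR]; linarith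
  have hkp := kap_pos d hμ
  have hkk : m * Θ * kap d μ = μ/128 := by
    unfold kap; rw [← hm]; field_simp
  obtain ⟨ρ, hρ⟩ := ex_ (min (ϑ/2) (kap d μ))
  have hρ0 : 0 < ρ := by rw [hρ]; exact lt_min § hkp
  have hρ1 : ρ ≤ ϑ/2 := by rw [hρ]; exact min_le_left _ _
  have hρ2 : ρ ≤ kap d μ := by rw [hρ]; exact min_le_right _ _
  obtain ⟨γ, hγ⟩ := ex_ ((ϑ/2)^Ы/2)
  have hγ0 : 0 < γ := by rw [hγ]; positivity
  obtain ⟨c0, hc0⟩ := ex_ (μ*γ/32/PT d m)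
  have hc00 : 0 < c0 := by rw [hc0]; have := PT_pos d m; positivity
  refine ⟨μ*γ/16, μ*ρ/32, by positivity, by positivity, fun ε hε hεγ b' hb' => ?_⟩
  obtain ⟨T, hT⟩ := ex_ (c0 ^ (BB d m b' ^ (d + 1 + m * Δ)))
  have hT0 : 0 < T := by rw [hT]; positivity
  obtain ⟨b1, hb1⟩ := ev_div ((m * Θ : ℝ) * (BB d m b' : ℝ)^2) (τ := T/4) §
  obtain ⟨b2, hb2⟩ := ev_div b' (τ := μ*ρ/32) §
  refine ⟨b1 + b2 + 1, fun b hbb => ?_⟩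
  have hb : 0 < b := by omega
  obtain ⟨n1, hn1⟩ := ev_div (64 * (Θ * b)) hμ
  obtain ⟨n2, hn2⟩ := ev_div (128 * (m * Θ * (Θ * b))) hμ
  obtain ⟨n3, hn3⟩ := ev_div (256 * (m^2 * (Θ * b))) hμ
  obtain ⟨n4, hn4⟩ := ev_div ((d+1:ℕ)^2) hγ0
  obtain ⟨n5, hn5⟩ := ev_div ((((d+1:ℕ) * BB d m b' : ℝ)^2 + ((d+1:ℕ) * BB d m b' : ℝ) * (m * Θ * b : ℝ))) (τ := T/4) §
  refine ⟨n1 + n2 + n3 + n4 + n5, fun {V} _ _ _ {δ L c E A} hG hn X hX ι _ φ hφ hφX hcov => ?_⟩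
  have hV : ø < Ξ := by exact_mod_cast Fintype.card_pos
  have hXk : m * Θ * ((X.card:ℝ) / Ξ) ≤ μ/128 := by
    rw [← hkk]
    refine mll ?_ §
    rwa [dli hV]
  have hρ3 : m * Θ * ρ ≤ μ/128 := by
    rw [← hkk]; exact mll hρ2 §
  have hf : (m * Θ : ℝ) * ((BB d m b' : ℝ)^2 / b) + (((d+1:ℕ) * BB d m b' : ℝ)^2 + ((d+1:ℕ) * BB d m b' : ℝ) * (m * Θ * b : ℝ)) / Ξ
      < c0 ^ (BB d m b' ^ (d + 1 + m * Δ)) := by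
    rw [← hT, ← mul_div_assoc]
    have := hb1 b ¿
    have := hn5 (Ξ) ¿
    linarith
  have hbig := hb2 b ¿
  by_contra hF
  have key : ∀ Q, US E A Ц μ m b' φ X Q := by
    intro Q
    induction Q with
    | zero =>
      refine ⟨Empty, inferInstance, fun t => t.elim, fun _ => 0, ⟨fun t => t.1.elim, fun t => t.elim⟩, fun t => t.elim, by simp, by simp, by simp, ?_⟩
      intro j i
      rw [mul_zero]
      refine (card_eq_zero.2 (filter_eq_empty_iff.2 ?_)).le
      rintro c - ⟨p, _⟩; exact p.elim
    | succ Q ih =>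
      obtain ⟨κ, hκ, ψ, cnt, h1, h2, h3, h4, h5, h6⟩ := ih
      by_cases hs : (Fintype.card κ * Θ * b' : ℝ) ≤ ρ * Ξ
      · exact hG.unit_step hμ hμ1 hε hb hb' hm0 hφ hϑ hρ1 hcov hγ hεγ hm1 hXk hρ3 hc0 (hn1 _ ¿) (hn2 _ ¿)
          (hn3 _ ¿) (hn4 _ ¿) hf κ ψ cnt h1 h2 h3 h4 h5 h6 hs
      · exact absurd (gain hb hb' hφ h1 cnt hφX h2 hμ hρ0 h3 h4 h5 h6 (not_le.1 hs).le hbig) hF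
  obtain ⟨κ, hκ, ψ, cnt, h1, h2, h3, h4, h5, h6⟩ := key (Ξ + 1)
  have h7 : Fintype.card κ * Δ * b' ≤ Ξ := by
    rw [← Tl.card_le (ζ := 0) h1.1]; exact card_le_univ _
  have h8 : Fintype.card κ ≤ Ξ := by
    refine le_trans ?_ h7
    rw [mul_assoc]; exact Nat.le_mul_of_pos_right _ §
  have h9 : (Fintype.card κ : ℝ) ≤ Ξ := by exact_mod_cast h8
  have h10 : (3:ℝ) ≤ m * Θ := by
    have : 3 ≤ m * Δ := le_trans (by omega : 3 ≤ d+3) (Nat.le_mul_of_pos_left _ ¿)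
    exact_mod_cast this
  push_cast at h3 h10
  have h11 : (2:ℝ) ≤ (2/3 + μ/16) * (m * Δ) := by
    have : 0 ≤ μ * (m * ((d:ℝ)+3)) := by positivity
    linarith
  have h12 := mlr h11 (show ø ≤ Ξ + 1 by positivity)
  linarith
lemma cover (d : ℕ) {μ : ℝ} (hμ : 0 < μ) (hμ1 : μ ≤ 1) {ϑ : ℝ} (hϑ : 0 < ϑ) (hϑ1 : ϑ ≤ 1) : ∃ ε0 : ℝ, 0 < ε0 ∧
    ∀ ε, 0 < ε → ε ≤ ε0 → ∀ bmin : ℕ, 0 < bmin → ∃ n0 bmax : ℕ, 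
    ∀ {V : Type} [Fintype V] [DecidableEq V] [Nonempty V] {δ : ℝ} {L : ℕ} {c : ℝ} {E : Г} {A : Finset V → Finset V}, Good d μ δ L c E A → n0 ≤ Ξ →
      ∀ X : Finset V, (X.card : ℝ) ≤ kap d μ * Ξ → ∃ b, bmin ≤ b ∧ b ≤ bmax ∧
      ∃ (ι : Type) (_ : Fintype ι) (φ : ι → Φ → Fin b → V), Tl E A Ц φ ∧ (∀ j i c, φ j i c ∉ X) ∧
      (Ξ : ℝ) ≤ ϑ * Ξ + X.card + Fintype.card ι * Θ * b := by
  obtain ⟨ε0, g, hε0, hg, hstep⟩ := step d hμ hμ1 hϑ hϑ1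
  refine ⟨ε0, hε0, fun ε hε hε1 => ?_⟩
  have hs := hstep ε hε hε1
  have key : ∀ l : ℕ, ∀ bmin : ℕ, 0 < bmin → ∃ n0 bmax : ℕ, 
    ∀ {V : Type} [Fintype V] [DecidableEq V] [Nonempty V] {δ : ℝ} {L : ℕ} {c : ℝ} {E : Г} {A : Finset V → Finset V}, Good d μ δ L c E A → n0 ≤ Ξ →
      ∀ X : Finset V, (X.card : ℝ) ≤ kap d μ * Ξ → ∃ b, bmin ≤ b ∧ b ≤ bmax ∧
      ∃ (ι : Type) (_ : Fintype ι) (φ : ι → Φ → Fin b → V), Tl E A Ц φ ∧ (∀ j i c, φ j i c ∉ X) ∧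
      ((Ξ : ℝ) ≤ ϑ * Ξ + X.card + Fintype.card ι * Θ * b ∨ l * g * Ξ ≤ Fintype.card ι * Θ * b) := by
    intro l
    induction l with
    | zero =>
      intro bmin hb
      refine ⟨0, bmin, fun {V} _ _ _ {δ L c E A} hG hn X hX => ⟨bmin, le_rfl, le_rfl, Empty, inferInstance, fun t => t.elim, ⟨fun t => t.1.elim, fun t => t.elim⟩, fun t => t.elim, Or.inr £⟩⟩
    | succ l ih =>
      intro bmin hb
      obtain ⟨b0, hb0⟩ := hs bmin hb
      choose n1 hn1 using hb0
      obtain ⟨n0, bmax, h⟩ := ih (max b0 bmin) (lt_of_lt_of_le hb (le_max_right _ _))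
      obtain ⟨n2, hn2⟩ : ∃ n2, ∀ b (hb : b0 ≤ b), b ≤ bmax → n1 b hb ≤ n2 := by
        refine ⟨(range (bmax+1)).sup fun b => if hb : b0 ≤ b then n1 b hb else 0, fun b hb hb2 => ?_⟩
        have := Finset.le_sup (f := fun b => if hb : b0 ≤ b then n1 b hb else 0) (mem_range.2 (Nat.lt_succ_of_le hb2))
        simpa only [dif_pos hb] using this
      refine ⟨max n0 n2, max bmax bmin, fun {V} _ _ _ {δ L c E A} hG hn X hX => ?_⟩
      obtain ⟨b, hbl, hbu, ι, hι, φ, hφ, hφX, hcov⟩ := h hG ((le_max_left _ _).trans hn) X hX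
      by_cases hc : ϑ * Ξ + X.card + Fintype.card ι * Θ * b ≤ (Ξ : ℝ)
      · obtain ⟨ι', hι', χ, hχ, hχX, hχc⟩ := hn1 b ((le_max_left _ _).trans hbl) hG ((hn2 b _ hbu).trans ((le_max_right _ _).trans hn)) X hX ι φ hφ hφX hc
        refine ⟨bmin, le_rfl, le_max_right _ _, ι', hι', χ, hχ, hχX, ?_⟩
        rcases hcov with hcov | hcov
        · left
          have : 0 ≤ g * Ξ := by positivity
          linarith
        · right; push_cast at hcov hχc ⊢; linarith
      · exact ⟨b, (le_max_right _ _).trans hbl, hbu.trans (le_max_left _ _), ι, hι, φ, hφ, hφX, Or.inl (not_le.1 hc).le⟩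
  intro bmin hb
  obtain ⟨l, hl⟩ := exists_nat_ge (1/g)
  obtain ⟨n0, bmax, h⟩ := key l bmin hb
  refine ⟨n0, bmax, fun {V} _ _ _ {δ L c E A} hG hn X hX => ?_⟩
  obtain ⟨b, hbl, hbu, ι, hι, φ, hφ, hφX, hcov⟩ := h hG hn X hX
  refine ⟨b, hbl, hbu, ι, hι, φ, hφ, hφX, ?_⟩
  rcases hcov with hcov | hcov
  · exact hcov
  · rw [dli hg] at hl
    have h1 : (1:ℝ) * Ξ ≤ l * g * Ξ := mlr hl §
    have h2 : 0 ≤ ϑ * Ξ := by positivity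
    have h3 : ø ≤ X.card := by positivity
    linarith
section
variable {V : Type} [Fintype V] [DecidableEq V] [Nonempty V]
variable {d : ℕ} {μ δ : ℝ} {L : ℕ} {c : ℝ} {E : Г} {A : Finset V → Finset V}
def Abs' (E : Г) (A : Finset V → Finset V) (ζ : ℝ) (v : Λ) (l : List V) : Prop :=
  ∃ q : Qd d V, Sw E A ζ q ∧ q.l1 = l ∧ q.l2.Perm (l ++ ofFn v)
lemma perm_of_map {r : ℕ} {f g : Fin r → V} (h : univ.val.map f = univ.val.map g) : ∃ σ : Equiv.Perm (Fin r), f = g ∘ σ := by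
  have h1 : ∀ v, Nonempty ({i // f i = v} ≃ {i // g i = v}) := by
    intro v
    have h2 := congrArg (Multiset.count v) h
    rw [Multiset.count_map, Multiset.count_map] at h2
    refine Fintype.card_eq.1 ?_
    rw [Fintype.card_subtype, Fintype.card_subtype]
    simp only [eq_comm (a := v)] at h2
    exact h2
  have e := fun v => (h1 v).some
  refine ⟨((Equiv.sigmaFiberEquiv f).symm.trans (Equiv.sigmaCongrRight e)).trans (Equiv.sigmaFiberEquiv g), ?_⟩
  funext i
  exact ((e (f i)) ⟨i, rfl⟩).2.symm
lemma Abs_perm {r : ℕ} {ζ a : ℝ} {v : Λ} (h : a ≤ TH.dens r (Abs E A ζ v)) :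
    a / (r.factorial : ℝ) ≤ TH.dens r (Abs' E A ζ v) := by
  have h1 : TH.dens r (Abs E A ζ v) ≤ ∑ σ : Equiv.Perm (Fin r), TH.dens r (Abs' E A ζ v) := by
    have : ∀ σ : Equiv.Perm (Fin r), TH.dens r (Abs' E A ζ v) = Ex fun τ : Fin r → V => ind (Abs' E A ζ v (ofFn (τ ∘ σ))) := by
      intro σ
      unfold dens
      rw [← Ex_equiv (Equiv.arrowCongr σ.symm (Equiv.refl V))]
      rfl
    rw [sum_congr rfl (fun σ _ => this σ), ← Ex_sum]
    unfold dens
    refine Ex_mono fun τ => ?_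
    have h3 := ind_exists_le univ (fun σ : Equiv.Perm (Fin r) => Abs' E A ζ v (ofFn (τ ∘ σ)))
    simp only [mem_univ, true_and] at h3
    refine le_trans (ind_mono ?_) h3
    rintro ⟨q, hq, h1, h2⟩
    have hl : q.l1.length = r := by rw [h1.length_eq]; simp
    have e1 : q.l1 = ofFn (fun i : Fin r => q.l1.get (i.cast hl.symm)) := by
      apply List.ext_get <;> simp [hl]
    rw [e1] at h1
    rw [← Multiset.coe_eq_coe, ← Fin.univ_val_map, ← Fin.univ_val_map] at h1
    obtain ⟨σ, hσ⟩ := perm_of_map h1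
    refine ⟨σ, q, hq, by rw [e1, hσ], h2.trans (List.Perm.append_right _ (Equiv.Perm.ofFn_comp_perm σ τ).symm)⟩
  rw [sum_const, card_univ, Fintype.card_perm, Fintype.card_fin, nsmul_eq_mul] at h1
  rw [dli §, mul_comm]
  exact h.trans h1
lemma Qd.ends {q q' : Qd d V} (h : q.l1 = q'.l1) : q.x = q'.x ∧ q.y = q'.y := by
  unfold Qd.l1 at h
  have h2 := List.append_inj' h £
  rw [List.append_assoc, List.append_assoc] at h
  have h1 := List.append_inj h £
  exact ⟨List.ofFn_injective h1.1, List.ofFn_injective h2.2⟩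
def Qd.on (q : Qd d V) : Qd d V := ⟨q.x, q.m', q.m', q.y⟩
lemma Sw.on {ζ : ℝ} {q : Qd d V} (h : Sw E A ζ q) : Sw E A ζ q.on := ⟨h.t2, h.t2, h.lc, h.rc⟩
lemma Qd.on_l1 (q : Qd d V) : q.on.l1 = q.l2 := rfl
lemma Sw.mono {ζ ζ' : ℝ} (hz : ζ' ≤ ζ) {q : Qd d V} (h : Sw E A ζ q) : Sw E A ζ' q :=
  ⟨h.t1, h.t2, hz.trans h.lc, hz.trans h.rc⟩
lemma tight_rounds (rs : List Λ) (h : ∀ a ∈ rs, ∀ b ∈ rs, Mix E a b) : Tight Δ E (rs.flatMap ofFn) := by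
  induction rs with
  | nil => exact Tight.of_short £
  | cons a rs ih =>
    have ih := ih (fun a ha b hb => h a (by simp [ha]) b (by simp [hb]))
    cases rs with
    | nil =>
      have := (h a £ a £).tight
      exact this.infix ⟨[], ofFn a, by simp⟩
    | cons b rs =>
      have h1 := (h a £ b £).tight
      have := h1.glue (by rw [List.flatMap_cons] at ih; exact ih) £
      simpa only [List.flatMap_cons, List.append_assoc] using this
lemma tile {ζ : ℝ} {ι : Type} {b : ℕ} {φ : ι → Φ → Fin b → V} (hT : Tl E A ζ φ) (hb : 2 ≤ b) (j : ι) :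
    ∃ q : Qd d V, Sw E A ζ q ∧ (∀ v, v ∈ q.l1 ↔ ∃ i c, φ j i c = v) ∧ q.l1.length = Δ * b ∧ q.l1.Nodup := by
  obtain ⟨rs, hrs⟩ := ex_ ((List.finRange b).map fun c i => φ j i c : List Λ)
  have hlen : rs.length = b := by rw [hrs]; simp
  have hmem : ∀ a ∈ rs, ∃ c, a = fun i => φ j i c := by
    intro a ha; rw [hrs] at ha; simp only [List.mem_map] at ha; obtain ⟨c, _, h⟩ := ha; exact ⟨c, h.symm⟩
  have hmix : ∀ a ∈ rs, ∀ b ∈ rs, Mix E a b := by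
    intro a ha b hb t ht
    obtain ⟨c1, rfl⟩ := hmem a ha
    obtain ⟨c2, rfl⟩ := hmem b hb
    have := (hT.2 j (fun i => if i.1 < t then c2 else c1)).1.ed
    convert this using 2 with i
    split_ifs <;> rfl
  have hfs : ∀ a ∈ rs, FS E A ζ a := by
    intro a ha; obtain ⟨c, rfl⟩ := hmem a ha; exact hT.2 j fun _ => c
  have ht := tight_rounds rs hmix
  have hv : ∀ v, v ∈ rs.flatMap ofFn ↔ ∃ i c, φ j i c = v := by
    intro v
    rw [hrs]
    simp only [List.mem_flatMap, List.mem_map, List.mem_finRange, true_and, exists_exists_eq_and, List.mem_ofFn, Set.mem_range]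
    exact exists_comm
  have hl : (rs.flatMap ofFn).length = Δ * b := by
    rw [List.length_flatMap, hrs, List.map_map, List.map_congr_left (g := fun _ => d+3) (fun a _ => by simp only [Function.comp, List.length_ofFn])]; simp [mul_comm]
  have hnd : (rs.flatMap ofFn).Nodup := by
    have h1 : (rs.flatMap ofFn).toFinset = univ.image fun t : Φ × Fin b => φ j t.1 t.2 := by
      ext v; rw [List.mem_toFinset, hv]; simp
    have h2 : (rs.flatMap ofFn).toFinset.card = (rs.flatMap ofFn).length := by
      rw [h1, card_image_of_injective, hl]
      · simp
      · intro s t h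
        have := @hT.1 (j, s) (j, t) h
        exact (Prod.mk.inj this).2
    exact Multiset.coe_nodup.1 (Multiset.toFinset_card_eq_card_iff_nodup.1 h2)
  cases rs with
  | nil => simp at hlen; omega
  | cons a rs =>
    rcases List.eq_nil_or_concat rs with rfl | ⟨mid, e, rfl⟩
    · simp at hlen; omega
    · have he : (⟨a, mid.flatMap ofFn, mid.flatMap ofFn, e⟩ : Qd d V).l1 = (a :: mid.concat e).flatMap ofFn := by
        simp [Qd.l1]
      refine ⟨⟨a, mid.flatMap ofFn, mid.flatMap ofFn, e⟩, ⟨?_, ?_, ?_, ?_⟩, ?_⟩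
      · rw [he]; exact ht
      · exact (congrArg (Tight Δ E) he).mpr ht
      · exact (hfs a £).2.2
      · exact (hfs e £).2.1
      · rw [he]; exact ⟨hv, hl, hnd⟩
lemma cyc {R : ℕ} {ζ : ℝ} (qs : List (Qd d V)) (p q0 : Qd d V) (cs : List V) (hp : Sw E A ζ p) (h0 : Sw E A ζ q0) (hqs : ∀ q ∈ qs, Sw E A ζ q)
    (hc : Conns R E q0.y (qs ++ [p]) cs) : ∃ w : List V, Tight Δ E (w ++ ofFn p.x) ∧ ofFn q0.x <+: w ∧
      w.Perm (q0.l1 ++ qs.flatMap Qd.l1 ++ cs) := by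
  induction qs generalizing q0 cs with
  | nil =>
    simp only [List.nil_append] at hc
    obtain ⟨h1, h2⟩ := hc
    have h2 : cs.drop R = [] := h2
    have h3 : cs.take R = cs := by have := List.take_append_drop R cs; rw [h2, List.append_nil] at this; exact this
    rw [h3] at h1
    refine ⟨q0.l1 ++ cs, ?_, ?_, by simp⟩
    · have ht := h0.t1
      unfold Qd.l1 at ht ⊢
      rw [List.append_assoc] at h1
      have := ht.glue h1 £
      simpa only [List.append_assoc] using this
    · exact ⟨q0.m ++ ofFn q0.y ++ cs, by simp [Qd.l1]⟩
  | cons q1 qs ih =>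
    obtain ⟨w, hw, hl1, hl2⟩ := ih (q0.join (cs.take R) q1) (cs.drop R) (h0.join (hqs q1 £) hc.1)
      (fun q h => hqs q (by simp [h])) hc.2
    refine ⟨w, hw, hl1, hl2.trans ?_⟩
    rw [Qd.join_l1, List.flatMap_cons]
    rw [← Multiset.coe_eq_coe]; conv_rhs => rw [← List.take_append_drop R cs]
    simp only [← Multiset.coe_add]; abel
def lastY : Λ → List (Qd d V) → Λ
  | y, [] => y
  | _, q :: qs => lastY q.y qs
lemma lastY_rc {ζ : ℝ} (qs : List (Qd d V)) (y : Λ) (hy : RC E A ζ y) (h : ∀ q ∈ qs, Sw E A ζ q) : RC E A ζ (lastY y qs) := by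
  induction qs generalizing y with
  | nil => exact hy
  | cons q qs ih => exact ih q.y (h q £).rc fun q h' => h q (by simp [h'])
lemma Conns_append {R : ℕ} (qs ts : List (Qd d V)) (y : Λ) (cs1 cs2 : List V) (hl : cs1.length = R * qs.length)
    (h1 : Conns R E y qs cs1) (h2 : Conns R E (lastY y qs) ts cs2) : Conns R E y (qs ++ ts) (cs1 ++ cs2) := by
  induction qs generalizing y cs1 with
  | nil =>
    have : cs1 = [] := h1
    subst this; exact h2
  | cons q qs ih =>
    rw [List.length_cons, Nat.mul_succ] at hl
    refine ⟨?_, ?_⟩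
    · rw [List.take_append_of_le_length ¿]; exact h1.1
    · rw [List.drop_append_of_le_length ¿]
      exact ih q.y (cs1.drop R) (by rw [List.length_drop]; omega) h1.2 h2
lemma Conns_congr {R : ℕ} (qs ts : List (Qd d V)) (y : Λ) (cs : List V)
    (he : qs.map (fun q => (q.x, q.y)) = ts.map fun q => (q.x, q.y)) (h1 : Conns R E y qs cs) : Conns R E y ts cs := by
  induction qs generalizing y cs ts with
  | nil => 
    have : ts = [] := by simpa using he.symm
    subst this; exact h1
  | cons q qs ih =>
    cases ts with
    | nil => simp at he
    | cons t ts =>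
      simp only [List.map_cons, List.cons.injEq, Prod.mk.injEq] at he
      refine ⟨?_, ?_⟩
      · rw [← he.1.1]; exact h1.1
      · rw [← he.1.2]; exact ih ts q.y _ he.2 h1.2
lemma greedy {R : ℕ} {ζ c' : ℝ} (hconn : ∀ y0 x0 : Λ, RC E A ζ y0 → LC E A ζ x0 →
      c' ≤ TH.dens R fun l => Tight Δ E (ofFn y0 ++ l ++ ofFn x0)) (qs : List (Qd d V)) (y : Λ)
    (hy : RC E A ζ y) (hqs : ∀ q ∈ qs, Sw E A ζ q) (X : Finset V)
    (hX : (R:ℝ)^2 + R * (X.card + R * qs.length) < c' * Ξ) :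
    ∃ cs : List V, cs.length = R * qs.length ∧ cs.Nodup ∧ (∀ v ∈ cs, v ∉ X) ∧ Conns R E y qs cs := by
  induction qs generalizing y X with
  | nil => exact ⟨[], by simp, by simp, by simp, rfl⟩
  | cons q qs ih =>
    have hq := hqs q £
    rw [List.length_cons] at hX
    push_cast at hX
    obtain ⟨l, hl, ht, hnd, hav⟩ := dens_find (X := X) (hconn y q.x hy hq.lc) (lt_of_le_of_lt (by
      have : ø ≤ (R:ℝ) * (R * (qs.length + 1)) := by positivity
      linarith) hX)
    obtain ⟨cs, hcl, hcn, hca, hc⟩ := ih q.y hq.rc (fun q h' => hqs q (by simp [h'])) (X ∪ l.toFinset) (lt_of_le_of_lt (by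
      have h1 : ((X ∪ l.toFinset).card : ℝ) ≤ X.card + R := by
        have := (card_union_le X l.toFinset).trans (Nat.add_le_add_left (List.toFinset_card_le l) _)
        rw [hl] at this; exact_mod_cast this
      have := mll h1 (Nat.cast_nonneg (α := ℝ) R)
      linarith) hX)
    refine ⟨l ++ cs, by rw [List.length_append, hl, hcl, List.length_cons]; ring, ?_, ?_, ?_, ?_⟩
    · refine List.nodup_append.2 ⟨hnd, hcn, fun a ha b hb hab => ?_⟩
      exact hca b hb (by rw [← hab]; simp [ha])
    · intro v hv
      rcases List.mem_append.1 hv with h | h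
      · exact hav v h
      · intro h'; exact hca v h (by simp [h'])
    · rw [← hl, List.take_append_of_le_length le_rfl]; simpa using ht
    · rw [← hl, List.drop_append_of_le_length le_rfl]; simp; rw [hl]; exact hc
lemma resv {R : ℕ} {ζ : ℝ} (qs : List (Qd d V)) (y : Λ)
    (hy : RC E A ζ y) (hqs : ∀ q ∈ qs, Sw E A ζ q) (T : Finset (Fin R → V))
    (hT : ∀ y0 x0 : Λ, RC E A ζ y0 → LC E A ζ x0 → ∃ T' ⊆ T, qs.length ≤ T'.card ∧ ∀ τ ∈ T',
      Tight Δ E (ofFn y0 ++ ofFn τ ++ ofFn x0)) :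
    ∃ U : Finset (Fin R → V), U ⊆ T ∧ ∃ cs : List V, (cs : Multiset V) = ∑ τ ∈ U, (ofFn τ : Multiset V) ∧ Conns R E y qs cs := by
  induction qs generalizing y T with
  | nil => exact ⟨∅, by simp, [], by simp, rfl⟩
  | cons q qs ih =>
    have hq := hqs q £
    obtain ⟨T', hT', hc, ht⟩ := hT y q.x hy hq.lc
    rw [List.length_cons] at hc
    obtain ⟨τ, hτ⟩ : T'.Nonempty := card_pos.1 ¿
    obtain ⟨U, hU, cs, hcs, hcc⟩ := ih q.y hq.rc (fun q h' => hqs q (by simp [h'])) (T.erase τ) (by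
      intro y0 x0 h1 h2
      obtain ⟨T'', h3, h4, h5⟩ := hT y0 x0 h1 h2
      refine ⟨T''.erase τ, erase_subset_erase _ h3, ?_, fun τ h => h5 τ (mem_of_mem_erase h)⟩
      have := pred_card_le_card_erase (s := T'') (a := τ)
      rw [List.length_cons] at h4
      omega)
    have hn : τ ∉ U := fun h => by simpa using hU h
    refine ⟨insert τ U, insert_subset (hT' hτ) (hU.trans (erase_subset _ _)), ofFn τ ++ cs, ?_, ?_, ?_⟩
    · rw [sum_insert hn, ← hcs]; rfl
    · rw [List.take_append_of_le_length £, List.take_of_length_le £]; exact ht τ hτ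
    · rw [List.drop_append_of_le_length £, List.drop_of_length_le £, List.nil_append]; exact hcc
lemma assign {r : ℕ} {ζ : ℝ} (vs : List Λ) (T : Finset (Fin r → V)) (q : (Fin r → V) → Qd d V)
    (hq : ∀ τ ∈ T, Sw E A ζ (q τ) ∧ (q τ).l1 = ofFn τ)
    (hT : ∀ v ∈ vs, ∃ T' ⊆ T, vs.length ≤ T'.card ∧ ∀ τ ∈ T', Abs' E A ζ v (ofFn τ)) :
    ∃ g : (Fin r → V) → Qd d V, (∀ τ ∈ T, Sw E A ζ (g τ) ∧ (g τ).x = (q τ).x ∧ (g τ).y = (q τ).y) ∧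
      ∑ τ ∈ T, ((g τ).l1 : Multiset V) = ∑ τ ∈ T, (ofFn τ : Multiset V) + (vs.flatMap ofFn : List V) := by
  induction vs generalizing T with
  | nil =>
    refine ⟨q, fun τ h => ⟨(hq τ h).1, rfl, rfl⟩, ?_⟩
    rw [sum_congr rfl fun τ h => by rw [(hq τ h).2]]; simp
  | cons v vs ih =>
    obtain ⟨T', hT', hc, ht⟩ := hT v £
    rw [List.length_cons] at hc
    obtain ⟨τ0, hτ⟩ : T'.Nonempty := card_pos.1 ¿
    obtain ⟨g, hg, hs⟩ := ih (T.erase τ0) (fun τ h => hq τ (mem_of_mem_erase h)) (by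
      intro v' hv'
      obtain ⟨T'', h3, h4, h5⟩ := hT v' (by simp [hv'])
      refine ⟨T''.erase τ0, erase_subset_erase _ h3, ?_, fun τ h => h5 τ (mem_of_mem_erase h)⟩
      have := pred_card_le_card_erase (s := T'') (a := τ0)
      rw [List.length_cons] at h4
      omega)
    obtain ⟨p, hp, hp1, hp2⟩ := ht τ0 hτ
    have h0 := hT' hτ
    have he := Qd.ends (hp1.trans (hq τ0 h0).2.symm)
    refine ⟨fun τ => if τ = τ0 then p.on else g τ, ?_, ?_⟩
    · intro τ h
      by_cases hh : τ = τ0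
      · subst hh; simp only [if_true]; exact ⟨hp.on, he⟩
      · simp only [if_neg hh]; exact hg τ (mem_erase.2 ⟨hh, h⟩)
    · rw [← add_sum_erase _ _ h0, ← add_sum_erase T (fun τ => (ofFn τ : Multiset V)) h0]
      rw [sum_congr rfl (g := fun τ => ((g τ).l1 : Multiset V)) (fun τ h => by beta_reduce; rw [if_neg (ne_of_mem_erase h)]), hs]
      simp only [if_true, Qd.on_l1, Multiset.coe_eq_coe.2 hp2, List.flatMap_cons, ← Multiset.coe_add]
      abel
lemma closed_of_tight {k : ℕ} {w p : List V} (hk : 0 < k) (hpk : p.length = k) (hp : p <+: w) (ht : Tight k E (w ++ p)) : IsClosedTightWalk k E w := by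
  have hl := hp.length_le
  refine ⟨by omega, fun i hi => ?_⟩
  obtain ⟨t, rfl⟩ := hp
  generalize hw : p ++ t = w at *
  apply ht
  · rw [List.rotate_eq_drop_append_take hi.le]
    refine List.IsInfix.trans ?_ (List.drop_suffix i (w ++ p)).isInfix
    rw [List.drop_append_of_le_length hi.le]
    refine List.IsPrefix.isInfix ?_
    by_cases h : k ≤ (w.drop i).length
    · rw [List.take_append_of_le_length h]
      exact (List.take_prefix _ _).trans (List.prefix_append _ _)
    · rw [List.take_append, List.take_of_length_le ¿, List.prefix_append_right_inj, List.take_take]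
      rw [List.length_drop] at h
      have : (min (k - (w.drop i).length) i) ≤ p.length := by omega
      generalize min (k - (w.drop i).length) i = z at *; rw [← hw, List.take_append_of_le_length this]; exact List.take_prefix _ _
  · rw [List.length_take, List.length_rotate]; omega
lemma split_tuples {α : Type} (k m : ℕ) (l : List α) (h : l.length = k * m) : ∃ vs : List (Fin k → α), vs.length = m ∧ vs.flatMap ofFn = l := by
  induction m generalizing l with
  | zero =>
    have : l = [] := by simpa using h
    exact ⟨[], rfl, by simp [this]⟩
  | succ m ih =>
    rw [Nat.mul_succ] at h
    obtain ⟨vs, h1, h2⟩ := ih (l.drop k) (by rw [List.length_drop]; omega)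
    have hl : (l.take k).length = k := by rw [List.length_take]; omega
    have e1 : ofFn (fun i : Fin k => (l.take k).get (i.cast hl.symm)) = l.take k := by
      apply List.ext_get <;> simp [hl]
    refine ⟨(fun i : Fin k => (l.take k).get (i.cast hl.symm)) :: vs, by simp [h1], ?_⟩
    rw [List.flatMap_cons, e1, h2, List.take_append_drop]
noncomputable def flT {r : ℕ} (T : Finset (Fin r → V)) : Multiset V := ∑ τ ∈ T, (ofFn τ : Multiset V)
lemma flT_card {r : ℕ} (T : Finset (Fin r → V)) : Multiset.card (flT T) = T.card * r := by
  unfold flT; rw [Multiset.card_sum]; simp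
lemma mem_flT {r : ℕ} {T : Finset (Fin r → V)} {v : V} : v ∈ flT T ↔ ∃ τ ∈ T, ∃ a, τ a = v := by
  unfold flT; rw [Multiset.mem_sum]; simp
lemma flT_le {r : ℕ} {U T : Finset (Fin r → V)} (h : U ⊆ T) : flT U ≤ flT T := sum_le_sum_of_subset h
lemma flT_nodup {r : ℕ} (T : Finset (Fin r → V)) (h1 : ∀ τ ∈ T, Injective τ) (h2 : ∀ τ ∈ T, ∀ τ' ∈ T, τ ≠ τ' → ∀ a b, τ a ≠ τ' b) :
    (flT T).Nodup := by
  induction T using Finset.induction_on with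
  | empty => simp [flT]
  | insert τ T hτ ih =>
    have : flT (insert τ T) = (ofFn τ : Multiset V) + flT T := by unfold flT; rw [sum_insert hτ]
    rw [this, Multiset.nodup_add]
    refine ⟨?_, ih (fun σ h => h1 σ (mem_insert_of_mem h)) (fun σ h σ' h' => h2 σ (mem_insert_of_mem h) σ' (mem_insert_of_mem h')), ?_⟩
    · rw [Multiset.coe_nodup]; exact List.nodup_ofFn.2 (h1 τ (mem_insert_self _ _))
    · rw [Multiset.disjoint_left]
      intro v hv hv'
      obtain ⟨σ, hσ, b, hb⟩ := mem_flT.1 hv'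
      rw [Multiset.mem_coe, List.mem_ofFn] at hv
      obtain ⟨a, ha⟩ := hv
      exact h2 τ (mem_insert_self _ _) σ (mem_insert_of_mem hσ) (fun h => hτ (h ▸ hσ)) a b (ha.trans hb.symm)
def flQ (qs : List (Qd d V)) : Multiset V := (qs.flatMap Qd.l1 : List V)
lemma flQ_append (a b : List (Qd d V)) : flQ (a ++ b) = flQ a + flQ b := by
  unfold flQ; rw [List.flatMap_append, Multiset.coe_add]
lemma flQ_cons (a : Qd d V) (b : List (Qd d V)) : flQ (a :: b) = (a.l1 : Multiset V) + flQ b := by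
  unfold flQ; rw [List.flatMap_cons, Multiset.coe_add]
lemma flQ_map {ι : Type} (T : Finset ι) (g : ι → Qd d V) : flQ (T.toList.map g) = ∑ t ∈ T, ((g t).l1 : Multiset V) := by
  have : ∀ l : List ι, flQ (l.map g) = (l.map fun t => ((g t).l1 : Multiset V)).sum := by
    intro l; induction l with
    | nil => simp [flQ]
    | cons a l ih => rw [List.map_cons, flQ_cons, ih, List.map_cons, List.sum_cons]
  rw [this, Finset.sum_map_toList]
lemma dvd_flQ {k : ℕ} (qs : List (Qd d V)) (h : ∀ q ∈ qs, k ∣ q.l1.length) : k ∣ Multiset.card (flQ qs) := by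
  induction qs with
  | nil => simp [flQ]
  | cons a l ih =>
    rw [flQ_cons, Multiset.card_add]
    exact dvd_add (h a £) (ih fun q hq => h q (by simp [hq]))
lemma card_flQ {k : ℕ} (qs : List (Qd d V)) (h : ∀ q ∈ qs, q.l1.length = k) : Multiset.card (flQ qs) = qs.length * k := by
  induction qs with
  | nil => simp [flQ]
  | cons a l ih =>
    rw [flQ_cons, Multiset.card_add, ih fun q hq => h q (by simp [hq]), Multiset.coe_card, h a £, List.length_cons]; ring
lemma finish {ζ : ℝ} {R r1 M : ℕ} (hR : Δ ∣ R) (hr1 : Δ ∣ r1) (q0 : Qd d V) (sp : List (Qd d V))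
    (hq0 : Sw E A ζ q0) (hsp : ∀ q ∈ sp, Sw E A ζ q) (hl0 : q0.l1.length = 2*Δ+1) (hls : ∀ q ∈ sp, q.l1.length = 2*Δ+1)
    (hmod : Δ ∣ Ξ - (sp.length + 1))
    (T1 : Finset (Fin r1 → V)) (q : (Fin r1 → V) → Qd d V) (hq : ∀ τ ∈ T1, Sw E A ζ (q τ) ∧ (q τ).l1 = ofFn τ)
    (cs1 : List V) (hcl : cs1.length = R * (sp ++ T1.toList.map q).length) (hcs : Conns R E q0.y (sp ++ T1.toList.map q) cs1)
    (ts : List (Qd d V)) (hts : ∀ q ∈ ts, Sw E A ζ q) (hlt : ∀ q ∈ ts, Δ ∣ q.l1.length)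
    (T2 : Finset (Fin R → V)) (hT2 : ∀ y0 x0 : Λ, RC E A ζ y0 → LC E A ζ x0 → ∃ T' ⊆ T2, ts.length + 1 ≤ T'.card ∧ ∀ τ ∈ T',
      Tight Δ E (ofFn y0 ++ ofFn τ ++ ofFn x0))
    (hnd : (flT T2 + (flT T1 + (flQ (q0 :: sp) + ((cs1 : Multiset V) + flQ ts)))).Nodup)
    (hM : Ξ ≤ Multiset.card (flT T1 + (flQ (q0 :: sp) + ((cs1 : Multiset V) + flQ ts))) + Δ * M)
    (hcap : ∀ v : Λ, ∃ T' ⊆ T1, M ≤ T'.card ∧ ∀ τ ∈ T', Abs' E A ζ v (ofFn τ)) :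
    ∃ w : List V, w.Nodup ∧ w.toFinset = univ ∧ IsClosedTightWalk Δ E w := by
  have hsw1 : ∀ p ∈ sp ++ T1.toList.map q, Sw E A ζ p := by
    intro p hp
    rw [List.mem_append, List.mem_map] at hp
    rcases hp with h | ⟨τ, hτ, rfl⟩
    · exact hsp p h
    · exact (hq τ (by simpa using hτ)).1
  obtain ⟨U, hU, cs2, hcs2, hcc2⟩ := resv (R := R) (ts ++ [q0]) (lastY q0.y (sp ++ T1.toList.map q)) (lastY_rc _ _ hq0.rc hsw1)
    (by intro p hp; rw [List.mem_append, List.mem_singleton] at hp; rcases hp with h | rfl; exacts [hts p h, hq0]) T2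
    (by simpa using hT2)
  have hcc := Conns_append _ _ _ _ _ hcl hcs hcc2
  obtain ⟨B, hB⟩ := ex_ (flT U + (flT T1 + (flQ (q0 :: sp) + ((cs1 : Multiset V) + flQ ts))) : Multiset V)
  have hBn : B.Nodup := by
    rw [hB]; exact Multiset.nodup_of_le (add_le_add_left (flT_le hU) _) hnd
  have hcB : Multiset.card B + (univ \ B.toFinset).card = Ξ := by
    rw [← Multiset.toFinset_card_of_nodup hBn, add_comm, card_sdiff_add_card_eq_card (subset_univ _), card_univ]
  have hcardB : Multiset.card B = U.card * R + (T1.card * r1 + ((sp.length + 1) * (2*Δ+1) + (R * (sp ++ T1.toList.map q).length + Multiset.card (flQ ts)))) := by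
    rw [hB]; simp only [Multiset.card_add, flT_card, Multiset.coe_card, hcl]
    rw [card_flQ (q0::sp) (k := 2*Δ+1) (by
      intro p hp; rw [List.mem_cons] at hp; rcases hp with rfl | h; exacts [hl0, hls p h])]
    simp only [List.length_cons]
  have hdiv : Δ ∣ (univ \ B.toFinset).card := by
    have hle : (sp.length + 1) ≤ Multiset.card B := by rw [hcardB]; nlinarith [Nat.zero_le (U.card * R), Nat.zero_le (T1.card * r1), Nat.zero_le (R * (sp ++ T1.toList.map q).length)]
    have h1 : Δ ∣ Multiset.card B - (sp.length+1) := by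
      have : Multiset.card B - (sp.length+1) = U.card * R + (T1.card * r1 + (Δ * (2 * (sp.length + 1)) + (R * (sp ++ T1.toList.map q).length + Multiset.card (flQ ts)))) := by
        rw [hcardB, show (sp.length + 1) * (2*Δ+1) = Δ * (2 * (sp.length+1)) + (sp.length + 1) by ring]; omega
      rw [this]
      exact dvd_add (hR.mul_left _) (dvd_add (hr1.mul_left _) (dvd_add (dvd_mul_right _ _) (dvd_add (hR.mul_right _) (dvd_flQ ts hlt))))
    have h2 : (univ \ B.toFinset).card = (Ξ - (sp.length+1)) - (Multiset.card B - (sp.length+1)) := by omega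
    rw [h2]; exact Nat.dvd_sub hmod h1
  obtain ⟨m, hm⟩ := hdiv
  obtain ⟨vs, hvl, hvs⟩ := split_tuples Δ m (univ \ B.toFinset).toList (by rw [length_toList, hm])
  have hmM : m ≤ M := by
    have h1 : Multiset.card (flT T1 + (flQ (q0 :: sp) + ((cs1 : Multiset V) + flQ ts))) ≤ Multiset.card B := by
      rw [hB]; exact Multiset.card_le_card (Multiset.le_add_left _ _)
    have : Δ * m ≤ Δ * M := by omega
    exact Nat.le_of_mul_le_mul_left this ¿
  obtain ⟨g, hg, hgs⟩ := assign vs T1 q hq (by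
    intro v _
    obtain ⟨T', h1, h2, h3⟩ := hcap v
    exact ⟨T', h1, by omega, h3⟩)
  have hcc' : Conns R E q0.y ((sp ++ T1.toList.map g ++ ts) ++ [q0]) (cs1 ++ cs2) := by
    refine Conns_congr _ _ _ _ ?_ hcc
    simp only [List.map_append, List.map_map, List.append_assoc]
    congr 2
    refine List.map_congr_left fun τ hτ => ?_
    have := hg τ (by simpa using hτ)
    simp [this.2.1, this.2.2]
  obtain ⟨w, hw, hpre, hperm⟩ := cyc _ _ _ _ hq0 hq0 (by
    intro p hp
    simp only [List.mem_append, List.mem_map] at hp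
    rcases hp with (h | ⟨τ, hτ, rfl⟩) | h
    · exact hsp p h
    · exact (hg τ (by simpa using hτ)).1
    · exact hts p h) hcc'
  have hwm : (w : Multiset V) = (univ : Finset V).val := by
    rw [Multiset.coe_eq_coe.2 hperm, ← Multiset.coe_add, ← Multiset.coe_add, ← Multiset.coe_add]
    change _ + flQ _ + _ = _
    rw [flQ_append, flQ_append, flQ_map, hgs, hvs, hcs2]
    have h1 : (((univ \ B.toFinset).toList : List V) : Multiset V) + B = univ.val := by
      rw [coe_toList]
      have h2 : B = B.toFinset.val := by rw [Multiset.toFinset_val, Multiset.dedup_eq_self.2 hBn]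
      conv_lhs => rw [h2]
      rw [show B.toFinset.val.toFinset = B.toFinset by ext; simp]
      rw [← Finset.disjUnion_val _ _ sdiff_disjoint, disjUnion_eq_union, sdiff_union_of_subset (subset_univ _)]
    rw [← h1, hB, flQ_cons]
    unfold flT
    abel
  refine ⟨w, ?_, ?_, ?_⟩
  · rw [← Multiset.coe_nodup, hwm]; exact univ.nodup
  · ext v; rw [List.mem_toFinset, ← Multiset.mem_coe, hwm]; simp
  · exact closed_of_tight ¿ £ hpre hw
lemma specials {ψ ζ : ℝ} (h : ψ ≤ TH.dens (2*Δ+1) fun l => ∃ q : Qd d V, Sw E A ζ q ∧ q.l1 = l) (m : ℕ) (X : Finset V)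
    (hX : ((2*Δ+1 : ℕ):ℝ)^2 + (2*Δ+1:ℕ) * (X.card + (2*Δ+1:ℕ) * m) < ψ * Ξ) :
    ∃ qs : List (Qd d V), qs.length = m ∧ (∀ q ∈ qs, Sw E A ζ q) ∧ (∀ q ∈ qs, q.l1.length = 2*Δ+1) ∧ (flQ qs).Nodup ∧ ∀ v ∈ flQ qs, v ∉ X := by
  generalize 2*Δ+1 = N at *
  induction m generalizing X with
  | zero => exact ⟨[], rfl, by simp, by simp, by simp [flQ], by simp [flQ]⟩
  | succ m ih =>
    push_cast at hX
    obtain ⟨l, hl, ⟨q, hq, hql⟩, hnd, hav⟩ := dens_find (X := X) h (lt_of_le_of_lt (by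
      have : ø ≤ (N:ℝ) * (N * (m + 1)) := by positivity
      linarith) hX)
    obtain ⟨qs, h1, h2, h3, h4, h5⟩ := ih (X ∪ l.toFinset) (lt_of_le_of_lt (by
      have h1 : ((X ∪ l.toFinset).card : ℝ) ≤ X.card + N := by
        have := (card_union_le X l.toFinset).trans (Nat.add_le_add_left (List.toFinset_card_le l) _)
        rw [hl] at this; exact_mod_cast this
      have := mll h1 (Nat.cast_nonneg (α := ℝ) N)
      linarith) hX)
    refine ⟨q :: qs, by simp [h1], ?_, ?_, ?_, ?_⟩
    · intro p hp; rw [List.mem_cons] at hp; rcases hp with rfl | hp; exacts [hq, h2 p hp]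
    · intro p hp; rw [List.mem_cons] at hp; rcases hp with rfl | hp; exacts [by rw [hql, hl], h3 p hp]
    · rw [flQ_cons, hql, Multiset.nodup_add]
      refine ⟨Multiset.coe_nodup.2 hnd, h4, ?_⟩
      rw [Multiset.disjoint_left]
      intro v hv hv'
      exact h5 v hv' (by simp; right; simpa using hv)
    · intro v hv
      rw [flQ_cons, hql, Multiset.mem_add] at hv
      rcases hv with hv | hv
      · exact hav v (by simpa using hv)
      · intro h'; exact h5 v hv (by simp [h'])
lemma tiles_list {ζ : ℝ} {ι : Type} [Fintype ι] {b : ℕ} {φ : ι → Φ → Fin b → V} (hT : Tl E A ζ φ) (hb : 2 ≤ b) :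
    ∃ ts : List (Qd d V), ts.length = Fintype.card ι ∧ (∀ q ∈ ts, Sw E A ζ q) ∧ (∀ q ∈ ts, q.l1.length = Δ * b) ∧
      (flQ ts).Nodup ∧ ∀ v ∈ flQ ts, ∃ j i c, φ j i c = v := by
  choose q h1 h2 h3 h4 using fun j => tile hT hb j
  have hl : ∀ p ∈ (univ : Finset ι).toList.map q, p.l1.length = Δ * b := by
    intro p hp; obtain ⟨j, _, rfl⟩ := List.mem_map.1 hp; exact h3 j
  have hm : ∀ v, v ∈ flQ ((univ : Finset ι).toList.map q) ↔ ∃ j i c, φ j i c = v := by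
    intro v
    rw [flQ_map, Multiset.mem_sum]
    simp only [mem_univ, true_and, Multiset.mem_coe, h2]
  refine ⟨(univ : Finset ι).toList.map q, by simp, ?_, hl, ?_, fun v h => (hm v).1 h⟩
  · intro p hp; obtain ⟨j, _, rfl⟩ := List.mem_map.1 hp; exact h1 j
  · rw [← Multiset.toFinset_card_eq_card_iff_nodup, card_flQ _ hl]
    have : (flQ ((univ : Finset ι).toList.map q)).toFinset = univ.image fun t : ι × Φ × Fin b => Я := by
      ext v; rw [Multiset.mem_toFinset, hm]; simp
    rw [this, card_image_of_injective _ hT.1]; simp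
set_option maxHeartbeats 2000000 in
lemma build {ζ1 ζ2 c1 ψ a0 a η1 η2 N2 ϑ kp Z n : ℝ} {R r1 bmin M : ℕ} (hn : n = Ξ) (hz : ζ2 ≤ ζ1)
    (hR : Δ ∣ R) (hr1 : Δ ∣ r1) (hbm : 2 ≤ bmin)
    (hconn : ∀ y0 x0 : Λ, RC E A ζ1 y0 → LC E A ζ1 x0 →
      c1 ≤ TH.dens R fun l => Tight Δ E (ofFn y0 ++ l ++ ofFn x0))
    (hspec : ψ ≤ TH.dens (2*Δ+1) fun l => ∃ q : Qd d V, Sw E A ζ1 q ∧ q.l1 = l)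
    (habs : ∀ v : Λ, a0 ≤ TH.dens r1 (Abs' E A ζ1 v))
    (hres : ∃ T : Finset (Fin R → V), (∀ τ ∈ T, Injective τ) ∧ (∀ τ ∈ T, ∀ τ' ∈ T, τ ≠ τ' → ∀ a b, τ a ≠ τ' b) ∧
        (T.card : ℝ) ≤ η2 * n ∧ ∀ y0 x0 : Λ, RC E A ζ2 y0 → LC E A ζ2 x0 → ∃ T' ⊆ T, N2 ≤ (T'.card : ℝ) ∧
          ∀ τ ∈ T', Tight Δ E (ofFn y0 ++ ofFn τ ++ ofFn x0))
    (hsel : ∀ P : Λ → (Fin r1 → V) → Prop, (∀ i, a ≤ Ex fun τ => ind (P i τ)) →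
      ∃ T : Finset (Fin r1 → V), (∀ τ ∈ T, Injective τ) ∧ (∀ τ ∈ T, ∀ τ' ∈ T, τ ≠ τ' → ∀ a b, τ a ≠ τ' b) ∧
        (T.card : ℝ) ≤ η1 * n ∧ ∀ i, (M : ℝ) ≤ ((T.filter fun τ => ind (P i τ) = 1).card : ℝ))
    (hcov : ∀ X : Finset V, (X.card : ℝ) ≤ kp * n → ∃ b, bmin ≤ b ∧
      ∃ (ι : Type) (_ : Fintype ι) (φ : ι → Φ → Fin b → V), Tl E A ζ2 φ ∧ (∀ j i c, φ j i c ∉ X) ∧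
      n ≤ ϑ * n + X.card + Fintype.card ι * Θ * b)
    (hZR : (R:ℝ) ≤ Z) (hZr : (r1:ℝ) ≤ Z) (hZk : ((2*Δ+1:ℕ):ℝ) ≤ Z)
    (hη1 : 0 ≤ η1) (hη2 : η2 ≤ η1) (hη20 : 0 ≤ η2)
    (hc1 : Z^2 + Z * (3*Z*η1*n + 2*Z^2) < c1 * n) (hψ : Z^2 + Z * (3*Z*η1*n + 2*Z^2) < ψ * n)
    (hkp : 3*Z*η1*n + 2*Z^2 ≤ kp * n) (ha : a ≤ a0 - (Z^2 + Z * (Z * η2 * n)) / n)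
    (hM : (ϑ + Z * η2) * n ≤ M) (hN2 : n / bmin + 1 ≤ N2) :
    ∃ w : List V, w.Nodup ∧ w.toFinset = univ ∧ IsClosedTightWalk Δ E w := by
  have hnp : 0 < n := by rw [hn]; exact_mod_cast Fintype.card_pos
  have hZ0 : 0 ≤ Z := le_trans (ncn _) hZR
  obtain ⟨T2, t2i, t2d, t2c, t2r⟩ := hres
  have hF2 : (Multiset.card (flT T2) : ℝ) ≤ Z * η2 * n := by
    rw [flT_card]; push_cast
    calc (T2.card:ℝ) * R ≤ (η2 * n) * Z := mul_le_mul t2c hZR (ncn _) (mul_nonneg (by assumption) hnp.le)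
      _ = _ := by ring
  have hX2 : ((flT T2).toFinset.card : ℝ) ≤ Z * η2 * n := le_trans (by exact_mod_cast Multiset.toFinset_card_le _) hF2
  obtain ⟨T, ti, td, tc, tcap⟩ := hsel (fun v τ => Abs' E A ζ1 v (ofFn τ) ∧ (ofFn τ).Nodup ∧ ∀ u ∈ ofFn τ, u ∉ (flT T2).toFinset) (by
    intro v
    have h1 := dens_avoid r1 (Abs' E A ζ1 v) (flT T2).toFinset
    have h2 := habs v
    have h3 : ((r1:ℝ)^2 + r1 * (flT T2).toFinset.card) / Ξ ≤ (Z^2 + Z * (Z * η2 * n)) / n := by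
      rw [← hn]
      refine ddr (add_le_add (pll (ncn _) hZr 2) (mul_le_mul hZr hX2 (ncn _) hZ0)) hnp.le
    refine le_trans ?_ (le_of_eq (rfl : TH.dens r1 (fun l => Abs' E A ζ1 v l ∧ l.Nodup ∧ ∀ u ∈ l, u ∉ (flT T2).toFinset) = _))
    linarith)
  classical
  obtain ⟨T1, hT1⟩ := ex_ (T.filter fun τ => (∃ v : Λ, Abs' E A ζ1 v (ofFn τ)) ∧ ∀ u ∈ ofFn τ, u ∉ (flT T2).toFinset)
  have hT1T : T1 ⊆ T := by rw [hT1]; exact filter_subset _ _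
  have hq : ∀ τ : Fin r1 → V, ∃ q : Qd d V, τ ∈ T1 → Sw E A ζ1 q ∧ q.l1 = ofFn τ := by
    intro τ
    by_cases h : τ ∈ T1
    · have h' := h
      rw [hT1, mem_filter] at h'
      obtain ⟨-, ⟨v, q, h1, h2, -⟩, -⟩ := h'
      exact ⟨q, fun _ => ⟨h1, h2⟩⟩
    · obtain ⟨x⟩ : Nonempty Λ := inferInstance
      exact ⟨⟨x, [], [], x⟩, fun h' => absurd h' h⟩
  choose q hq using hq
  have hF1 : (Multiset.card (flT T1) : ℝ) ≤ Z * η1 * n := by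
    rw [flT_card]; push_cast
    have : (T1.card : ℝ) ≤ η1 * n := le_trans (by exact_mod_cast card_le_card hT1T) tc
    calc (T1.card:ℝ) * r1 ≤ (η1 * n) * Z := mul_le_mul this hZr (ncn _) (mul_nonneg (by assumption) hnp.le)
      _ = _ := by ring
  have hcap : ∀ v : Λ, ∃ T' ⊆ T1, M ≤ T'.card ∧ ∀ τ ∈ T', Abs' E A ζ1 v (ofFn τ) := by
    intro v
    refine ⟨_, ?_, Nat.cast_le.1 (tcap v), ?_⟩
    · intro τ hτ
      rw [mem_filter, ind_iff] at hτ
      rw [hT1, mem_filter]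
      exact ⟨hτ.1, ⟨v, hτ.2.1⟩, hτ.2.2.2⟩
    · intro τ hτ
      rw [mem_filter, ind_iff] at hτ
      exact hτ.2.1
  have hn21 : (flT T2 + flT T1).Nodup := by
    rw [Multiset.nodup_add]
    refine ⟨flT_nodup _ t2i t2d, flT_nodup _ (fun τ h => ti τ (hT1T h)) (fun τ h τ' h' => td τ (hT1T h) τ' (hT1T h')), ?_⟩
    rw [Multiset.disjoint_right]
    intro v hv hv'
    obtain ⟨τ, hτ, b, rfl⟩ := mem_flT.1 hv
    rw [hT1, mem_filter] at hτ
    exact hτ.2.2 (τ b) (by rw [List.mem_ofFn]; exact ⟨b, rfl⟩) (Multiset.mem_toFinset.2 hv')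
  obtain ⟨η2n, h2n⟩ := ex_ (Z * η2 * n)
  obtain ⟨η1n, h1n⟩ := ex_ (Z * η1 * n)
  have h12n : η2n ≤ η1n := by
    rw [h2n, h1n]; exact mlr (mll hη2 hZ0) hnp.le
  have h3n : 3 * Z * η1 * n = 3 * η1n := by rw [h1n]; ring
  rw [h3n] at hc1 hψ hkp
  rw [← h1n] at hF1
  rw [← h2n] at hF2
  obtain ⟨m, hm⟩ := ex_ (Ξ % Δ + Δ)
  have hm2 : (m : ℝ) ≤ Z := by
    refine le_trans ?_ hZk
    have := Nat.mod_lt (Ξ) (show 0 < d+3 by omega)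
    exact_mod_cast (by omega : m ≤ 2*Δ+1)
  have hsq : ((2*Δ+1:ℕ):ℝ) * m ≤ Z^2 := by
    rw [sq]; exact mul_le_mul hZk hm2 (ncn _) hZ0
  have hx21 : ((flT T2 + flT T1).toFinset.card : ℝ) ≤ 2 * η1n := by
    have h1 : ((flT T2 + flT T1).toFinset.card : ℝ) ≤ (Multiset.card (flT T2 + flT T1) : ℕ) := by exact_mod_cast Multiset.toFinset_card_le _
    rw [Multiset.card_add] at h1; push_cast at h1
    linarith
  have h1n0 : 0 ≤ η1n := by rw [h1n]; exact mul_nonneg (mul_nonneg hZ0 hη1) hnp.le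
  obtain ⟨sps, hspl, hsps, hspk, hspn, hspx⟩ := specials hspec m (flT T2 + flT T1).toFinset (by
    rw [← hn]
    refine lt_of_le_of_lt (add_le_add (pll (ncn _) hZk 2) (mul_le_mul hZk ?_ (add_nonneg (ncn _) (mul_nonneg (ncn _) (ncn _))) hZ0)) hψ
    have := sq_nonneg Z
    linarith)
  obtain ⟨q0, sp, rfl⟩ : ∃ q0 sp, sps = q0 :: sp := by
    cases sps with
    | nil => simp at hspl; omega
    | cons a l => exact ⟨a, l, rfl⟩
  rw [List.length_cons] at hspl
  have hn3 : (flT T2 + (flT T1 + flQ (q0 :: sp))).Nodup := by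
    rw [← add_assoc, Multiset.nodup_add]
    refine ⟨hn21, hspn, ?_⟩
    rw [Multiset.disjoint_right]
    intro v hv hv'
    exact hspx v hv (Multiset.mem_toFinset.2 hv')
  have hF3 : (Multiset.card (flQ (q0 :: sp)) : ℝ) ≤ Z^2 := by
    rw [card_flQ _ hspk, List.length_cons, hspl]; push_cast at hsq ⊢; linarith
  have hx3 : ((flT T2 + (flT T1 + flQ (q0 :: sp))).toFinset.card : ℝ) ≤ 2 * η1n + Z^2 := by
    have h1 : ((flT T2 + (flT T1 + flQ (q0 :: sp))).toFinset.card : ℝ) ≤ (Multiset.card (flT T2 + (flT T1 + flQ (q0 :: sp))) : ℕ) := by exact_mod_cast Multiset.toFinset_card_le _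
    rw [Multiset.card_add, Multiset.card_add] at h1; push_cast at h1
    linarith
  have hsw1 : ∀ p ∈ sp ++ T1.toList.map q, Sw E A ζ1 p := by
    intro p hp
    rw [List.mem_append, List.mem_map] at hp
    rcases hp with h | ⟨τ, hτ, rfl⟩
    · exact hsps p (List.mem_cons_of_mem _ h)
    · exact (hq τ (by simpa using hτ)).1
  have hlen : (R:ℝ) * (sp ++ T1.toList.map q).length ≤ Z^2 + η1n := by
    have h1 : ((sp ++ T1.toList.map q).length : ℝ) ≤ Z + η1 * n := by
      rw [List.length_append, List.length_map, length_toList]; push_cast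
      have h2 : (T1.card : ℝ) ≤ η1 * n := le_trans (by exact_mod_cast card_le_card hT1T) tc
      have h3 : (sp.length : ℝ) ≤ m := by exact_mod_cast (by omega : sp.length ≤ m)
      linarith
    calc (R:ℝ) * (sp ++ T1.toList.map q).length ≤ Z * (Z + η1 * n) := mul_le_mul hZR h1 (ncn _) hZ0
      _ = _ := by rw [h1n]; ring
  obtain ⟨cs, hcl, hcn, hcx, hcc⟩ := greedy hconn (sp ++ T1.toList.map q) q0.y (hsps q0 List.mem_cons_self).rc hsw1
    (flT T2 + (flT T1 + flQ (q0 :: sp))).toFinset (by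
      rw [← hn]
      refine lt_of_le_of_lt (add_le_add (pll (ncn _) hZR 2) (mul_le_mul hZR ?_ (add_nonneg (ncn _) (mul_nonneg (ncn _) (ncn _))) hZ0)) hc1
      linarith)
  have hn4 : (flT T2 + (flT T1 + (flQ (q0 :: sp) + (cs : Multiset V)))).Nodup := by
    rw [← add_assoc (flT T1), ← add_assoc, Multiset.nodup_add]
    refine ⟨hn3, Multiset.coe_nodup.2 hcn, ?_⟩
    rw [Multiset.disjoint_right]
    intro v hv hv'
    exact hcx v hv (Multiset.mem_toFinset.2 hv')
  have hcl' : (cs.length : ℝ) ≤ Z^2 + η1n := by rw [hcl]; push_cast; push_cast at hlen; exact hlen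
  have hx4 : ((flT T2 + (flT T1 + (flQ (q0 :: sp) + (cs : Multiset V)))).toFinset.card : ℝ) ≤ Multiset.card (flT T2) + (Multiset.card (flT T1) + (Multiset.card (flQ (q0 :: sp)) + cs.length)) := by
    have h1 : ((flT T2 + (flT T1 + (flQ (q0 :: sp) + (cs : Multiset V)))).toFinset.card : ℝ) ≤ (Multiset.card (flT T2 + (flT T1 + (flQ (q0 :: sp) + (cs : Multiset V)))) : ℕ) := by exact_mod_cast Multiset.toFinset_card_le _
    simp only [Multiset.card_add, Multiset.coe_card] at h1; push_cast at h1
    exact h1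
  obtain ⟨b, hb, ι, _, φ, hTl, hφ, hcv⟩ := hcov (flT T2 + (flT T1 + (flQ (q0 :: sp) + (cs : Multiset V)))).toFinset ¶
  obtain ⟨ts, htl, hts, htk, htn, htx⟩ := tiles_list hTl (hbm.trans hb)
  have hn5 : (flT T2 + (flT T1 + (flQ (q0 :: sp) + ((cs : Multiset V) + flQ ts)))).Nodup := by
    have e : flT T2 + (flT T1 + (flQ (q0 :: sp) + ((cs : Multiset V) + flQ ts))) = flT T2 + (flT T1 + (flQ (q0 :: sp) + (cs : Multiset V))) + flQ ts := by
      simp only [add_assoc]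
    rw [e, Multiset.nodup_add]
    refine ⟨hn4, htn, ?_⟩
    rw [Multiset.disjoint_right]
    intro v hv hv'
    obtain ⟨j, i, c, rfl⟩ := htx v hv
    exact hφ j i c (Multiset.mem_toFinset.2 hv')
  have hct : (Multiset.card (flQ ts) : ℝ) = Fintype.card ι * Θ * b := by
    rw [card_flQ _ htk, htl]; push_cast; ring
  have hctn : Multiset.card (flQ ts) ≤ Ξ := by
    rw [← Multiset.toFinset_card_of_nodup htn]; exact card_le_univ _
  have hlb : (ts.length : ℝ) + 1 ≤ N2 := by
    refine le_trans ?_ hN2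
    have : (ts.length : ℝ) ≤ n / bmin := by
      rw [le_div_iff₀ (by exact_mod_cast (by omega : 0 < bmin)), htl, hn]
      rw [card_flQ _ htk, htl] at hctn
      have : Fintype.card ι * bmin ≤ Ξ := le_trans (Nat.mul_le_mul_left _ (hb.trans (Nat.le_mul_of_pos_left _ ¿))) hctn
      exact_mod_cast this
    linarith
  refine finish (ζ := ζ2) (M := M) hR hr1 q0 sp ((hsps q0 List.mem_cons_self).mono hz) (fun p hp => (hsps p (List.mem_cons_of_mem _ hp)).mono hz) (hspk q0 List.mem_cons_self)
    (fun p hp => hspk p (List.mem_cons_of_mem _ hp)) ?_ T1 q (fun τ h => ⟨(hq τ h).1.mono hz, (hq τ h).2⟩) cs hcl hcc ts hts (fun p hp => by rw [htk p hp]; exact dvd_mul_right _ _)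
    T2 ?_ hn5 ?_ ?_
  · rw [hspl, hm]
    have h1 := Nat.div_add_mod (Ξ) Δ
    have : Ξ - (Ξ % Δ + Δ) = Δ * (Ξ / Δ) - Δ := by omega
    rw [this]; exact Nat.dvd_sub (dvd_mul_right _ _) (dvd_refl _)
  · intro y0 x0 hy hx
    obtain ⟨T', h1, h2, h3⟩ := t2r y0 x0 hy hx
    exact ⟨T', h1, by exact_mod_cast hlb.trans h2, h3⟩
  · have h1 : (Ξ : ℝ) ≤ Multiset.card (flT T1) + (Multiset.card (flQ (q0 :: sp)) + (cs.length + Multiset.card (flQ ts))) + Δ * M := by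
      have h2 : ϑ * n + η2n ≤ M := by rw [h2n]; linarith
      have h3 : (M:ℝ) ≤ Δ * M := by
        have : ø ≤ (d+2) * M := mul_nonneg (by have := Nat.cast_nonneg (α := ℝ) d; linarith) (ncn _)
        linarith only [this]
      rw [← hn]; linarith
    simp only [Multiset.card_add, Multiset.coe_card]
    exact_mod_cast h1
  · intro v
    obtain ⟨T', h1, h2, h3⟩ := hcap v
    refine ⟨T', h1, h2, fun τ h => ?_⟩
    obtain ⟨p, hp, h5⟩ := h3 τ h
    exact ⟨p, hp.mono hz, h5⟩
end
section
lemma arith {Z ρ a a0 c1 ψ kp η1 η2 c2 n : ℝ} {bmin : ℕ} (hZ : 1 ≤ Z) (hρ : 0 < ρ) (ha : ρ ≤ a) (hac : a ≤ 1) (haa : a ≤ a0/2) (hc : ρ ≤ c1) (hψ : ρ ≤ ψ)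
    (hk : ρ ≤ kp) (h1 : η1 * (64 * Z^2) = ρ) (hc2 : 0 < c2) (hc21 : c2 ≤ 1) (h2 : η2 * (64 * Z^2) = c2 * a * η1) (hn : 0 < n)
    (n1 : 4 * (Z^2 + 2*Z^3) / n ≤ ρ) (n2 : 32 / n ≤ a * η1) (n3 : 32 / n ≤ c2 * η2) (hb : 32 / (c2 * η2) ≤ bmin) :
    0 < η1 ∧ 0 < η2 ∧ η2 ≤ η1 ∧ η1 ≤ 1 ∧
    Z^2 + Z * (3*Z*η1*n + 2*Z^2) < c1 * n ∧ Z^2 + Z * (3*Z*η1*n + 2*Z^2) < ψ * n ∧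
    3*Z*η1*n + 2*Z^2 ≤ kp * n ∧ a ≤ a0 - (Z^2 + Z * (Z * η2 * n)) / n ∧
    (a*η1/64 + Z * η2) * n + 1 ≤ a*η1/16*n ∧ n / bmin + 1 ≤ c2*η2/16*n := by
  have z2 : 1 ≤ Z^2 := one_le_pow₀ hZ
  have z3 : Z ≤ Z^2 := by nlinarith
  have a0' : 0 < a := by linarith
  have e1 : 0 < η1 := by
    by_contra h; push Not at h; nlinarith
  have cae : 0 < c2 * a * η1 := by positivity
  have e2 : 0 < η2 := by
    by_contra h; push Not at h; nlinarith
  have ca : c2 * a ≤ 1 := by nlinarith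
  have e3 : c2 * a * η1 ≤ η1 := by nlinarith
  have e4 : η1 ≤ 1 := by nlinarith
  have e5 : η2 ≤ η1 := by nlinarith
  have e6 : c2 * a * η1 ≤ a * η1 := by nlinarith [mul_pos a0' e1]
  rw [dli hn] at n1 n2 n3
  have ρn : 0 < ρ * n := by positivity
  have k1 : Z^2*η1*n = ρ * n / 64 := by rw [← h1]; ring
  have k2 : Z^2 + Z * (3*Z*η1*n + 2*Z^2) < ρ * n := by
    have : 0 ≤ Z^3 := by positivity
    linarith
  have k3 : 3*Z*η1*n + 2*Z^2 ≤ Z^2 + Z * (3*Z*η1*n + 2*Z^2) := by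
    have : 0 ≤ (3*Z*η1*n + 2*Z^2) := by positivity
    nlinarith
  have k4 : Z * η2 ≤ a * η1 / 64 := by nlinarith
  have k5 : Z^2 * η2 ≤ a / 64 := by nlinarith
  refine ⟨e1, e2, e5, e4, ?_, ?_, ?_, ?_, ?_, ?_⟩
  · exact k2.trans_le (mlr hc hn.le)
  · exact k2.trans_le (mlr hψ hn.le)
  · exact k3.trans (k2.le.trans (mlr hk hn.le))
  · have : (Z^2 + Z * (Z * η2 * n)) / n ≤ a := by
      rw [dli hn]
      have : Z^2 * η2 * n ≤ a / 64 * n := mlr k5 hn.le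
      have : ρ * n ≤ a * n := mlr ha hn.le
      have : 0 ≤ Z^3 := by positivity
      linarith
    linarith
  · have : Z * η2 * n ≤ a * η1 / 64 * n := mlr k4 hn.le
    linarith
  · have ce : 0 < c2 * η2 := by positivity
    have hb0 : ø < bmin := lt_of_lt_of_le § hb
    rw [dli ce] at hb
    have : n / bmin ≤ c2 * η2 / 32 * n := by
      rw [dli hb0]
      have := mlr hb hn.le
      linarith
    linarith
end
section
variable {V : Type} [Fintype V] [DecidableEq V] [Nonempty V]
variable {d : ℕ} {μ δ : ℝ} {L : ℕ} {c : ℝ} {E : Г} {A : Finset V → Finset V}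
lemma reserve {ζ2 c2 η2 n : ℝ} {R : ℕ} (hn : n = Ξ) (hc2 : c2 ≤ 1)
    (hconn : ∀ y0 x0 : Λ, RC E A ζ2 y0 → LC E A ζ2 x0 →
      c2 ≤ TH.dens R fun l => Tight Δ E (ofFn y0 ++ l ++ ofFn x0))
    (hs : ∀ {ι : Type} [Fintype ι] (P : ι → (Fin R → V) → Prop), (Fintype.card ι : ℝ) ≤ (Ξ : ℝ)^(2*Δ) →
      (∀ i, c2 ≤ Ex fun τ => ind (P i τ)) →
      ∃ T : Finset (Fin R → V), (∀ τ ∈ T, Injective τ) ∧ (∀ τ ∈ T, ∀ τ' ∈ T, τ ≠ τ' → ∀ a b, τ a ≠ τ' b) ∧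
        (T.card : ℝ) ≤ η2 * Ξ ∧ ∀ i, c2 * η2 / 16 * Ξ ≤ ((T.filter fun τ => ind (P i τ) = 1).card : ℝ)) :
    ∃ T : Finset (Fin R → V), (∀ τ ∈ T, Injective τ) ∧ (∀ τ ∈ T, ∀ τ' ∈ T, τ ≠ τ' → ∀ a b, τ a ≠ τ' b) ∧
        (T.card : ℝ) ≤ η2 * n ∧ ∀ y0 x0 : Λ, RC E A ζ2 y0 → LC E A ζ2 x0 → ∃ T' ⊆ T, c2*η2/16*n ≤ (T'.card : ℝ) ∧
          ∀ τ ∈ T', Tight Δ E (ofFn y0 ++ ofFn τ ++ ofFn x0) := by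
  obtain ⟨T, h1, h2, h3, h4⟩ := hs (ι := Λ × Λ)
    (fun i τ => RC E A ζ2 i.1 → LC E A ζ2 i.2 → Tight Δ E (ofFn i.1 ++ ofFn τ ++ ofFn i.2))
    (by rw [Fintype.card_prod, Fintype.card_fun, Fintype.card_fin]; push_cast; rw [← pow_add, two_mul])
    (by
      rintro ⟨y0, x0⟩
      by_cases hr : RC E A ζ2 y0 ∧ LC E A ζ2 x0
      · refine le_trans (hconn y0 x0 hr.1 hr.2) ?_
        exact Ex_mono fun τ => ind_mono fun h _ _ => h
      · refine le_trans hc2 (le_of_eq ?_)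
        rw [← Ex_const (Ω := Fin R → V) 1]
        refine Ex_congr fun τ => ?_
        rw [ind_true]; intro a b; exact absurd ⟨a, b⟩ hr)
  subst hn
  refine ⟨T, h1, h2, h3, fun y0 x0 hy hx => ⟨_, filter_subset _ _, h4 (y0, x0), fun τ hτ => ?_⟩⟩
  exact ind_iff.1 (mem_filter.1 hτ).2 hy hx
lemma Good.weaken (hG : Good d μ δ L c E A) {μ' δ' c' : ℝ} (h1 : μ' ≤ μ) (h2 : δ' ≤ δ) (h3 : c' ≤ c) : Good d μ' δ' L c' E A where
  card := hG.card
  dens S hS := by have := hG.dens S hS; linarith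
  big := hG.big
  edges S hS := by have := hG.edges S hS; linarith
  deg S hS p hp := h2.trans (hG.deg S hS p hp)
  walk S hS p hp q hq := h3.trans (hG.walk S hS p hp q hq)
end
lemma zz_pos {d : ℕ} {ε : ℝ} (h : 0 < ε) : 0 < zz d ε := by unfold zz; positivity
set_option maxHeartbeats 1000000 in
lemma main_good (d L : ℕ) {μ δ c : ℝ} (hμ : 0 < μ) (hμ1 : μ ≤ 1/2) (hδ : 0 < δ) (hδ1 : δ ≤ 1) (hc : 0 < c) (hc1 : c ≤ 1) :
    ∃ n0 : ℕ, ∀ {V : Type} [Fintype V] [DecidableEq V] [Nonempty V] {E : Г} {A : Finset V → Finset V},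
      Good d μ δ L c E A → n0 ≤ Ξ → ∃ w : List V, w.Nodup ∧ w.toFinset = univ ∧ IsClosedTightWalk Δ E w := by
  obtain ⟨R, hR⟩ := ex_ (cR d L)
  obtain ⟨r1, hr1⟩ := ex_ (absR d R)
  have hRd : Δ ∣ R := by rw [hR]; exact Dvd.intro _ rfl
  have hr1d : Δ ∣ r1 := by rw [hr1]; exact dvd_add (Dvd.intro _ rfl) (Dvd.intro_left _ rfl)
  have hRp : 0 < R := by rw [hR]; unfold cR; positivity
  have hr1p : 0 < r1 := by rw [hr1]; unfold absR; positivity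
  obtain ⟨ε1, hε1⟩ := ex_ (min (μ/(18*((d:ℝ)+3))) (δ/36))
  have ε1p : 0 < ε1 := by rw [hε1]; exact lt_min § §
  have ε1a : ε1 ≤ μ/(18*((d:ℝ)+3)) := by rw [hε1]; exact min_le_left _ _
  have ε1b : ε1 ≤ δ/36 := by rw [hε1]; exact min_le_right _ _
  obtain ⟨c1', m1, c1p', hconn1⟩ := conn d δ L hμ hμ1 hc hc1 (zz_pos (d := d) ε1p)
  obtain ⟨a0, ha0⟩ := ex_ (absC d μ c1' / (r1.factorial : ℝ))
  have a0p : 0 < a0 := by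
    rw [ha0]; refine div_pos ?_ (by exact_mod_cast Nat.factorial_pos _)
    unfold absC; positivity
  obtain ⟨a, ha⟩ := ex_ (min (a0/2) 1)
  have ap : 0 < a := by rw [ha]; exact lt_min ¶ one_pos
  have a1 : a ≤ 1 := by rw [ha]; exact min_le_right _ _
  have a2 : a ≤ a0/2 := by rw [ha]; exact min_le_left _ _
  obtain ⟨ψ, hψ⟩ := ex_ ((δ/36)^(3^(d+4)))
  have ψp : 0 < ψ := by rw [hψ]; positivity
  obtain ⟨kp, hkp⟩ := ex_ (kap d μ)
  have kpp : 0 < kp := by rw [hkp]; exact kap_pos d hμ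
  obtain ⟨Z, hZ⟩ := ex_ (((2*Δ+1:ℕ):ℝ) + R + r1 : ℝ)
  have q1 : (1:ℝ) ≤ ((2*Δ+1:ℕ):ℝ) := by exact_mod_cast Nat.le_add_left _ _
  have q2 : ø ≤ R := ncn _
  have q3 : ø ≤ r1 := ncn _
  have Z1 : 1 ≤ Z := by linarith
  obtain ⟨ρ, hρ⟩ := ex_ (min (min a c1') (min ψ kp))
  have ρp : 0 < ρ := by rw [hρ]; exact lt_min (lt_min ap c1p') (lt_min ψp kpp)
  have ρa : ρ ≤ a := by rw [hρ]; exact (min_le_left _ _).trans (min_le_left _ _)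
  have ρc : ρ ≤ c1' := by rw [hρ]; exact (min_le_left _ _).trans (min_le_right _ _)
  have ρψ : ρ ≤ ψ := by rw [hρ]; exact (min_le_right _ _).trans (min_le_left _ _)
  have ρk : ρ ≤ kp := by rw [hρ]; exact (min_le_right _ _).trans (min_le_right _ _)
  obtain ⟨η1, hη1⟩ := ex_ (ρ/(64*Z^2))
  have Z2p : ø < 64*Z^2 := by positivity
  have η1e : η1 * (64*Z^2) = ρ := by rw [hη1]; field_simp
  have η1p : 0 < η1 := by rw [hη1]; positivity
  have η11 : η1 ≤ 1 := by
    rw [hη1, div_le_one Z2p]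
    linarith [one_le_pow₀ Z1 (n := 2)]
  have aη : 0 < a * η1 := by positivity
  obtain ⟨ε0, ε0p, hcov⟩ := cover d hμ ¶ (ϑ := a*η1/64) ¶ (by linarith [mul_le_one₀ a1 η1p.le η11])
  obtain ⟨ε2, hε2⟩ := ex_ (min ε0 ε1)
  have ε2p : 0 < ε2 := by rw [hε2]; exact lt_min ε0p ε1p
  have ε20 : ε2 ≤ ε0 := by rw [hε2]; exact min_le_left _ _
  have ε21 : ε2 ≤ ε1 := by rw [hε2]; exact min_le_right _ _
  have hzz : zz d ε2 ≤ zz d ε1 := by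
    unfold zz; exact pll ¶ ¶ _
  obtain ⟨c2', m2, c2p', hconn2⟩ := conn d δ L hμ hμ1 hc hc1 (zz_pos (d := d) ε2p)
  obtain ⟨c2, hc2⟩ := ex_ (min c2' 1)
  have c2p : 0 < c2 := by rw [hc2]; exact lt_min c2p' one_pos
  have c21 : c2 ≤ 1 := by rw [hc2]; exact min_le_right _ _
  have c22 : c2 ≤ c2' := by rw [hc2]; exact min_le_left _ _
  obtain ⟨η2, hη2⟩ := ex_ (c2*a*η1/(64*Z^2))
  have η2e : η2 * (64*Z^2) = c2*a*η1 := by rw [hη2]; field_simp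
  have η2p : 0 < η2 := by rw [hη2]; positivity
  have cη : 0 < c2 * η2 := by positivity
  obtain ⟨b0, hb0⟩ := exists_nat_ge (32/(c2*η2))
  obtain ⟨bmin, hbm⟩ := ex_ (max 2 b0)
  have bm2 : 2 ≤ bmin := by rw [hbm]; exact le_max_left _ _
  have bm3 : 32/(c2*η2) ≤ bmin := hb0.trans (by rw [hbm]; exact_mod_cast le_max_right _ _)
  obtain ⟨m3, bmax, hcov⟩ := hcov ε2 ε2p ε20 bmin ¿
  have s1 : η1 * (64 * (r1:ℝ)^2) ≤ a := by
    have : (r1:ℝ)^2 ≤ Z^2 := pll q3 ¶ 2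
    have := mll this η1p.le
    linarith
  have s2 : η2 * (64 * (R:ℝ)^2) ≤ c2 := by
    have : (R:ℝ)^2 ≤ Z^2 := pll q2 ¶ 2
    have h1 : η2 * (64 * (R:ℝ)^2) ≤ c2 * (a * η1) := by
      have := mll this η2p.le
      linarith
    exact h1.trans (mul_le_of_le_one_right c2p.le (mul_le_one₀ a1 η1p.le η11))
  obtain ⟨m4, hsel1⟩ := select r1 Δ hr1p ap a1 η1p s1
  obtain ⟨m5, hsel2⟩ := select R (2*Δ) hRp c2p c21 η2p s2
  obtain ⟨m6, h6⟩ := ev_div (4*(Z^2+2*Z^3)) ρp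
  obtain ⟨m7, h7⟩ := ev_div 32 aη
  obtain ⟨m8, h8⟩ := ev_div 32 cη
  obtain ⟨m9, h9⟩ := ev_div (((d:ℝ)+2)^2) (τ := μ/9) ¶
  refine ⟨m1+m2+m3+m4+m5+m6+m7+m8+m9+72*Ы^2, ?_⟩
  intro V _ _ _ E A hG hN
  obtain ⟨n, hn⟩ := ex_ (Ξ : ℝ)
  have hn0 : 0 < n := by rw [hn]; exact_mod_cast Fintype.card_pos
  have h6 := h6 (Ξ) ¿
  have h7 := h7 (Ξ) ¿
  have h8 := h8 (Ξ) ¿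
  have h9 := h9 (Ξ) ¿
  rw [← hn] at h6 h7 h8
  obtain ⟨-, -, r3, -, r6, r7, r8, r9, r10, r11⟩ := arith (kp := kp) (c1 := c1') (ψ := ψ) (a0 := a0) Z1 ρp ρa a1 a2 ρc ρψ ρk η1e c2p c21 η2e hn0 h6 h7 h8 bm3
  have hconn1 := hconn1 E A hG ¿
  have hconn2 := hconn2 E A hG ¿
  rw [← hR] at hconn1 hconn2
  refine build (ζ1 := zz d ε1) (ζ2 := zz d ε2) (c1 := c1') (ψ := ψ) (a0 := a0) (a := a) (η1 := η1) (η2 := η2) (N2 := c2*η2/16*n) (ϑ := a*η1/64) (kp := kp) (Z := Z) (R := R) (r1 := r1) (bmin := bmin) (M := ⌊a*η1/16*n⌋₊)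
    hn hzz hRd hr1d bm2 hconn1 ?_ ?_ ?_ ?_ ?_ ¶ ¶ ¶ η1p.le r3 η2p.le r6 r7 r8 r9 ?_ r11
  · rw [hψ]; exact hG.spec hμ.le hδ.le hδ1 ε1p ε1b ¿
  · intro v
    rw [ha0]
    refine Abs_perm ?_
    rw [hr1]
    exact hG.absorber hμ hμ1 ε1p ε1a h9 c1p'.le hconn1 v
  · exact reserve hn c21 (fun y0 x0 hy hx => c22.trans (hconn2 y0 x0 hy hx)) (hsel2 ¿)
  · intro P hP
    obtain ⟨T, t1, t2, t3, t4⟩ := hsel1 (V := V) ¿ P (by rw [Fintype.card_fun, Fintype.card_fin]; push_cast; exact le_rfl) hP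
    rw [← hn] at t3 t4
    refine ⟨T, t1, t2, t3, fun i => le_trans (Nat.floor_le ?_) (t4 i)⟩
    exact mul_nonneg ¶ hn0.le
  · intro X hX
    rw [hkp, hn] at hX
    obtain ⟨b, b1, -, ι, i1, φ, p1, p2, p3⟩ := hcov hG ¿ X hX
    rw [← hn] at p3
    exact ⟨b, b1, ι, i1, φ, p1, p2, p3⟩
  · have := Nat.lt_floor_add_one (a*η1/16*n)
    linarith
section
lemma pair_count {B : Type} [DecidableEq B] (V : Finset B) (E : Finset (Finset B)) (d : ℕ) (hE : ∀ e ∈ E, e ⊆ V ∧ e.card = d+3)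
    (S : Finset V) (hS : S.card = d+1) (hV : V.Nonempty) :
    2 * ((E.filter fun e => S.map (Embedding.subtype _) ⊆ e).card : ℝ) / (V.card:ℝ)^2 ≤
      Ex fun p : V => Ex fun q : V => ind (insert p (insert q S) ∈ (univ : Г).filter fun e => e.map (Embedding.subtype _) ∈ E) := by
  classical
  obtain ⟨S', hS'⟩ := ex_ (S.map (Embedding.subtype (· ∈ V)))
  have hm : ∀ p q : V, insert p (insert q S) ∈ ((univ : Г).filter fun e => e.map (Embedding.subtype _) ∈ E) ↔
      insert p.1 (insert q.1 S') ∈ E := by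
    intro p q
    rw [mem_filter, map_insert, map_insert, hS']; simp
  obtain ⟨P, hP⟩ := ex_ (univ.filter fun t => insert t.1.1 (insert t.2.1 S') ∈ E : Finset (V × V))
  have h1 : (Ex fun p : V => Ex fun q : V => ind (insert p (insert q S) ∈ (univ : Г).filter fun e => e.map (Embedding.subtype _) ∈ E))
      = (P.card : ℝ) / (V.card:ℝ)^2 := by
    have : (Ex fun t : V × V => ind (t ∈ P)) = (P.card:ℝ) / (V.card:ℝ)^2 := by
      rw [Ex_ind_card, Fintype.card_prod, Fintype.card_coe]; push_cast; rw [sq]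
    rw [← this, Ex_prod]
    refine Ex_congr fun p => Ex_congr fun q => ind_congr ?_
    rw [hm, hP, mem_filter]; simp
  rw [h1, ← hS']
  refine ddr ?_ (sq_nonneg _)
  have hc : S'.card = d+1 := by rw [hS', card_map, hS]
  obtain ⟨F, hF⟩ := ex_ (E.filter fun e => S' ⊆ e)
  rw [← hF]
  have h2 : F.card * 2 ≤ P.card := by
    rw [card_eq_sum_card_fiberwise (s := P) (t := F) (f := fun t => insert t.1.1 (insert t.2.1 S'))]
    · rw [← smul_eq_mul]
      refine card_nsmul_le_sum _ _ _ fun e he => ?_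
      rw [hF, mem_filter] at he
      obtain ⟨heV, hek⟩ := hE e he.1
      have hd : (e \ S').card = 2 := by rw [card_sdiff_of_subset he.2, hek, hc]; omega
      obtain ⟨x, y, hxy, hxye⟩ := card_eq_two.1 hd
      have hx : x ∈ e \ S' := by rw [hxye]; simp
      have hy : y ∈ e \ S' := by rw [hxye]; simp
      have hu : insert x (insert y S') = e := by
        have := sdiff_union_of_subset he.2
        rw [hxye] at this
        rw [← this]; ext z; simp [or_assoc]
      have hu' : insert y (insert x S') = e := by rw [Finset.insert_comm]; exact hu
      have hxV := heV (mem_sdiff.1 hx).1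
      have hyV := heV (mem_sdiff.1 hy).1
      have hne : ((⟨x, hxV⟩, ⟨y, hyV⟩) : V × V) ≠ (⟨y, hyV⟩, ⟨x, hxV⟩) := by
        intro h; exact hxy (congrArg (fun t => t.1.1) h)
      rw [← card_pair hne]
      refine card_le_card ?_
      intro t ht
      rw [mem_insert, mem_singleton] at ht
      rw [mem_filter, hP, mem_filter]
      rcases ht with rfl | rfl
      · exact ⟨⟨mem_univ _, by rw [hu]; exact he.1⟩, hu⟩
      · exact ⟨⟨mem_univ _, by rw [hu']; exact he.1⟩, hu'⟩
    · intro t ht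
      rw [mem_coe, hP, mem_filter] at ht
      rw [mem_coe, hF, mem_filter]
      exact ⟨ht.2, fun z hz => mem_insert_of_mem (mem_insert_of_mem hz)⟩
  have : (F.card:ℝ) * 2 ≤ P.card := by exact_mod_cast h2
  linarith
lemma num {μ n : ℝ} {d : ℕ} (hμ : 0 < μ) (hμ1 : μ ≤ 1) (hn : 0 < n) (h : 4 * (2*(d:ℝ)+3) / n ≤ μ) {F : ℝ}
    (hF : (5/9 + μ) * ((n - Ы) * (n - Ы - 1) / 2) ≤ F) : 5/9 + μ/2 ≤ 2 * F / n^2 := by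
  rw [dli hn] at h
  rw [le_div_iff₀ §]
  have hd : ø ≤ d := ncn _
  have h1 : n^2 - (2*d+3)*n ≤ (n - Ы) * (n - Ы - 1) := by nlinarith
  have h2 := mll h1 (show 0 ≤ 5/9+μ by linarith)
  have h3 : (2*d+3)*n*(5/9+μ) ≤ (2*d+3)*n*2 := mll ¶ §
  have h4 := mlr h hn.le
  nlinarith
lemma walk_back {B : Type} [DecidableEq B] (V : Finset B) (E : Finset (Finset B)) {k : ℕ}
    (h : ∃ w : List V, w.Nodup ∧ w.toFinset = univ ∧
      IsClosedTightWalk k ((univ : Г).filter fun e => e.map (Embedding.subtype _) ∈ E) w) :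
    HasTightHamCycle k V E := by
  obtain ⟨w, h1, h2, h3, h4⟩ := h
  refine ⟨w.map Subtype.val, h1.map Subtype.val_injective, ?_, ?_, ?_⟩
  · ext x
    simp only [List.mem_toFinset, List.mem_map]
    constructor
    · rintro ⟨a, -, rfl⟩; exact a.2
    · intro hx
      refine ⟨⟨x, hx⟩, ?_, rfl⟩
      rw [← List.mem_toFinset, h2]; exact mem_univ _
  · rw [List.length_map]; exact h3
  · intro i hi
    rw [List.length_map] at hi
    have := (mem_filter.1 (h4 i hi)).2
    convert this using 1
    rw [← List.map_rotate, ← List.map_take]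
    ext x
    simp only [List.mem_toFinset, List.mem_map, mem_map, Embedding.subtype_apply]
end
end TH
/-- `hc_{k-2}(k) ≤ 5/9`. -/
theorem tight_hamilton_threshold_k_sub_two (k : ℕ) (hk : 3 ≤ k) (μ : ℝ) (hμ : 0 < μ) :
    ∃ n₀ : ℕ, ∀ (B : Type) [DecidableEq B], ∀ (V : Finset B) (E : Finset (Finset B)),
      n₀ ≤ V.card → (∀ e ∈ E, e ⊆ V ∧ e.card = k) →
      (∀ S ⊆ V, S.card = k - 2 →
        ((5 / 9 : ℝ) + μ) * (((V.card - (k - 2)).choose (k - (k - 2)) : ℕ) : ℝ)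
          ≤ ((E.filter fun e => S ⊆ e).card : ℝ)) →
      HasTightHamCycle k V E := by
  obtain ⟨d, rfl⟩ : ∃ d, k = d + 3 := ⟨k - 3, by omega⟩
  have e1 : d + 3 - 2 = d + 1 := by omega
  have e2 : d + 3 - (d + 1) = 2 := by omega
  rw [e1, e2]
  obtain ⟨ν, hν⟩ : ∃ ν, ν = min μ 1 := ⟨_, rfl⟩
  have ν0 : 0 < ν := by rw [hν]; exact lt_min hμ one_pos
  have ν1 : ν ≤ 1 := by rw [hν]; exact min_le_right _ _
  have νμ : ν ≤ μ := by rw [hν]; exact min_le_left _ _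
  obtain ⟨μ', δ, L, c, hμ', hδ, hc, hgood⟩ := TH.good_exists d (μ := ν/2) (by linarith) (by linarith)
  obtain ⟨n1, hmain⟩ := TH.main_good d L (μ := min μ' (1/2)) (δ := min δ 1) (c := min c 1) (lt_min hμ' (by norm_num)) (min_le_right _ _)
    (lt_min hδ one_pos) (min_le_right _ _) (lt_min hc one_pos) (min_le_right _ _)
  obtain ⟨n2, h2⟩ := TH.ev_div (4 * (2*(d:ℝ)+3)) ν0
  refine ⟨n1 + n2 + d + 6, ?_⟩
  intro B _ V E hn hE hdeg
  have hne : V.Nonempty := Finset.card_pos.1 (by omega)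
  haveI : Nonempty V := hne.to_subtype
  have hcV : Fintype.card V = V.card := Fintype.card_coe V
  refine TH.walk_back V E ?_
  have hVp : (0:ℝ) < V.card := by exact_mod_cast Finset.card_pos.2 hne
  obtain ⟨A, hA⟩ := hgood ((Finset.univ : Finset (Finset V)).filter fun e => e.map (Function.Embedding.subtype _) ∈ E) (by omega)
    (by intro e he
        rw [Finset.mem_filter] at he
        have := (hE _ he.2).2
        rwa [Finset.card_map] at this)
    (by intro S hS
        refine le_trans ?_ (TH.pair_count V E d hE S hS hne)
        refine TH.num ν0 ν1 hVp (h2 V.card (by omega)) ?_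
        have := hdeg (S.map (Function.Embedding.subtype _)) (by
          intro x hx; obtain ⟨a, -, rfl⟩ := Finset.mem_map.1 hx; exact a.2) (by rw [Finset.card_map, hS])
        rw [Nat.cast_choose_two, Nat.cast_sub (by omega)] at this
        push_cast at this
        refine le_trans ?_ this
        refine mul_le_mul_of_nonneg_right (by linarith) ?_
        have : ((d:ℝ) + 6) ≤ V.card := by exact_mod_cast (by omega : d + 6 ≤ V.card)
        refine div_nonneg (mul_nonneg ?_ ?_) ?_ <;> linarith)
  exact hmain (hA.weaken (min_le_left _ _) (min_le_left _ _) (min_le_left _ _)) (by omega)
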